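/- Let n, m, p ∈ ℕ with either n = m = p = 1 or gcd(n,m) ≥ 2, let τ > 1, and let ψ(r) = r^{−τ}. Then the Hausdorff dimension of the set W of (x,y) ∈ [0,1)² such that |aⁿx + bᵐy − cᵖ| < (max(aⁿ,bᵐ))^{−τ} for infinitely many (a,b,c) ∈ ℕ²×ℤ_{≥0} equals 1 + min{1, (1/n + 1/m + 1/p)/(τ + 1)}. -/

import Mathlib

section
open MeasureTheory Set Filter Topology ENNReal NNReal

/-- The half-open interval `[0, 1/2)`; all integrals are taken over products of it. -/
def halfIco : Set ℝ := Ico 0 (1 / 2)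

/-- Integral of `g x y z` over the cube `[0, 1/2)³`. -/
noncomputable def cubeInt (g : ℝ → ℝ → ℝ → ℝ≥0∞) : ℝ≥0∞ :=
  ∫⁻ x in halfIco, ∫⁻ y in halfIco, ∫⁻ z in halfIco, g x y z

/-- Integral of a density over the square `[0, 1/2)²`. -/
noncomputable def squareMass (g : ℝ × ℝ → ℝ≥0∞) : ℝ≥0∞ :=
  ∫⁻ x in halfIco, ∫⁻ y in halfIco, g (x, y)

/-- The `t`-energies of the vertical slices of a density, integrated over the slices. -/
noncomputable def sliceEnergy (t : ℝ) (g : ℝ × ℝ → ℝ≥0∞) : ℝ≥0∞ :=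
  cubeInt fun x y y' => g (x, y) * g (x, y') * edist y y' ^ (-t)

lemma le_mul_add_inv_mul_sq {c : ℝ≥0∞} (hc : c ≠ 0) (hc' : c ≠ ⊤) (v : ℝ≥0∞) :
    v ≤ c + c⁻¹ * (v * v) := by
  rcases le_total v c with h | h
  · exact h.trans le_self_add
  · calc v = 1 * v := (one_mul v).symm
      _ ≤ (c⁻¹ * v) * v := by
        gcongr
        calc (1 : ℝ≥0∞) = c⁻¹ * c := (ENNReal.inv_mul_cancel hc hc').symm
          _ ≤ c⁻¹ * v := by gcongr
      _ = c⁻¹ * (v * v) := by ring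
      _ ≤ _ := le_add_self

lemma sum_indicator_mul_le_one {V : ℕ → Set (ℝ × ℝ)} (hd : Pairwise (Function.onFun Disjoint V))
    (p : ℝ × ℝ) (b : ℕ → ℝ≥0∞) (hb : ∀ i, b i ≤ 1) :
    ∑' i, (V i).indicator (fun _ => (1 : ℝ≥0∞)) p * b i ≤ 1 := by
  by_cases h : ∃ i, p ∈ V i
  · obtain ⟨i, hi⟩ := h
    rw [tsum_eq_single i]
    · simpa [hi] using hb i
    · intro j hj
      have : p ∉ V j := fun hpj => (Set.disjoint_left.1 (hd hj) hpj hi)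
      simp [this]
  · push Not at h
    simp [h]

lemma slice_mass_le {G : ℝ × ℝ → ℝ≥0∞} (hG : Measurable G) {V : ℕ → Set (ℝ × ℝ)}
    (hV : ∀ i, MeasurableSet (V i)) (hd : Pairwise (Function.onFun Disjoint V))
    (p : ℕ → ℝ × ℝ) (ρ : ℕ → ℝ) (hρ : ∀ i, 0 < ρ i)
    (hVb : ∀ i, V i ⊆ Metric.closedBall (p i) (ρ i))
    {t : ℝ} (ht : 0 < t) {l : ℝ≥0∞} (hl : l ≠ 0) (hl' : l ≠ ⊤) (x : ℝ)
    (hcov : ∀ y ∈ halfIco, G (x, y) ≠ 0 → (x, y) ∈ ⋃ i, V i) :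
    ∫⁻ y in halfIco, G (x, y) ≤
      (∑' i, l * ENNReal.ofReal (2 * ρ i) ^ t *
        (Metric.closedBall (p i).1 (ρ i)).indicator (fun _ => 1) x) +
      l⁻¹ * ∫⁻ y in halfIco, ∫⁻ y' in halfIco, G (x, y) * G (x, y') * edist y y' ^ (-t) := by
  set D : ℕ → ℝ≥0∞ := fun i => ENNReal.ofReal (2 * ρ i)
  have hD0 : ∀ i, D i ≠ 0 := fun i => by simp [D, hρ i]
  have hDt : ∀ i, D i ≠ ⊤ := fun i => ENNReal.ofReal_ne_top
  set χ : ℕ → ℝ → ℝ≥0∞ := fun i y => (V i).indicator (fun _ => (1 : ℝ≥0∞)) (x, y)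
  have hχm : ∀ i, Measurable (χ i) := fun i =>
    (measurable_const.indicator (hV i)).comp measurable_prodMk_left
  have hGm : Measurable fun y => G (x, y) := hG.comp measurable_prodMk_left
  have hχG : ∀ i, Measurable fun y => χ i y * G (x, y) := fun i => (hχm i).mul hGm
  set ν : ℕ → ℝ≥0∞ := fun i => ∫⁻ y in halfIco, χ i y * G (x, y)
  have hsplit : ∫⁻ y in halfIco, G (x, y) ≤ ∑' i, ν i := by
    rw [← lintegral_tsum fun i => (hχG i).aemeasurable]
    refine setLIntegral_mono' measurableSet_Ico fun y hy => ?_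
    by_cases h0 : G (x, y) = 0
    · simp [h0]
    · obtain ⟨i, hi⟩ := mem_iUnion.1 (hcov y hy h0)
      calc G (x, y) = χ i y * G (x, y) := by simp [χ, hi]
        _ ≤ _ := ENNReal.le_tsum i
  refine hsplit.trans ?_
  have hpt : ∀ i, ν i ≤ l * D i ^ t *
        (Metric.closedBall (p i).1 (ρ i)).indicator (fun _ => 1) x +
        l⁻¹ * ∫⁻ y in halfIco, ∫⁻ y' in halfIco,
          (χ i y * χ i y') * (G (x, y) * G (x, y') * edist y y' ^ (-t)) := by
    intro i
    by_cases hx : x ∈ Metric.closedBall (p i).1 (ρ i)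
    · have hc0 : l * D i ^ t ≠ 0 := mul_ne_zero hl (by
        simp [ENNReal.rpow_eq_zero_iff, hD0 i, hDt i])
      have hct : l * D i ^ t ≠ ⊤ := ENNReal.mul_ne_top hl' (by
        simp [ENNReal.rpow_eq_top_iff, hD0 i, hDt i])
      refine (le_mul_add_inv_mul_sq hc0 hct (ν i)).trans ?_
      simp only [hx, indicator_of_mem, mul_one]
      refine add_le_add le_rfl ?_
      rw [ENNReal.mul_inv (Or.inl hl) (Or.inl hl'), mul_assoc]
      gcongr
      rw [← ENNReal.rpow_neg]
      have : ν i * ν i = ∫⁻ y in halfIco, ∫⁻ y' in halfIco,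
          (χ i y * G (x, y)) * (χ i y' * G (x, y')) := by
        simp only [ν]
        rw [← lintegral_mul_const _ (hχG i)]
        refine lintegral_congr fun y => ?_
        rw [← lintegral_const_mul _ (hχG i)]
      rw [this, ← lintegral_const_mul']
      swap
      · simp [ENNReal.rpow_eq_top_iff, hD0 i, hDt i]
      refine lintegral_mono fun y => ?_
      rw [← lintegral_const_mul']
      swap
      · simp [ENNReal.rpow_eq_top_iff, hD0 i, hDt i]
      refine lintegral_mono fun y' => ?_
      by_cases hy : (x, y) ∈ V i
      · by_cases hy' : (x, y') ∈ V i
        · have hle : edist y y' ≤ D i := by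
            have h1 := hVb i hy
            have h2 := hVb i hy'
            rw [Metric.mem_closedBall, Prod.dist_eq, max_le_iff] at h1 h2
            rw [edist_dist]
            refine ENNReal.ofReal_le_ofReal ?_
            have := dist_triangle_right y y' (p i).2
            linarith [h1.2, h2.2]
          have : D i ^ (-t) ≤ edist y y' ^ (-t) := by
            rw [ENNReal.rpow_neg, ENNReal.rpow_neg]
            gcongr
          simp only [χ, hy, hy', indicator_of_mem, one_mul]
          rw [mul_comm]
          gcongr
        · simp [χ, hy']
      · simp [χ, hy]
    · have : ν i = 0 := by
        have : ∀ y, χ i y * G (x, y) = 0 := by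
          intro y
          have : (x, y) ∉ V i := fun h => hx (by
            have := hVb i h
            rw [Metric.mem_closedBall, Prod.dist_eq, max_le_iff] at this
            exact this.1)
          simp [χ, this]
        simp [ν, this]
      simp [this]
  refine (ENNReal.tsum_le_tsum hpt).trans ?_
  rw [ENNReal.tsum_add, ENNReal.tsum_mul_left (a := l⁻¹)]
  gcongr
  have hker : Measurable fun q : ℝ × ℝ => G (x, q.1) * G (x, q.2) * edist q.1 q.2 ^ (-t) :=
    ((hGm.comp measurable_fst).mul (hGm.comp measurable_snd)).mul
      ((measurable_fst.edist measurable_snd).pow_const _)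
  have hm2 : ∀ i, Measurable fun q : ℝ × ℝ => (χ i q.1 * χ i q.2) *
      (G (x, q.1) * G (x, q.2) * edist q.1 q.2 ^ (-t)) := fun i =>
    (((hχm i).comp measurable_fst).mul ((hχm i).comp measurable_snd)).mul hker
  rw [← lintegral_tsum fun i => (Measurable.lintegral_prod_right' (hm2 i)).aemeasurable]
  refine lintegral_mono fun y => ?_
  have hm3 : ∀ i, AEMeasurable (fun y' : ℝ => (χ i y * χ i y') *
      (G (x, y) * G (x, y') * edist y y' ^ (-t))) (volume.restrict halfIco) :=
    fun i => ((hm2 i).comp measurable_prodMk_left).aemeasurable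
  rw [← lintegral_tsum hm3]
  refine lintegral_mono fun y' => ?_
  simp only
  rw [ENNReal.tsum_mul_right]
  calc _ ≤ 1 * (G (x, y) * G (x, y') * edist y y' ^ (-t)) := by
        gcongr
        refine sum_indicator_mul_le_one hd (x, y) _ fun i => ?_
        simp only [χ, indicator]; split_ifs <;> simp
    _ = _ := one_mul _

lemma squareMass_le_of_cover {G : ℝ × ℝ → ℝ≥0∞} (hG : Measurable G) {V : ℕ → Set (ℝ × ℝ)}
    (hV : ∀ i, MeasurableSet (V i))
    (p : ℕ → ℝ × ℝ) (ρ : ℕ → ℝ) (hρ : ∀ i, 0 < ρ i)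
    (hVb : ∀ i, V i ⊆ Metric.closedBall (p i) (ρ i))
    {t : ℝ} (ht : 0 < t) {l : ℝ≥0∞} (hl : l ≠ 0) (hl' : l ≠ ⊤)
    (hcov : ∀ q ∈ halfIco ×ˢ halfIco, G q ≠ 0 → q ∈ ⋃ i, V i) :
    squareMass G ≤ l * (∑' i, ENNReal.ofReal (2 * ρ i) ^ (1 + t)) + l⁻¹ * sliceEnergy t G := by
  have key : ∀ x ∈ halfIco, _ := fun x hx =>
    slice_mass_le hG (V := disjointed V) (fun i => MeasurableSet.disjointed hV i)
      (disjoint_disjointed V) p ρ hρ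
      (fun i => (disjointed_subset V i).trans (hVb i)) ht hl hl' x
      (fun y hy h0 => by rw [iUnion_disjointed]; exact hcov (x, y) ⟨hx, hy⟩ h0)
  have hmI : ∀ i, Measurable fun x : ℝ =>
      (Metric.closedBall (p i).1 (ρ i)).indicator (fun _ => (1 : ℝ≥0∞)) x := fun i =>
    measurable_const.indicator Metric.isClosed_closedBall.measurableSet
  refine (setLIntegral_mono' measurableSet_Ico key).trans ?_
  rw [lintegral_add_left (Measurable.tsum fun i => (hmI i).const_mul _),
    lintegral_tsum fun i => ((hmI i).const_mul _).aemeasurable]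
  rw [lintegral_const_mul' _ _ (ENNReal.inv_ne_top.2 hl), ← ENNReal.tsum_mul_left]
  refine add_le_add (ENNReal.tsum_le_tsum fun i => ?_) le_rfl
  rw [lintegral_const_mul _ (hmI i),
    lintegral_indicator Metric.isClosed_closedBall.measurableSet, mul_assoc]
  gcongr
  have h2 : 0 < 2 * ρ i := by have := hρ i; linarith
  rw [add_comm, ENNReal.rpow_add _ _ (by simpa using hρ i) ENNReal.ofReal_ne_top, ENNReal.rpow_one]
  gcongr
  simp only [lintegral_const, one_mul, MeasurableSet.univ, Measure.restrict_apply, univ_inter]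
  calc _ ≤ volume (Metric.closedBall (p i).1 (ρ i)) :=
        (Measure.restrict_apply_le _ _)
    _ = _ := Real.volume_closedBall _ _
end

section
open MeasureTheory Set Filter Topology ENNReal NNReal

lemma cubeInt_mono {f g : ℝ → ℝ → ℝ → ℝ≥0∞}
    (h : ∀ x ∈ halfIco, ∀ y ∈ halfIco, ∀ y' ∈ halfIco, f x y y' ≤ g x y y') :
    cubeInt f ≤ cubeInt g :=
  setLIntegral_mono' measurableSet_Ico fun x hx =>
    setLIntegral_mono' measurableSet_Ico fun y hy =>
      setLIntegral_mono' measurableSet_Ico fun y' hy' => h x hx y hy y' hy'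

lemma cubeInt_eq {f : ℝ → ℝ → ℝ → ℝ≥0∞}
    (hf : Measurable fun q : ℝ × ℝ × ℝ => f q.1 q.2.1 q.2.2) :
    cubeInt f = ∫⁻ q, f q.1 q.2.1 q.2.2 ∂((volume.restrict halfIco).prod
      ((volume.restrict halfIco).prod (volume.restrict halfIco))) := by
  rw [lintegral_prod _ hf.aemeasurable]
  refine lintegral_congr fun x => ?_
  have : Measurable fun q : ℝ × ℝ => f x q.1 q.2 := hf.comp measurable_prodMk_left
  exact (lintegral_prod _ this.aemeasurable).symm

lemma cubeInt_add {f g : ℝ → ℝ → ℝ → ℝ≥0∞}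
    (hf : Measurable fun q : ℝ × ℝ × ℝ => f q.1 q.2.1 q.2.2)
    (hg : Measurable fun q : ℝ × ℝ × ℝ => g q.1 q.2.1 q.2.2) :
    cubeInt (fun x y y' => f x y y' + g x y y') = cubeInt f + cubeInt g := by
  rw [cubeInt_eq hf, cubeInt_eq hg, cubeInt_eq (hf.add hg), lintegral_add_left hf]

lemma cubeInt_const_mul {f : ℝ → ℝ → ℝ → ℝ≥0∞} (c : ℝ≥0∞)
    (hf : Measurable fun q : ℝ × ℝ × ℝ => f q.1 q.2.1 q.2.2) :
    cubeInt (fun x y y' => c * f x y y') = c * cubeInt f := by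
  rw [cubeInt_eq hf, cubeInt_eq (hf.const_mul c), lintegral_const_mul _ hf]

lemma cubeInt_tsum {f : ℕ → ℝ → ℝ → ℝ → ℝ≥0∞}
    (hf : ∀ i, Measurable fun q : ℝ × ℝ × ℝ => f i q.1 q.2.1 q.2.2) :
    cubeInt (fun x y y' => ∑' i, f i x y y') = ∑' i, cubeInt (f i) := by
  rw [cubeInt_eq (Measurable.tsum hf), lintegral_tsum fun i => (hf i).aemeasurable]
  exact tsum_congr fun i => (cubeInt_eq (hf i)).symm

lemma lintegral_mul_le_of_pieces {ι : Type*} [Countable ι] {I : ι → Set ℝ}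
    (hI : ∀ i, MeasurableSet (I i)) (hd : Pairwise (Function.onFun Disjoint I))
    {F₁ F₂ φ : ℝ → ℝ≥0∞} (h₁ : Measurable F₁) (h₂ : Measurable F₂) {C ω : ℝ≥0∞}
    (hF : ∀ i, ∫⁻ y in I i, F₁ y ≤ C * ∫⁻ y in I i, F₂ y)
    (hφ : ∀ i, ∀ y ∈ I i, ∀ y' ∈ I i, φ y ≤ φ y' + ω) :
    ∫⁻ y in ⋃ i, I i, F₁ y * φ y ≤ C * ∫⁻ y in ⋃ i, I i, F₂ y * (φ y + ω) := by
  rw [lintegral_iUnion hI hd, lintegral_iUnion hI hd, ← ENNReal.tsum_mul_left]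
  refine ENNReal.tsum_le_tsum fun i => ?_
  set S : ℝ≥0∞ := ⨆ y ∈ I i, φ y
  calc ∫⁻ y in I i, F₁ y * φ y ≤ ∫⁻ y in I i, F₁ y * S := by
        refine setLIntegral_mono' (hI i) fun y hy => ?_
        gcongr
        exact le_iSup₂ (f := fun y _ => φ y) y hy
    _ = (∫⁻ y in I i, F₁ y) * S := lintegral_mul_const _ h₁
    _ ≤ C * (∫⁻ y in I i, F₂ y) * S := by gcongr; exact hF i
    _ = C * ∫⁻ y in I i, F₂ y * S := by rw [lintegral_mul_const _ h₂, mul_assoc]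
    _ ≤ _ := by
      refine mul_le_mul_right (setLIntegral_mono' (hI i) fun y hy => ?_) _
      refine mul_le_mul_right ?_ _
      exact iSup₂_le fun z hz => hφ i z hz y hy

/-- The `i`-th of `M` consecutive intervals of equal length partitioning `[0, 1/2)`. -/
def piece (M : ℕ) (i : Fin M) : Set ℝ := Ico ((i : ℝ) / (2 * M)) (((i : ℝ) + 1) / (2 * M))

lemma iUnion_piece {M : ℕ} (hM : 0 < M) : ⋃ i, piece M i = halfIco := by
  have hM' : (0 : ℝ) < 2 * M := by positivity
  ext y
  simp only [mem_iUnion, piece, halfIco, mem_Ico, div_le_iff₀ hM', lt_div_iff₀ hM']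
  constructor
  · rintro ⟨i, h1, h2⟩
    have hi : ((i : ℕ) : ℝ) + 1 ≤ M := by exact_mod_cast i.2
    have h0 : (0 : ℝ) ≤ (i : ℕ) := by positivity
    constructor
    · by_contra! h
      nlinarith
    · by_contra! h
      nlinarith
  · rintro ⟨h1, h2⟩
    have h0 : 0 ≤ y * (2 * M) := by positivity
    refine ⟨⟨⌊y * (2 * M)⌋₊, ?_⟩, Nat.floor_le h0, Nat.lt_floor_add_one _⟩
    rw [Nat.floor_lt h0]
    nlinarith

lemma disjoint_piece {M : ℕ} (hM : 0 < M) : Pairwise (Function.onFun Disjoint (piece M)) := by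
  have hM' : (0 : ℝ) < 2 * M := by positivity
  have key : ∀ i j : Fin M, i < j → Disjoint (piece M i) (piece M j) := by
    intro i j hij
    refine Set.disjoint_left.2 fun y hy hy' => ?_
    simp only [piece, mem_Ico, div_le_iff₀ hM', lt_div_iff₀ hM'] at hy hy'
    have : ((i : ℕ) : ℝ) + 1 ≤ (j : ℕ) := by exact_mod_cast hij
    linarith [hy.2, hy'.1]
  intro i j hij
  rcases lt_or_gt_of_ne hij with h | h
  · exact key i j h
  · exact (key j i h).symm

lemma piece_subset {M : ℕ} (hM : 0 < M) (i : Fin M) : piece M i ⊆ halfIco := by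
  rw [← iUnion_piece hM]; exact subset_iUnion _ i

lemma abs_sub_le_of_mem_piece {M : ℕ} (hM : 0 < M) {i : Fin M} {y y' : ℝ} (hy : y ∈ piece M i)
    (hy' : y' ∈ piece M i) : |y - y'| ≤ 1 / (2 * M) := by
  have hM' : (0 : ℝ) < 2 * M := by positivity
  simp only [piece, mem_Ico, add_div] at hy hy'
  rw [abs_le]
  constructor <;> linarith [hy.1, hy.2, hy'.1, hy'.2]

lemma volume_piece {M : ℕ} (i : Fin M) :
    volume (piece M i) = ENNReal.ofReal (1 / (2 * M)) := by
  rw [piece, Real.volume_Ico]; congr 1; ring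

/-- The densities `F k` equidistribute along vertical lines as `k → ∞`, uniformly. -/
structure VerticalEquidistribution (F : ℕ → ℝ × ℝ → ℝ≥0) : Prop where
  continuous : ∀ k, Continuous (F k)
  upper : ∀ ε : ℝ, 0 < ε → ∀ᶠ k in atTop, ∀ x ∈ halfIco, ∀ u v, 0 ≤ u → u ≤ v → v ≤ 1 / 2 →
    ∫⁻ y in Ico u v, (F k (x, y) : ℝ≥0∞) ≤ ENNReal.ofReal (v - u + ε)
  lower : ∀ ε : ℝ, 0 < ε → ∀ᶠ k in atTop, ∀ x ∈ halfIco, ∀ u v, 0 ≤ u → u ≤ v → v ≤ 1 / 2 →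
    ENNReal.ofReal (v - u) ≤ (∫⁻ y in Ico u v, (F k (x, y) : ℝ≥0∞)) + ENNReal.ofReal ε

lemma VerticalEquidistribution.eventually_piece {F : ℕ → ℝ × ℝ → ℝ≥0}
    (hF : VerticalEquidistribution F) {M : ℕ} (hM : 0 < M) {η : ℝ≥0} (hη : 0 < η) :
    ∀ᶠ k in atTop, ∀ x ∈ halfIco, ∀ i : Fin M,
      ∫⁻ y in piece M i, (F k (x, y) : ℝ≥0∞) ≤ (1 + η) * ∫⁻ _y in piece M i, 1 ∧
      ∫⁻ _y in piece M i, 1 ≤ (1 + η) * ∫⁻ y in piece M i, (F k (x, y) : ℝ≥0∞) := by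
  have hM' : (0 : ℝ) < 2 * M := by positivity
  have hl : (0 : ℝ) < 1 / (2 * M) := by positivity
  have hη' : (0 : ℝ) < η := hη
  have h1 := hF.upper (η * (1 / (2 * M))) (by positivity)
  have h2 := hF.lower (η / (1 + η) * (1 / (2 * M))) (by positivity)
  filter_upwards [h1, h2] with k h1 h2 x hx i
  have hi : ((i : ℕ) : ℝ) + 1 ≤ M := by exact_mod_cast i.2
  have e1 : (0 : ℝ) ≤ (i : ℕ) / (2 * M) := by positivity
  have e2 : ((i : ℕ) : ℝ) / (2 * M) ≤ (((i : ℕ) : ℝ) + 1) / (2 * M) := by gcongr; linarith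
  have e3 : (((i : ℕ) : ℝ) + 1) / (2 * M) ≤ 1 / 2 := by
    rw [div_le_div_iff₀ hM' two_pos]; linarith
  have e4 : (((i : ℕ) : ℝ) + 1) / (2 * M) - (i : ℕ) / (2 * M) = 1 / (2 * M) := by ring
  have h1 := h1 x hx _ _ e1 e2 e3
  have h2 := h2 x hx _ _ e1 e2 e3
  rw [e4] at h1 h2
  have hv := volume_piece i
  have hη1 : (1 + (η : ℝ≥0∞)) = ENNReal.ofReal (1 + η) := by
    rw [ENNReal.ofReal_add (by norm_num) hη'.le]; simp
  simp only [lintegral_const, one_mul, MeasurableSet.univ, Measure.restrict_apply, univ_inter, hv]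
  constructor
  · refine h1.trans_eq ?_
    rw [hη1, ← ENNReal.ofReal_mul (by positivity)]
    congr 1; ring
  · have h3 : ENNReal.ofReal (1 / (1 + η) * (1 / (2 * M))) ≤
        ∫⁻ y in piece M i, (F k (x, y) : ℝ≥0∞) := by
      have : 1 / (1 + (η : ℝ)) * (1 / (2 * M)) = 1 / (2 * M) - η / (1 + η) * (1 / (2 * M)) := by
        field_simp; ring
      rw [this, ENNReal.ofReal_sub _ (by positivity)]
      exact tsub_le_iff_right.2 h2
    calc ENNReal.ofReal (1 / (2 * M))
        = (1 + η) * ENNReal.ofReal (1 / (1 + η) * (1 / (2 * M))) := by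
          rw [hη1, ← ENNReal.ofReal_mul (by positivity)]
          congr 1; field_simp
      _ ≤ _ := by gcongr

lemma exists_piece_oscillation {K : Type*} [PseudoMetricSpace K] {s : Set K} (hs : IsCompact s)
    {H : K → ℝ≥0} (hH : ContinuousOn H s) {η : ℝ≥0} (hη : 0 < η) :
    ∃ M : ℕ, 0 < M ∧ ∀ p ∈ s, ∀ q ∈ s, dist p q ≤ 1 / (2 * M) →
      (H p : ℝ≥0∞) ≤ H q + η := by
  have := Metric.uniformContinuousOn_iff.1 (hs.uniformContinuousOn_of_continuous hH) η hη
  obtain ⟨δ, hδ, h⟩ := this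
  obtain ⟨n, hn⟩ := exists_nat_gt (1 / δ)
  have hn0 : (0 : ℝ) < n := lt_trans (by positivity) hn
  refine ⟨n, by exact_mod_cast hn0, fun p hp q hq hpq => ?_⟩
  have h1 : dist p q < δ := by
    refine hpq.trans_lt ?_
    rw [div_lt_iff₀ (by positivity)]
    rw [div_lt_iff₀ hδ] at hn
    nlinarith
  have := h p hp q hq h1
  rw [NNReal.dist_eq, abs_lt] at this
  have h2 : (H p : ℝ) ≤ H q + η := by linarith [this.2]
  exact_mod_cast h2

lemma halfIco_subset_Icc : halfIco ⊆ Icc 0 (1 / 2) := Ico_subset_Icc_self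

lemma volume_halfIco : volume halfIco = ENNReal.ofReal (1 / 2) := by
  rw [halfIco, Real.volume_Ico]; congr 1; ring

lemma volume_halfIco_le : volume halfIco ≤ 1 := by
  rw [volume_halfIco, ← ENNReal.ofReal_one]
  exact ENNReal.ofReal_le_ofReal (by norm_num)

lemma VerticalEquidistribution.eventually_lintegral_le {F : ℕ → ℝ × ℝ → ℝ≥0}
    (hF : VerticalEquidistribution F) {η : ℝ≥0} (hη : 0 < η) :
    ∀ᶠ k in atTop, ∀ x ∈ halfIco, ∫⁻ y in halfIco, (F k (x, y) : ℝ≥0∞) ≤ 1 + η := by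
  filter_upwards [hF.upper η hη] with k hk x hx
  refine (hk x hx 0 (1 / 2) le_rfl (by norm_num) le_rfl).trans ?_
  rw [ENNReal.ofReal_add (by norm_num) η.coe_nonneg]
  gcongr
  · rw [← ENNReal.ofReal_one]; exact ENNReal.ofReal_le_ofReal (by norm_num)
  · simp

lemma ENNReal.exists_pos_of_lt {a b : ℝ≥0∞} (f : ℝ≥0 → ℝ≥0∞) (hf : ContinuousAt f 0)
    (h0 : f 0 = a) (hab : a < b) : ∃ η : ℝ≥0, 0 < η ∧ f η < b := by
  have h1 : ∀ᶠ η in 𝓝 (0 : ℝ≥0), f η < b := hf.eventually_lt_const (by rwa [h0])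
  have h2 : ∀ᶠ η in 𝓝[>] (0 : ℝ≥0), f η < b := h1.filter_mono nhdsWithin_le_nhds
  obtain ⟨η, h3, h4⟩ := (h2.and self_mem_nhdsWithin).exists
  exact ⟨η, h4, h3⟩

lemma VerticalEquidistribution.eventually_lt_squareMass {F : ℕ → ℝ × ℝ → ℝ≥0}
    (hF : VerticalEquidistribution F) {g : ℝ × ℝ → ℝ≥0} (hg : Continuous g) {m : ℝ≥0∞}
    (hm : m < squareMass fun q => g q) :
    ∀ᶠ k in atTop, m < squareMass fun q => (F k q * g q : ℝ≥0∞) := by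
  have hmt : m ≠ ⊤ := hm.ne_top
  obtain ⟨η, hη, hlt⟩ := ENNReal.exists_pos_of_lt
    (fun η : ℝ≥0 => (1 + (η : ℝ≥0∞)) * (m + η * (1 + η))) (a := m) (by
      lift m to ℝ≥0 using hmt
      refine Continuous.continuousAt ?_
      have : Continuous fun η : ℝ≥0 => ((((1 + η) * (m + η * (1 + η)) : ℝ≥0)) : ℝ≥0∞) := by
        fun_prop
      simpa using this) (by simp) hm
  obtain ⟨M, hM, hosc⟩ := exists_piece_oscillation
    ((isCompact_Icc (a := (0 : ℝ)) (b := 1 / 2)).prod (isCompact_Icc (a := (0 : ℝ)) (b := 1 / 2)))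
    hg.continuousOn hη
  filter_upwards [hF.eventually_piece hM hη, hF.eventually_lintegral_le hη] with k hk hk1
  by_contra! hle
  refine (lt_irrefl _) (hlt.trans_le ?_)
  have hFm : ∀ x, Measurable fun y => (F k (x, y) : ℝ≥0∞) := fun x =>
    (hF.continuous k).measurable.coe_nnreal_ennreal.comp measurable_prodMk_left
  have hgm : ∀ x, Measurable fun y => (g (x, y) : ℝ≥0∞) := fun x =>
    hg.measurable.coe_nnreal_ennreal.comp measurable_prodMk_left
  have hx : ∀ x ∈ halfIco, ∫⁻ y in halfIco, (g (x, y) : ℝ≥0∞) ≤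
      (1 + η) * ((∫⁻ y in halfIco, F k (x, y) * (g (x, y) : ℝ≥0∞)) + η * (1 + η)) := by
    intro x hx
    have := lintegral_mul_le_of_pieces (I := piece M) (fun i => measurableSet_Ico)
      (disjoint_piece hM) (measurable_const (a := (1 : ℝ≥0∞))) (hFm x)
      (φ := fun y => (g (x, y) : ℝ≥0∞)) (ω := η) (C := 1 + η)
      (fun i => (hk x hx i).2) (fun i y hy y' hy' => by
        refine hosc _ ⟨halfIco_subset_Icc hx, halfIco_subset_Icc (piece_subset hM i hy)⟩ _
          ⟨halfIco_subset_Icc hx, halfIco_subset_Icc (piece_subset hM i hy')⟩ ?_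
        simpa [Prod.dist_eq, Real.dist_eq] using abs_sub_le_of_mem_piece hM hy hy')
    rw [iUnion_piece hM] at this
    simp only [one_mul, mul_add (F k (x, _) : ℝ≥0∞)] at this
    refine this.trans ?_
    have hm2 : Measurable fun y => (F k (x, y) : ℝ≥0∞) * g (x, y) := (hFm x).mul (hgm x)
    rw [lintegral_add_left hm2, lintegral_mul_const _ (hFm x), mul_comm (η : ℝ≥0∞)]
    gcongr
    exact hk1 x hx
  calc squareMass (fun q => g q)
      ≤ ∫⁻ x in halfIco, (1 + η) *
        ((∫⁻ y in halfIco, F k (x, y) * (g (x, y) : ℝ≥0∞)) + η * (1 + η)) :=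
      setLIntegral_mono' measurableSet_Ico hx
    _ = (1 + η) * (squareMass (fun q => (F k q * g q : ℝ≥0∞)) +
          η * (1 + η) * volume halfIco) := by
        rw [lintegral_const_mul' _ _ (by simp), lintegral_add_right _ measurable_const]
        simp [squareMass]
    _ ≤ (1 + η) * (m + η * (1 + η) * 1) := by
        gcongr
        exact volume_halfIco_le
    _ = _ := by rw [mul_one]
end

section
open MeasureTheory Set Filter Topology ENNReal NNReal

lemma VerticalEquidistribution.eventually_cubeInt_lt {F : ℕ → ℝ × ℝ → ℝ≥0}
    (hF : VerticalEquidistribution F) {H : ℝ × ℝ × ℝ → ℝ≥0} (hH : Continuous H) {E : ℝ≥0∞}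
    (hE : cubeInt (fun x y y' => H (x, y, y')) < E) :
    ∀ᶠ k in atTop,
      cubeInt (fun x y y' => F k (x, y) * F k (x, y') * (H (x, y, y') : ℝ≥0∞)) < E := by
  have hmt : cubeInt (fun x y y' => H (x, y, y')) ≠ ⊤ := hE.ne_top
  obtain ⟨m, hm⟩ : ∃ m : ℝ≥0, (m : ℝ≥0∞) = cubeInt (fun x y y' => H (x, y, y')) :=
    ⟨_, ENNReal.coe_toNNReal hmt⟩
  obtain ⟨η, hη, hlt⟩ := ENNReal.exists_pos_of_lt
    (fun η : ℝ≥0 => (1 + (η : ℝ≥0∞)) * (1 + η) * (m + 2 * η)) (a := m) (by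
      refine Continuous.continuousAt ?_
      have : Continuous fun η : ℝ≥0 => ((((1 + η) * (1 + η) * (m + 2 * η) : ℝ≥0)) : ℝ≥0∞) := by
        fun_prop
      simpa using this) (by simp) (hm.symm ▸ hE)
  refine (fun h => ?_ : (∀ᶠ k in atTop, cubeInt
    (fun x y y' => F k (x, y) * F k (x, y') * (H (x, y, y') : ℝ≥0∞)) ≤
      (1 + (η : ℝ≥0∞)) * (1 + η) * (m + 2 * η)) → _) ?_
  · exact h.mono fun k hk => hk.trans_lt hlt
  obtain ⟨M, hM, hosc⟩ := exists_piece_oscillation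
    ((isCompact_Icc (a := (0 : ℝ)) (b := 1 / 2)).prod
      ((isCompact_Icc (a := (0 : ℝ)) (b := 1 / 2)).prod (isCompact_Icc (a := (0 : ℝ)) (b := 1 / 2))))
    hH.continuousOn hη
  filter_upwards [hF.eventually_piece hM hη] with k hk
  have hFm : ∀ x, Measurable fun y => (F k (x, y) : ℝ≥0∞) := fun x =>
    (hF.continuous k).measurable.coe_nnreal_ennreal.comp measurable_prodMk_left
  have hHm : Measurable fun q => (H q : ℝ≥0∞) := hH.measurable.coe_nnreal_ennreal
  have hHm2 : ∀ x, Measurable fun q : ℝ × ℝ => (H (x, q.1, q.2) : ℝ≥0∞) := fun x =>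
    hHm.comp measurable_prodMk_left
  have hHm1 : ∀ x y, Measurable fun y' => (H (x, y, y') : ℝ≥0∞) := fun x y =>
    (hHm2 x).comp measurable_prodMk_left
  have hx : ∀ x ∈ halfIco,
      ∫⁻ y in halfIco, ∫⁻ y' in halfIco, F k (x, y) * F k (x, y') * (H (x, y, y') : ℝ≥0∞) ≤
      (1 + η) * (1 + η) * ((∫⁻ y in halfIco, ∫⁻ y' in halfIco, (H (x, y, y') : ℝ≥0∞)) + 2 * η) := by
    intro x hx
    set ψ : ℝ → ℝ≥0∞ := fun y => ∫⁻ y' in halfIco, ((H (x, y, y') : ℝ≥0∞) + η)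
    have hψ : ∀ y, ψ y = (∫⁻ y' in halfIco, (H (x, y, y') : ℝ≥0∞)) + η * volume halfIco := by
      intro y
      simp only [ψ]
      rw [lintegral_add_left (hHm1 x y)]
      simp
    have hin : ∀ y ∈ halfIco, ∫⁻ y' in halfIco, F k (x, y') * (H (x, y, y') : ℝ≥0∞) ≤
        (1 + η) * ψ y := by
      intro y hy
      have := lintegral_mul_le_of_pieces (I := piece M) (fun i => measurableSet_Ico)
        (disjoint_piece hM) (hFm x) (measurable_const (a := (1 : ℝ≥0∞)))
        (φ := fun y' => (H (x, y, y') : ℝ≥0∞)) (ω := η) (C := 1 + η)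
        (fun i => (hk x hx i).1) (fun i z hz z' hz' => by
          refine hosc _ ⟨halfIco_subset_Icc hx, halfIco_subset_Icc hy,
            halfIco_subset_Icc (piece_subset hM i hz)⟩ _
            ⟨halfIco_subset_Icc hx, halfIco_subset_Icc hy,
            halfIco_subset_Icc (piece_subset hM i hz')⟩ ?_
          simpa [Prod.dist_eq, Real.dist_eq] using abs_sub_le_of_mem_piece hM hz hz')
      rw [iUnion_piece hM] at this
      simpa only [one_mul] using this
    have hout : ∫⁻ y in halfIco, F k (x, y) * ψ y ≤ (1 + η) * ∫⁻ y in halfIco, 1 * (ψ y + η) := by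
      have := lintegral_mul_le_of_pieces (I := piece M) (fun i => measurableSet_Ico)
        (disjoint_piece hM) (hFm x) (measurable_const (a := (1 : ℝ≥0∞)))
        (φ := ψ) (ω := η) (C := 1 + η)
        (fun i => (hk x hx i).1) (fun i z hz z' hz' => by
          calc ψ z ≤ ∫⁻ y' in halfIco, ((H (x, z', y') : ℝ≥0∞) + η + η) := by
                refine setLIntegral_mono' measurableSet_Ico fun y' hy' => ?_
                refine add_le_add ?_ le_rfl
                refine hosc _ ⟨halfIco_subset_Icc hx, halfIco_subset_Icc (piece_subset hM i hz),
                  halfIco_subset_Icc hy'⟩ _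
                  ⟨halfIco_subset_Icc hx, halfIco_subset_Icc (piece_subset hM i hz'),
                  halfIco_subset_Icc hy'⟩ ?_
                simpa [Prod.dist_eq, Real.dist_eq] using abs_sub_le_of_mem_piece hM hz hz'
            _ = ψ z' + η * volume halfIco := by
                rw [lintegral_add_right _ measurable_const]; simp [ψ]
            _ ≤ ψ z' + η * 1 := by gcongr; exact volume_halfIco_le
            _ = _ := by rw [mul_one])
      rwa [iUnion_piece hM] at this
    calc ∫⁻ y in halfIco, ∫⁻ y' in halfIco, F k (x, y) * F k (x, y') * (H (x, y, y') : ℝ≥0∞)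
        = ∫⁻ y in halfIco, F k (x, y) *
            ∫⁻ y' in halfIco, F k (x, y') * (H (x, y, y') : ℝ≥0∞) := by
          refine lintegral_congr fun y => ?_
          rw [← lintegral_const_mul' _ _ ENNReal.coe_ne_top]
          simp only [mul_assoc]
      _ ≤ ∫⁻ y in halfIco, F k (x, y) * ((1 + η) * ψ y) := by
          refine setLIntegral_mono' measurableSet_Ico fun y hy => ?_
          gcongr
          exact hin y hy
      _ = (1 + η) * ∫⁻ y in halfIco, F k (x, y) * ψ y := by
          rw [← lintegral_const_mul' _ _ (by simp)]
          refine lintegral_congr fun y => ?_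
          ring
      _ ≤ (1 + η) * ((1 + η) * ∫⁻ y in halfIco, 1 * (ψ y + η)) := by gcongr
      _ = (1 + η) * (1 + η) * ((∫⁻ y in halfIco, ∫⁻ y' in halfIco, (H (x, y, y') : ℝ≥0∞)) +
            η * volume halfIco * volume halfIco + η * volume halfIco) := by
          simp only [one_mul, hψ]
          rw [lintegral_add_right _ measurable_const, lintegral_add_right _ measurable_const,
            mul_assoc]
          simp
      _ ≤ (1 + η) * (1 + η) * ((∫⁻ y in halfIco, ∫⁻ y' in halfIco, (H (x, y, y') : ℝ≥0∞)) +
            η * 1 * 1 + η * 1) := by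
          gcongr <;> exact volume_halfIco_le
      _ = _ := by ring
  calc cubeInt (fun x y y' => F k (x, y) * F k (x, y') * (H (x, y, y') : ℝ≥0∞))
      ≤ ∫⁻ x in halfIco, (1 + (η : ℝ≥0∞)) * (1 + η) *
          ((∫⁻ y in halfIco, ∫⁻ y' in halfIco, (H (x, y, y') : ℝ≥0∞)) + 2 * η) :=
        setLIntegral_mono' measurableSet_Ico hx
    _ = (1 + η) * (1 + η) * (cubeInt (fun x y y' => H (x, y, y')) + 2 * η * volume halfIco) := by
        rw [lintegral_const_mul' _ _ (by simp [ENNReal.mul_eq_top]),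
          lintegral_add_right _ measurable_const]
        simp [cubeInt]
    _ ≤ (1 + η) * (1 + η) * (m + 2 * η * 1) := by
        rw [← hm]
        gcongr
        exact volume_halfIco_le
    _ = _ := by rw [mul_one]

/-- Indicator of the pairs at distance at most `r`. -/
noncomputable def nearInd (r y y' : ℝ) : ℝ≥0∞ := if |y - y'| ≤ r then 1 else 0

lemma measurable_nearInd (r : ℝ) : Measurable fun q : ℝ × ℝ => nearInd r q.1 q.2 :=
  Measurable.ite (measurableSet_le (by fun_prop) measurable_const) measurable_const
    measurable_const

lemma edist_rpow_neg_le {t : ℝ} (ht : 0 < t) (N : ℕ) (y y' : ℝ) :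
    edist y y' ^ (-t) ≤ ENNReal.ofReal (max |y - y'| ((1 / 2) ^ N) ^ (-t)) +
      ∑' j, ENNReal.ofReal (((1 / 2 : ℝ) ^ (j + N + 1)) ^ (-t)) * nearInd ((1 / 2) ^ (j + N)) y y' := by
  have hpos : ∀ j : ℕ, (0 : ℝ) < (1 / 2) ^ j := fun j => by positivity
  rw [edist_dist, Real.dist_eq]
  rcases (abs_nonneg (y - y')).eq_or_lt' with h0 | h0
  · have h1 : ∀ j : ℕ, (1 : ℝ≥0∞) ≤ ENNReal.ofReal (((1 / 2 : ℝ) ^ (j + N + 1)) ^ (-t)) *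
        nearInd ((1 / 2) ^ (j + N)) y y' := by
      intro j
      simp only [nearInd, h0, (hpos _).le, if_true, mul_one]
      rw [← ENNReal.ofReal_one]
      exact ENNReal.ofReal_le_ofReal (Real.one_le_rpow_of_pos_of_le_one_of_nonpos (hpos _)
        (pow_le_one₀ (by norm_num) (by norm_num)) (by linarith))
    have : ∑' j, ENNReal.ofReal (((1 / 2 : ℝ) ^ (j + N + 1)) ^ (-t)) *
        nearInd ((1 / 2) ^ (j + N)) y y' = ⊤ :=
      top_le_iff.1 ((ENNReal.tsum_const_eq_top_of_ne_zero (α := ℕ) one_ne_zero).symm.le.trans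
        (ENNReal.tsum_le_tsum h1))
    rw [this]; simp
  · rw [ENNReal.ofReal_rpow_of_pos h0]
    rcases le_or_gt ((1 / 2) ^ N) |y - y'| with h | h
    · rw [max_eq_left h]; exact le_self_add
    · obtain ⟨n, hn1, hn2⟩ := exists_nat_pow_near_of_lt_one h0
        (h.le.trans (pow_le_one₀ (by norm_num) (by norm_num))) (y := (1 / 2 : ℝ))
        (by norm_num) (by norm_num)
      have hNn : N < n + 1 := by
        rw [← pow_lt_pow_iff_right_of_lt_one₀ (a := (1 / 2 : ℝ)) (by norm_num) (by norm_num)]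
        exact hn1.trans h
      obtain ⟨j, rfl⟩ := Nat.exists_eq_add_of_le' (Nat.lt_succ_iff.1 hNn)
      refine le_trans ?_ le_add_self
      refine le_trans ?_ (ENNReal.le_tsum j)
      simp only [nearInd, hn2, if_true, mul_one]
      exact ENNReal.ofReal_le_ofReal
        (Real.rpow_le_rpow_of_nonpos (hpos _) hn1.le (by linarith))

lemma tsum_shell_ne_top {s t : ℝ} (hts : t < s) (C : ℝ) :
    ∑' j : ℕ, ENNReal.ofReal (((1 / 2 : ℝ) ^ (j + 1)) ^ (-t)) *
      ENNReal.ofReal (C * ((1 / 2) ^ j) ^ s) ≠ ⊤ := by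
  have h : ∀ j : ℕ, ENNReal.ofReal (((1 / 2 : ℝ) ^ (j + 1)) ^ (-t)) *
      ENNReal.ofReal (C * ((1 / 2) ^ j) ^ s) =
      ENNReal.ofReal (C * (1 / 2) ^ (-t) * ((1 / 2 : ℝ) ^ (s - t)) ^ j) := by
    intro j
    rw [← ENNReal.ofReal_mul (by positivity)]
    congr 1
    have h2 : (0 : ℝ) < 1 / 2 := by norm_num
    rw [← Real.rpow_natCast, ← Real.rpow_natCast, ← Real.rpow_natCast, ← Real.rpow_mul h2.le,
      ← Real.rpow_mul h2.le, ← Real.rpow_mul h2.le, mul_left_comm, ← Real.rpow_add h2, mul_assoc,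
      ← Real.rpow_add h2]
    congr 2
    push_cast; ring
  simp only [h]
  have hq : (1 / 2 : ℝ) ^ (s - t) < 1 := Real.rpow_lt_one (by norm_num) (by norm_num) (by linarith)
  have hs : Summable fun j : ℕ => C * (1 / 2) ^ (-t) * ((1 / 2 : ℝ) ^ (s - t)) ^ j :=
    (summable_geometric_of_lt_one (by positivity) hq).mul_left _
  exact hs.tsum_ofReal_ne_top

lemma sliceEnergy_mul_le {F g : ℝ × ℝ → ℝ≥0} (hF : Continuous F) (hg : Continuous g) {s t C : ℝ}
    (ht : 0 < t) {b : ℝ≥0} (hb : ∀ x ∈ halfIco, ∀ y ∈ halfIco, g (x, y) ≤ b)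
    (hcorr : ∀ r : ℝ, 0 < r → r ≤ 1 →
      cubeInt (fun x y y' => F (x, y) * F (x, y') * nearInd r y y') ≤ ENNReal.ofReal (C * r ^ s))
    (N : ℕ) :
    sliceEnergy t (fun q => (F q * g q : ℝ≥0∞)) ≤
      cubeInt (fun x y y' => F (x, y) * F (x, y') *
        (g (x, y) * g (x, y') * ENNReal.ofReal (max |y - y'| ((1 / 2) ^ N) ^ (-t)))) +
      (b * b : ℝ≥0∞) * ∑' j : ℕ, ENNReal.ofReal (((1 / 2 : ℝ) ^ (j + N + 1)) ^ (-t)) *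
        ENNReal.ofReal (C * ((1 / 2) ^ (j + N)) ^ s) := by
  have hFm := hF.measurable.coe_nnreal_ennreal
  have hgm := hg.measurable.coe_nnreal_ennreal
  have e1 : Measurable fun q : ℝ × ℝ × ℝ => (q.1, q.2.1) := by fun_prop
  have e2 : Measurable fun q : ℝ × ℝ × ℝ => (q.1, q.2.2) := by fun_prop
  have hFF : Measurable fun q : ℝ × ℝ × ℝ => (F (q.1, q.2.1) * F (q.1, q.2.2) : ℝ≥0∞) :=
    (hFm.comp e1).mul (hFm.comp e2)
  have hgg : Measurable fun q : ℝ × ℝ × ℝ => (g (q.1, q.2.1) * g (q.1, q.2.2) : ℝ≥0∞) :=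
    (hgm.comp e1).mul (hgm.comp e2)
  have hK : Measurable fun q : ℝ × ℝ × ℝ =>
      ENNReal.ofReal (max |q.2.1 - q.2.2| ((1 / 2) ^ N) ^ (-t)) := by fun_prop
  have hN : ∀ r, Measurable fun q : ℝ × ℝ × ℝ => nearInd r q.2.1 q.2.2 := fun r =>
    (measurable_nearInd r).comp measurable_snd
  calc sliceEnergy t (fun q => (F q * g q : ℝ≥0∞))
      ≤ cubeInt (fun x y y' => F (x, y) * F (x, y') *
        (g (x, y) * g (x, y') * ENNReal.ofReal (max |y - y'| ((1 / 2) ^ N) ^ (-t))) +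
        (b * b : ℝ≥0∞) * ∑' j : ℕ, ENNReal.ofReal (((1 / 2 : ℝ) ^ (j + N + 1)) ^ (-t)) *
          (F (x, y) * F (x, y') * nearInd ((1 / 2) ^ (j + N)) y y')) := by
        refine cubeInt_mono fun x hx y hy y' hy' => ?_
        have h1 : ((g (x, y) : ℝ≥0∞)) ≤ b := by exact_mod_cast hb x hx y hy
        have h2 : ((g (x, y') : ℝ≥0∞)) ≤ b := by exact_mod_cast hb x hx y' hy'
        calc (F (x, y) * g (x, y) : ℝ≥0∞) * (F (x, y') * g (x, y')) * edist y y' ^ (-t)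
            = F (x, y) * F (x, y') * (g (x, y) * g (x, y') * edist y y' ^ (-t)) := by ring
          _ ≤ F (x, y) * F (x, y') * (g (x, y) * g (x, y') * (
              ENNReal.ofReal (max |y - y'| ((1 / 2) ^ N) ^ (-t)) +
              ∑' j, ENNReal.ofReal (((1 / 2 : ℝ) ^ (j + N + 1)) ^ (-t)) *
                nearInd ((1 / 2) ^ (j + N)) y y')) := by
              gcongr; exact edist_rpow_neg_le ht N y y'
          _ = F (x, y) * F (x, y') *
              (g (x, y) * g (x, y') * ENNReal.ofReal (max |y - y'| ((1 / 2) ^ N) ^ (-t))) +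
              g (x, y) * g (x, y') *
              ∑' j : ℕ, ENNReal.ofReal (((1 / 2 : ℝ) ^ (j + N + 1)) ^ (-t)) *
              (F (x, y) * F (x, y') * nearInd ((1 / 2) ^ (j + N)) y y') := by
              simp only [mul_left_comm (ENNReal.ofReal _) (_ * _ : ℝ≥0∞)]
              rw [ENNReal.tsum_mul_left]
              ring
          _ ≤ _ := by gcongr
    _ = _ := by
        have hT : ∀ j : ℕ, Measurable fun q : ℝ × ℝ × ℝ =>
            ENNReal.ofReal (((1 / 2 : ℝ) ^ (j + N + 1)) ^ (-t)) *
            (F (q.1, q.2.1) * F (q.1, q.2.2) * nearInd ((1 / 2) ^ (j + N)) q.2.1 q.2.2) :=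
          fun j => (hFF.mul (hN _)).const_mul _
        have hT2 : Measurable fun q : ℝ × ℝ × ℝ =>
            ∑' j : ℕ, ENNReal.ofReal (((1 / 2 : ℝ) ^ (j + N + 1)) ^ (-t)) *
            (F (q.1, q.2.1) * F (q.1, q.2.2) * nearInd ((1 / 2) ^ (j + N)) q.2.1 q.2.2) :=
          Measurable.tsum hT
        rw [cubeInt_add (hFF.mul (hgg.mul hK)) (hT2.const_mul _), cubeInt_const_mul _ hT2,
          cubeInt_tsum hT]
    _ ≤ _ := by
        gcongr with j
        rw [cubeInt_const_mul _ (hFF.mul (hN _))]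
        gcongr
        exact hcorr _ (by positivity) (pow_le_one₀ (by norm_num) (by norm_num))

lemma VerticalEquidistribution.eventually_sliceEnergy_lt {F : ℕ → ℝ × ℝ → ℝ≥0}
    (hF : VerticalEquidistribution F) {g : ℝ × ℝ → ℝ≥0} (hg : Continuous g) {s t C : ℝ}
    (ht : 0 < t) (hts : t < s)
    (hcorr : ∀ k, ∀ r : ℝ, 0 < r → r ≤ 1 →
      cubeInt (fun x y y' => F k (x, y) * F k (x, y') * nearInd r y y') ≤ ENNReal.ofReal (C * r ^ s))
    {E : ℝ≥0∞} (hE : sliceEnergy t (fun q => g q) < E) :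
    ∀ᶠ k in atTop, sliceEnergy t (fun q => (F k q * g q : ℝ≥0∞)) < E := by
  obtain ⟨b, hb⟩ : ∃ b : ℝ≥0, ∀ x ∈ halfIco, ∀ y ∈ halfIco, g (x, y) ≤ b := by
    obtain ⟨b, hb⟩ := ((isCompact_Icc (a := (0 : ℝ)) (b := 1 / 2)).prod
      (isCompact_Icc (a := (0 : ℝ)) (b := 1 / 2))).bddAbove_image hg.continuousOn
    exact ⟨b, fun x hx y hy => hb ⟨(x, y),
      ⟨halfIco_subset_Icc hx, halfIco_subset_Icc hy⟩, rfl⟩⟩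
  obtain ⟨E', hE1, hE2⟩ := exists_between hE
  have hE' : E' ≠ ⊤ := hE2.ne_top
  have htail := ENNReal.tendsto_sum_nat_add _ (tsum_shell_ne_top hts C)
  have htail2 := ENNReal.Tendsto.const_mul (a := (b * b : ℝ≥0∞)) htail
    (Or.inr (ENNReal.mul_ne_top ENNReal.coe_ne_top ENNReal.coe_ne_top))
  rw [mul_zero] at htail2
  obtain ⟨N, hN⟩ := (htail2.eventually_lt_const (tsub_pos_of_lt hE2)).exists
  have hpos : (0 : ℝ) < (1 / 2) ^ N := by positivity
  have hH : Continuous fun q : ℝ × ℝ × ℝ => g (q.1, q.2.1) * g (q.1, q.2.2) *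
      Real.toNNReal (max |q.2.1 - q.2.2| ((1 / 2) ^ N) ^ (-t)) := by
    have : Continuous fun q : ℝ × ℝ × ℝ => max |q.2.1 - q.2.2| ((1 / 2) ^ N) ^ (-t) :=
      Continuous.rpow_const (by fun_prop) fun q => Or.inl (lt_max_of_lt_right hpos).ne'
    fun_prop
  have hfar := hF.eventually_cubeInt_lt hH (E := E') (by
    refine lt_of_le_of_lt (cubeInt_mono fun x _ y _ y' _ => ?_) hE1
    simp only [ENNReal.coe_mul]
    gcongr
    rw [edist_dist, Real.dist_eq]
    rcases (abs_nonneg (y - y')).eq_or_lt' with h0 | h0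
    · rw [h0]; simp [ht]
    · rw [ENNReal.ofReal_rpow_of_pos h0]
      exact ENNReal.ofReal_le_ofReal
        (Real.rpow_le_rpow_of_nonpos h0 (le_max_left _ _) (by linarith)))
  filter_upwards [hfar] with k hk
  refine (sliceEnergy_mul_le (hF.continuous k) hg ht hb (hcorr k) N).trans_lt ?_
  calc _ < E' + (E - E') := by
        refine ENNReal.add_lt_add ?_ hN
        simp only [ENNReal.coe_mul] at hk
        exact hk
    _ = E := add_tsub_cancel_of_le hE2.le
end

section
open MeasureTheory Set Filter Topology ENNReal NNReal

lemma exists_ball_cover {X : Type*} [MetricSpace X] [MeasurableSpace X] [BorelSpace X]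
    {d : ℝ} (hd : 0 < d) {W : Set X} (hW : μH[d] W = 0) {ε : ℝ≥0∞} (hε : 0 < ε) [Nonempty X] :
    ∃ (p : ℕ → X) (ρ : ℕ → ℝ), (∀ i, 0 < ρ i) ∧ W ⊆ ⋃ i, Metric.ball (p i) (ρ i) ∧
      ∑' i, ENNReal.ofReal (2 * ρ i) ^ d < ε := by
  have h4 : (4 : ℝ≥0∞) ^ d ≠ 0 := by simp [ENNReal.rpow_eq_zero_iff, hd]
  have h4' : (4 : ℝ≥0∞) ^ d ≠ ⊤ := ENNReal.rpow_ne_top_of_nonneg hd.le (by simp)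
  obtain ⟨ε', hε'0, hε'⟩ : ∃ ε' : ℝ≥0∞, 0 < ε' ∧ (4 : ℝ≥0∞) ^ d * (ε' + ε') ≤ ε := by
    refine ⟨ε / 4 ^ d / 2, ENNReal.div_pos (ENNReal.div_pos hε.ne' h4').ne' (by simp), ?_⟩
    rw [ENNReal.add_halves, ENNReal.mul_div_cancel h4 h4']
  rw [Measure.hausdorffMeasure_apply] at hW
  have h1 := (ENNReal.iSup_eq_zero.1 hW) 1
  rw [iSup_pos one_pos] at h1
  have h2 := h1.trans_lt hε'0
  simp only [iInf_lt_iff] at h2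
  obtain ⟨T, hcov, hd1, hT⟩ := h2
  obtain ⟨e, he0, he⟩ := ENNReal.exists_pos_sum_of_countable hε'0.ne' ℕ
  classical
  let p : ℕ → X := fun i => if h : (T i).Nonempty then h.some else Classical.arbitrary X
  have hne : ∀ i, Metric.ediam (T i) ≠ ⊤ := fun i => ne_top_of_le_ne_top ENNReal.one_ne_top (hd1 i)
  have hη : ∀ i, (0 : ℝ) < (e i : ℝ) ^ d⁻¹ := fun i => Real.rpow_pos_of_pos (he0 i) _
  refine ⟨p, fun i => (Metric.ediam (T i)).toReal + (e i : ℝ) ^ d⁻¹, fun i => ?_, ?_, ?_⟩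
  · have := hη i
    positivity
  · intro q hq
    obtain ⟨i, hi⟩ := mem_iUnion.1 (hcov hq)
    refine mem_iUnion.2 ⟨i, ?_⟩
    have hn : (T i).Nonempty := ⟨q, hi⟩
    have hp : p i ∈ T i := by simp only [p, hn, dif_pos]; exact hn.some_mem
    rw [Metric.mem_ball]
    have : dist q (p i) ≤ (Metric.ediam (T i)).toReal := by
      rw [dist_edist]
      exact ENNReal.toReal_mono (hne i) (Metric.edist_le_ediam_of_mem hi hp)
    linarith [hη i]
  · refine lt_of_lt_of_le ?_ hε'
    have hterm : ∀ i, ENNReal.ofReal (2 * ((Metric.ediam (T i)).toReal + (e i : ℝ) ^ d⁻¹)) ^ d ≤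
        4 ^ d * ((⨆ _ : (T i).Nonempty, Metric.ediam (T i) ^ d) + e i) := by
      intro i
      have hx : ENNReal.ofReal (2 * ((Metric.ediam (T i)).toReal + (e i : ℝ) ^ d⁻¹)) ≤
          4 * max (Metric.ediam (T i)) ((e i : ℝ≥0∞) ^ d⁻¹) := by
        rw [ENNReal.ofReal_mul (by norm_num), ENNReal.ofReal_add (by simp) (hη i).le,
          ENNReal.ofReal_toReal (hne i),
          ← ENNReal.ofReal_rpow_of_pos (p := d⁻¹) (NNReal.coe_pos.2 (he0 i)),
          ENNReal.ofReal_coe_nnreal]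
        calc _ ≤ ENNReal.ofReal 2 * (max (Metric.ediam (T i)) ((e i : ℝ≥0∞) ^ d⁻¹) +
              max (Metric.ediam (T i)) ((e i : ℝ≥0∞) ^ d⁻¹)) := by
              gcongr
              · exact le_max_left _ _
              · exact le_max_right _ _
          _ = _ := by
              rw [← two_mul, ← mul_assoc]; norm_num
      have hs : (⨆ _ : (T i).Nonempty, Metric.ediam (T i) ^ d) = Metric.ediam (T i) ^ d := by
        rcases (T i).eq_empty_or_nonempty with h | h
        · simp [h, hd]
        · simp [h]
      rw [hs]
      calc _ ≤ (4 * max (Metric.ediam (T i)) ((e i : ℝ≥0∞) ^ d⁻¹)) ^ d :=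
            ENNReal.rpow_le_rpow hx hd.le
        _ = 4 ^ d * max (Metric.ediam (T i)) ((e i : ℝ≥0∞) ^ d⁻¹) ^ d :=
            ENNReal.mul_rpow_of_nonneg _ _ hd.le
        _ ≤ _ := by
            gcongr
            rcases max_choice (Metric.ediam (T i)) ((e i : ℝ≥0∞) ^ d⁻¹) with h | h <;> rw [h]
            · exact le_self_add
            · rw [ENNReal.rpow_inv_rpow hd.ne']; exact le_add_self
    refine (ENNReal.tsum_le_tsum hterm).trans_lt ?_
    rw [ENNReal.tsum_mul_left, ENNReal.tsum_add]
    exact (ENNReal.mul_lt_mul_iff_right h4 h4').2 (ENNReal.add_lt_add hT he)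

lemma VerticalEquidistribution.exists_step {F : ℕ → ℝ × ℝ → ℝ≥0}
    (hF : VerticalEquidistribution F) {s t C : ℝ} (ht : 0 < t) (hts : t < s)
    (hcorr : ∀ k, ∀ r : ℝ, 0 < r → r ≤ 1 →
      cubeInt (fun x y y' => F k (x, y) * F k (x, y') * nearInd r y y') ≤ ENNReal.ofReal (C * r ^ s))
    {g : ℝ × ℝ → ℝ≥0} (hg : Continuous g) {m E : ℝ≥0∞} (hm : m < squareMass fun q => g q)
    (hE : sliceEnergy t (fun q => g q) < E) (k₀ : ℕ) :
    ∃ k, k₀ ≤ k ∧ m < squareMass (fun q => (F k q * g q : ℝ≥0)) ∧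
      sliceEnergy t (fun q => (F k q * g q : ℝ≥0)) < E := by
  have h := ((hF.eventually_lt_squareMass hg hm).and
    (hF.eventually_sliceEnergy_lt hg ht hts hcorr hE)).and (eventually_ge_atTop k₀)
  obtain ⟨k, ⟨h1, h2⟩, h3⟩ := h.exists
  simp only [ENNReal.coe_mul]
  exact ⟨k, h3, h1, h2⟩

lemma VerticalEquidistribution.exists_start {F : ℕ → ℝ × ℝ → ℝ≥0}
    (hF : VerticalEquidistribution F) {s t C : ℝ} (ht : 0 < t) (hts : t < s)
    (hcorr : ∀ k, ∀ r : ℝ, 0 < r → r ≤ 1 →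
      cubeInt (fun x y y' => F k (x, y) * F k (x, y') * nearInd r y y') ≤ ENNReal.ofReal (C * r ^ s)) :
    ∃ k, 0 < squareMass (fun q => F k q) ∧ sliceEnergy t (fun q => F k q) ≠ ⊤ := by
  have h1 : squareMass (fun _ => ((1 : ℝ≥0) : ℝ≥0∞)) = volume halfIco * volume halfIco := by
    simp [squareMass]
  have h0 : 0 < volume halfIco := by rw [volume_halfIco]; simp
  obtain ⟨k, hk⟩ := (hF.eventually_lt_squareMass (g := fun _ => 1) continuous_const
    (m := 0) (by rw [h1]; exact ENNReal.mul_pos h0.ne' h0.ne')).exists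
  simp only [ENNReal.coe_one, mul_one] at hk
  refine ⟨k, hk, ?_⟩
  have hFk := hF.continuous k
  have := sliceEnergy_mul_le hFk (g := fun _ => 1) continuous_const ht (b := 1)
    (fun _ _ _ _ => le_rfl) (hcorr k) 0
  simp only [ENNReal.coe_one, mul_one, one_mul, add_zero] at this
  refine ne_top_of_le_ne_top (ENNReal.add_ne_top.2 ⟨?_, tsum_shell_ne_top hts C⟩) this
  obtain ⟨b, hb⟩ : ∃ b : ℝ≥0, ∀ x ∈ halfIco, ∀ y ∈ halfIco, F k (x, y) ≤ b := by
    obtain ⟨b, hb⟩ := ((isCompact_Icc (a := (0 : ℝ)) (b := 1 / 2)).prod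
      (isCompact_Icc (a := (0 : ℝ)) (b := 1 / 2))).bddAbove_image hFk.continuousOn
    exact ⟨b, fun x hx y hy => hb ⟨(x, y),
      ⟨halfIco_subset_Icc hx, halfIco_subset_Icc hy⟩, rfl⟩⟩
  have hle : cubeInt (fun x y y' => F k (x, y) * F k (x, y') *
      ENNReal.ofReal (max |y - y'| ((1 / 2) ^ 0) ^ (-t))) ≤
      cubeInt (fun _ _ _ => (b * b * 1 : ℝ≥0∞)) := by
    refine cubeInt_mono fun x hx y hy y' hy' => ?_
    gcongr
    · exact hb x hx y hy
    · exact hb x hx y' hy'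
    · rw [← ENNReal.ofReal_one]
      refine ENNReal.ofReal_le_ofReal (Real.rpow_le_one_of_one_le_of_nonpos ?_ (by linarith))
      simp
  refine ne_top_of_le_ne_top ?_ hle
  simp only [cubeInt, lintegral_const, MeasurableSet.univ, Measure.restrict_apply, univ_inter]
  have hv : volume halfIco ≠ ⊤ := ne_top_of_le_ne_top ENNReal.one_ne_top volume_halfIco_le
  exact ENNReal.mul_ne_top (ENNReal.mul_ne_top (ENNReal.mul_ne_top (by
    simp [ENNReal.mul_eq_top]) hv) hv) hv

theorem VerticalEquidistribution.le_dimH {F : ℕ → ℝ × ℝ → ℝ≥0}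
    (hF : VerticalEquidistribution F) {s t C : ℝ} (ht : 0 < t) (hts : t < s)
    (hcorr : ∀ k, ∀ r : ℝ, 0 < r → r ≤ 1 →
      cubeInt (fun x y y' => F k (x, y) * F k (x, y') * nearInd r y y') ≤ ENNReal.ofReal (C * r ^ s))
    {Z : ℕ → Set (ℝ × ℝ)} (hZ : ∀ k, IsClosed (Z k)) (hFZ : ∀ k q, q ∉ Z k → F k q = 0)
    {W : Set (ℝ × ℝ)}
    (hW : ∀ q ∈ Icc (0 : ℝ) (1 / 2) ×ˢ Icc (0 : ℝ) (1 / 2), (∃ᶠ k in atTop, q ∈ Z k) → q ∈ W) :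
    ENNReal.ofReal (1 + t) ≤ dimH W := by
  by_contra! hlt
  have hnull : μH[1 + t] W = 0 := by
    have := hausdorffMeasure_of_dimH_lt (s := W) (d := Real.toNNReal (1 + t)) hlt
    rwa [Real.coe_toNNReal _ (by linarith)] at this
  obtain ⟨k₀, hk₀, hk₀'⟩ := hF.exists_start ht hts hcorr
  obtain ⟨m, hm0, hm⟩ := exists_between hk₀
  obtain ⟨E, hE, hEt⟩ := exists_between (lt_top_iff_ne_top.2 hk₀')
  let S := {a : ℕ × (ℝ × ℝ → ℝ≥0) // Continuous a.2 ∧ m < squareMass (fun q => a.2 q) ∧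
      sliceEnergy t (fun q => a.2 q) < E}
  have step : ∀ a : S, ∃ b : S, a.1.1 + 1 ≤ b.1.1 ∧ b.1.2 = fun q => F b.1.1 q * a.1.2 q := by
    rintro ⟨⟨k, g⟩, hg, hgm, hgE⟩
    obtain ⟨k', h1, h2, h3⟩ := hF.exists_step ht hts hcorr hg hgm hgE (k + 1)
    exact ⟨⟨(k', fun q => F k' q * g q), (hF.continuous k').mul hg, h2, h3⟩, h1, rfl⟩
  choose next hnext1 hnext2 using step
  let a : ℕ → S := fun j => next^[j] ⟨(k₀, F k₀), hF.continuous k₀, hm, hE⟩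
  have ha : ∀ j, a (j + 1) = next (a j) := fun j => Function.iterate_succ_apply' _ _ _
  let κ : ℕ → ℕ := fun j => (a j).1.1
  have hκ : StrictMono κ := strictMono_nat_of_lt_succ fun j => by
    have := hnext1 (a j)
    simp only [κ, ha]; exact this
  let K : ℕ → Set (ℝ × ℝ) := fun j =>
    (Icc (0 : ℝ) (1 / 2) ×ˢ Icc (0 : ℝ) (1 / 2)) ∩ ⋂ i ≤ j, Z (κ i)
  have hbox : IsCompact (Icc (0 : ℝ) (1 / 2) ×ˢ Icc (0 : ℝ) (1 / 2)) :=
    isCompact_Icc.prod isCompact_Icc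
  have hK : ∀ j, IsCompact (K j) := fun j => hbox.inter_right
    (isClosed_biInter fun i _ => hZ _)
  have hKanti : Antitone K := fun i j hij => inter_subset_inter_right _
    (biInter_subset_biInter_left fun l hl => le_trans hl hij)
  have hKW : ⋂ j, K j ⊆ W := by
    intro q hq
    rw [mem_iInter] at hq
    refine hW q (hq 0).1 ?_
    have : ∀ j, q ∈ Z (κ j) := fun j => by
      have := (hq j).2
      rw [mem_iInter₂] at this
      exact this j le_rfl
    refine frequently_atTop.2 fun N => ⟨κ N, hκ.id_le N, this N⟩
  have hg0 : ∀ j q, q ∈ Icc (0 : ℝ) (1 / 2) ×ˢ Icc (0 : ℝ) (1 / 2) → (a j).1.2 q ≠ 0 → q ∈ K j := by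
    intro j
    suffices h : ∀ q, (a j).1.2 q ≠ 0 → ∀ i ≤ j, q ∈ Z (κ i) from
      fun q hq h' => ⟨hq, mem_iInter₂.2 (h q h')⟩
    induction j with
    | zero =>
      intro q hq i hi
      obtain rfl : i = 0 := by omega
      by_contra h
      exact hq (hFZ _ _ h)
    | succ j ih =>
      intro q hq i hi
      rw [ha, hnext2] at hq
      have hq := mul_ne_zero_iff.1 hq
      rcases Nat.lt_or_ge i (j + 1) with h | h
      · exact ih q hq.2 i (by omega)
      · obtain rfl : i = j + 1 := by omega
        by_contra h
        have h2 : κ (j + 1) = (next (a j)).1.1 := by simp only [κ, ha]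
        rw [h2] at h
        exact hq.1 (hFZ _ _ h)
  have hE0 : E ≠ 0 := (pos_of_gt hE).ne'
  have hmt : m ≠ ⊤ := hm.ne_top
  -- threshold for the covering sum
  have hl0 : 2 * E / m ≠ 0 := (ENNReal.div_pos (by simp [hE0]) hmt).ne'
  have hlt' : 2 * E / m ≠ ⊤ := (ENNReal.div_lt_top (ENNReal.mul_ne_top (by simp) hEt.ne) hm0.ne').ne
  obtain ⟨p, ρ, hρ, hcov, hsum⟩ := exists_ball_cover (by linarith) hnull
    (ε := m / 2 / (2 * E / m)) (ENNReal.div_pos (ENNReal.div_pos hm0.ne' (by simp)).ne' hlt')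
  have hopen : IsOpen (⋃ i, Metric.ball (p i) (ρ i)) := isOpen_iUnion fun i => Metric.isOpen_ball
  obtain ⟨j, hj⟩ := exists_subset_nhds_of_isCompact' (hKanti.directed_ge) hK
    (fun j => (hK j).isClosed) (U := ⋃ i, Metric.ball (p i) (ρ i)) fun q hq =>
      hopen.mem_nhds (hcov (hKW hq))
  obtain ⟨hc, hmass, hen⟩ := (a j).2
  have hmain := squareMass_le_of_cover (G := fun q => ((a j).1.2 q : ℝ≥0∞))
    hc.measurable.coe_nnreal_ennreal (V := fun i => Metric.ball (p i) (ρ i))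
    (fun i => Metric.isOpen_ball.measurableSet) p ρ hρ (fun i => Metric.ball_subset_closedBall)
    ht hl0 hlt' (fun q hq h => hj (hg0 j q
      ⟨halfIco_subset_Icc hq.1, halfIco_subset_Icc hq.2⟩ (by simpa using h)))
  have h1 : 2 * E / m * ∑' i, ENNReal.ofReal (2 * ρ i) ^ (1 + t) ≤ m / 2 := by
    calc _ ≤ 2 * E / m * (m / 2 / (2 * E / m)) := by gcongr
      _ = m / 2 := ENNReal.mul_div_cancel hl0 hlt'
  have h2 : (2 * E / m)⁻¹ * sliceEnergy t (fun q => ((a j).1.2 q : ℝ≥0∞)) ≤ m / 2 := by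
    calc _ ≤ (2 * E / m)⁻¹ * E := by gcongr
      _ = m / 2 := by
        rw [ENNReal.inv_div (Or.inl hmt) (Or.inl hm0.ne'), ENNReal.div_eq_inv_mul,
          ENNReal.div_eq_inv_mul, ENNReal.mul_inv (by simp) (by simp)]
        rw [mul_right_comm, mul_assoc 2⁻¹, ENNReal.inv_mul_cancel hE0 hEt.ne, mul_one]
  have := hmass.trans_le (hmain.trans (add_le_add h1 h2))
  rw [ENNReal.add_halves] at this
  exact lt_irrefl _ this
end

section
open MeasureTheory Set Filter Topology ENNReal NNReal

/-- A continuous probability density supported on `[0, w]`. -/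
noncomputable def bump (w z : ℝ) : ℝ≥0 := Real.toNNReal (6 * z * (w - z) / w ^ 3)

lemma continuous_bump (w : ℝ) : Continuous (bump w) := by unfold bump; fun_prop

lemma bump_eq_zero {w z : ℝ} (hw : 0 < w) (hz : z ∉ Ioo 0 w) : bump w z = 0 := by
  refine Real.toNNReal_of_nonpos (div_nonpos_of_nonpos_of_nonneg ?_ (by positivity))
  rw [mem_Ioo, not_and_or, not_lt, not_lt] at hz
  rcases hz with h | h
  · exact mul_nonpos_of_nonpos_of_nonneg (by linarith) (by linarith)
  · exact mul_nonpos_of_nonneg_of_nonpos (by linarith) (by linarith)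

lemma bump_le {w : ℝ} (hw : 0 < w) (z : ℝ) : (bump w z : ℝ) ≤ 3 / (2 * w) := by
  rw [bump, Real.coe_toNNReal', max_le_iff]
  refine ⟨?_, by positivity⟩
  rw [div_le_div_iff₀ (by positivity) (by positivity)]
  nlinarith [sq_nonneg (w - 2 * z), mul_nonneg hw.le (sq_nonneg (w - 2 * z))]

lemma lintegral_bump {w : ℝ} (hw : 0 < w) : ∫⁻ z in Ioo 0 w, (bump w z : ℝ≥0∞) = 1 := by
  have h : ∫ z in (0 : ℝ)..w, 6 * z * (w - z) / w ^ 3 = 1 := by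
    have e : ∀ z : ℝ, 6 * z * (w - z) / w ^ 3 = 6 / w ^ 2 * z ^ 1 - 6 / w ^ 3 * z ^ 2 := by
      intro z; field_simp
    simp only [e]
    rw [intervalIntegral.integral_sub ((by fun_prop : Continuous _).intervalIntegrable _ _)
      ((by fun_prop : Continuous _).intervalIntegrable _ _)]
    simp only [intervalIntegral.integral_const_mul, integral_pow]
    field_simp
    norm_num
    ring
  rw [intervalIntegral.integral_of_le hw.le, integral_Ioc_eq_integral_Ioo] at h
  rw [← ENNReal.ofReal_one, ← h, ofReal_integral_eq_lintegral_ofReal]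
  · rfl
  · exact (Continuous.integrableOn_Icc (by fun_prop)).mono_set Ioo_subset_Icc_self
  · refine (ae_restrict_iff' measurableSet_Ioo).2 (Eventually.of_forall fun z hz => ?_)
    have := hz.1
    have := sub_pos.2 hz.2
    simp only [Pi.zero_apply]
    positivity

lemma lintegral_bump_sub {w : ℝ} (hw : 0 < w) (x : ℝ) :
    ∫⁻ z in Ioo x (x + w), (bump w (z - x) : ℝ≥0∞) = 1 := by
  rw [← lintegral_bump hw, ← lintegral_indicator measurableSet_Ioo,
    ← lintegral_indicator measurableSet_Ioo,
    ← lintegral_sub_right_eq_self (fun z => (Ioo 0 w).indicator (fun z => (bump w z : ℝ≥0∞)) z) x]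
  refine lintegral_congr fun z => ?_
  simp only [indicator, mem_Ioo, sub_pos, sub_lt_iff_lt_add']

lemma setLIntegral_bump_sub_le {w : ℝ} (hw : 0 < w) (x : ℝ) (S : Set ℝ) :
    ∫⁻ z in S, (bump w (z - x) : ℝ≥0∞) ≤ 1 := by
  rw [← lintegral_bump_sub hw x, ← lintegral_indicator measurableSet_Ioo]
  refine (setLIntegral_le_lintegral _ _).trans (lintegral_mono fun z => ?_)
  by_cases hz : z ∈ Ioo x (x + w)
  · simp [hz]
  · rw [bump_eq_zero hw]
    · simp
    · intro h
      exact hz ⟨by linarith [h.1], by linarith [h.2]⟩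

/-- A density close to Lebesgue measure on `[0, L ^ p]`, supported within distance `w` to the right
of the `p`-th powers. -/
noncomputable def spikes (p L : ℕ) (w z : ℝ) : ℝ≥0 :=
  ∑ c ∈ Finset.range L, Real.toNNReal ((c + 1 : ℝ) ^ p - (c : ℝ) ^ p) * bump w (z - (c : ℝ) ^ p)

lemma continuous_spikes (p L : ℕ) (w : ℝ) : Continuous (spikes p L w) := by
  have := continuous_bump w
  unfold spikes
  fun_prop

lemma pow_gap_nonneg (p c : ℕ) : 0 ≤ (c + 1 : ℝ) ^ p - (c : ℝ) ^ p :=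
  sub_nonneg.2 (pow_le_pow_left₀ (by positivity) (by linarith) _)

lemma pow_gap_le {p L c : ℕ} (hc : c < L) :
    (c + 1 : ℝ) ^ p - (c : ℝ) ^ p ≤ p * (L : ℝ) ^ (p - 1) := by
  have h := abs_pow_sub_pow_le (c + 1 : ℝ) (c : ℝ) p
  have hL : (c : ℝ) + 1 ≤ L := by exact_mod_cast hc
  have hc0 : (0 : ℝ) ≤ c := by positivity
  rw [abs_of_nonneg (pow_gap_nonneg p c), add_sub_cancel_left, abs_one, one_mul,
    abs_of_nonneg (by positivity : (0 : ℝ) ≤ c + 1), abs_of_nonneg hc0,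
    max_eq_left (by linarith)] at h
  refine h.trans ?_
  gcongr

lemma one_le_pow_gap {p : ℕ} (hp : 1 ≤ p) (c : ℕ) : 1 ≤ (c + 1 : ℝ) ^ p - (c : ℝ) ^ p := by
  have : c ^ p + 1 ≤ (c + 1) ^ p := Nat.pow_lt_pow_left (Nat.lt_succ_self c) (by omega)
  have : (c : ℝ) ^ p + 1 ≤ (c + 1 : ℝ) ^ p := by exact_mod_cast this
  linarith

lemma exists_pow_cell {p L : ℕ} (hp : 1 ≤ p) {z : ℝ} (h0 : 0 ≤ z) (hz : z < (L : ℝ) ^ p) :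
    ∃ c < L, (c : ℝ) ^ p ≤ z ∧ z < (c + 1 : ℝ) ^ p := by
  classical
  have hex : ∃ k : ℕ, z < (k : ℝ) ^ p := ⟨L, hz⟩
  have h1 := Nat.find_spec hex
  have hne : Nat.find hex ≠ 0 := by
    intro h
    rw [h, Nat.cast_zero, zero_pow (by omega)] at h1
    linarith
  obtain ⟨c, hc⟩ := Nat.exists_eq_succ_of_ne_zero hne
  refine ⟨c, ?_, ?_, ?_⟩
  · have := Nat.find_min' hex hz
    omega
  · exact not_lt.1 (Nat.find_min hex (by omega : c < Nat.find hex))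
  · rw [hc] at h1
    exact_mod_cast h1

lemma pow_cell_disjoint {p : ℕ} {c c' : ℕ} {z : ℝ} (h : (c : ℝ) ^ p ≤ z)
    (h' : z < (c + 1 : ℝ) ^ p) (k : (c' : ℝ) ^ p ≤ z) (k' : z < (c' + 1 : ℝ) ^ p) : c = c' := by
  have key : ∀ a b : ℕ, (a : ℝ) ^ p ≤ z → z < (b + 1 : ℝ) ^ p → a ≤ b := by
    intro a b ha hb
    by_contra! hab
    have : (b + 1 : ℝ) ≤ a := by exact_mod_cast hab
    have := pow_le_pow_left₀ (by positivity) this p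
    linarith
  exact le_antisymm (key _ _ h k') (key _ _ k h')

lemma exists_of_spikes_ne_zero {p L : ℕ} {w z : ℝ} (hw : 0 < w)
    (h : spikes p L w z ≠ 0) : ∃ c < L, 0 < z - (c : ℝ) ^ p ∧ z - (c : ℝ) ^ p < w := by
  obtain ⟨c, hc, hne⟩ := Finset.exists_ne_zero_of_sum_ne_zero h
  refine ⟨c, Finset.mem_range.1 hc, ?_⟩
  by_contra hcon
  exact hne (by rw [bump_eq_zero hw hcon, mul_zero])

lemma spikes_le {p L : ℕ} (hp : 1 ≤ p) {w : ℝ} (hw : 0 < w) (hw1 : w ≤ 1) (z : ℝ) :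
    (spikes p L w z : ℝ) ≤ p * (L : ℝ) ^ (p - 1) * (3 / (2 * w)) := by
  by_cases h : spikes p L w z = 0
  · rw [h]
    have : 0 ≤ 3 / (2 * w) := by positivity
    simp only [NNReal.coe_zero]; positivity
  obtain ⟨c, hc, h1, h2⟩ := exists_of_spikes_ne_zero hw h
  have heq : spikes p L w z =
      Real.toNNReal ((c + 1 : ℝ) ^ p - (c : ℝ) ^ p) * bump w (z - (c : ℝ) ^ p) := by
    refine Finset.sum_eq_single_of_mem c (Finset.mem_range.2 hc) fun c' _ hne => ?_
    rw [bump_eq_zero hw, mul_zero]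
    rintro ⟨h3, h4⟩
    have e1 := one_le_pow_gap hp c
    have e2 := one_le_pow_gap hp c'
    exact hne (pow_cell_disjoint (z := z) (by linarith) (by linarith) (by linarith) (by linarith))
  rw [heq, NNReal.coe_mul, Real.coe_toNNReal _ (pow_gap_nonneg p c)]
  gcongr
  · exact pow_gap_le hc
  · exact bump_le hw _

lemma lintegral_spikes (p L : ℕ) (w : ℝ) (S : Set ℝ) :
    ∫⁻ z in S, (spikes p L w z : ℝ≥0∞) = ∑ c ∈ Finset.range L,
      volume (Ico ((c : ℝ) ^ p) ((c + 1 : ℝ) ^ p)) *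
        ∫⁻ z in S, (bump w (z - (c : ℝ) ^ p) : ℝ≥0∞) := by
  have := continuous_bump w
  simp only [spikes, ENNReal.ofNNReal_finsetSum, ENNReal.coe_mul, Real.volume_Ico]
  rw [lintegral_finsetSum]
  · refine Finset.sum_congr rfl fun c _ => ?_
    rw [lintegral_const_mul' _ _ ENNReal.coe_ne_top]
    rfl
  · intro c _
    have : Measurable fun z => bump w (z - (c : ℝ) ^ p) := by fun_prop
    exact this.coe_nnreal_ennreal.const_mul _

lemma lintegral_spikes_le {p L : ℕ} (hp : 1 ≤ p) {w : ℝ} (hw : 0 < w) (hw1 : w ≤ 1) (u v : ℝ) :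
    ∫⁻ z in Icc u v, (spikes p L w z : ℝ≥0∞) ≤
      ENNReal.ofReal (v - u + 2 * (p * (L : ℝ) ^ (p - 1))) := by
  classical
  set G : ℝ := p * (L : ℝ) ^ (p - 1) with hG
  have hG1 : ∀ c < L, 1 ≤ G := fun c hc => (one_le_pow_gap hp c).trans (pow_gap_le hc)
  rw [lintegral_spikes]
  set S := (Finset.range L).filter fun c : ℕ => (c : ℝ) ^ p ≤ v ∧ u ≤ (c : ℝ) ^ p + w
  calc _ ≤ ∑ c ∈ S, volume (Ico ((c : ℝ) ^ p) ((c + 1 : ℝ) ^ p)) := by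
        rw [Finset.sum_filter]
        refine Finset.sum_le_sum fun c _ => ?_
        split_ifs with h
        · calc _ ≤ volume (Ico ((c : ℝ) ^ p) ((c + 1 : ℝ) ^ p)) * 1 := by
                gcongr; exact setLIntegral_bump_sub_le hw _ _
            _ = _ := mul_one _
        · rw [nonpos_iff_eq_zero, mul_eq_zero]
          right
          refine (setLIntegral_congr_fun measurableSet_Icc fun z hz => ?_).trans lintegral_zero
          rw [bump_eq_zero hw, ENNReal.coe_zero]
          rintro ⟨h1, h2⟩
          exact h ⟨by linarith [hz.2], by linarith [hz.1]⟩
    _ = volume (⋃ c ∈ S, Ico ((c : ℝ) ^ p) ((c + 1 : ℝ) ^ p)) := by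
        rw [measure_biUnion_finset _ fun _ _ => measurableSet_Ico]
        intro c _ c' _ hne
        refine Set.disjoint_left.2 fun z hz hz' => hne ?_
        exact pow_cell_disjoint hz.1 hz.2 hz'.1 hz'.2
    _ ≤ volume (Icc (u - G) (v + G)) := by
        refine measure_mono (iUnion₂_subset fun c hc z hz => ?_)
        simp only [S, Finset.mem_filter, Finset.mem_range] at hc
        have e1 := pow_gap_le (p := p) hc.1
        have e2 := hG1 c hc.1
        exact ⟨by linarith [hz.1, hc.2.2], by linarith [hz.2, hc.2.1]⟩
    _ = _ := by rw [Real.volume_Icc]; congr 1; ring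

lemma le_lintegral_spikes {p L : ℕ} (hp : 1 ≤ p) {w : ℝ} (hw : 0 < w) (hw1 : w ≤ 1) {u v : ℝ}
    (hu : 0 ≤ u) (hv : v ≤ (L : ℝ) ^ p) :
    ENNReal.ofReal (v - u) ≤ (∫⁻ z in Ico u v, (spikes p L w z : ℝ≥0∞)) +
      ENNReal.ofReal (2 * (p * (L : ℝ) ^ (p - 1))) := by
  classical
  set G : ℝ := p * (L : ℝ) ^ (p - 1) with hG
  have hG0 : 0 ≤ G := by positivity
  rw [lintegral_spikes]
  set S := (Finset.range L).filter fun c : ℕ => u ≤ (c : ℝ) ^ p ∧ (c + 1 : ℝ) ^ p ≤ v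
  calc ENNReal.ofReal (v - u) = volume (Ico u v) := Real.volume_Ico.symm
    _ ≤ volume ((⋃ c ∈ S, Ico ((c : ℝ) ^ p) ((c + 1 : ℝ) ^ p)) ∪
          (Ico u (u + G) ∪ Ico (v - G) v)) := by
        refine measure_mono fun z hz => ?_
        by_cases h1 : z < u + G
        · exact Or.inr (Or.inl ⟨hz.1, h1⟩)
        by_cases h2 : v - G ≤ z
        · exact Or.inr (Or.inr ⟨h2, hz.2⟩)
        obtain ⟨c, hc, h3, h4⟩ := exists_pow_cell hp (hu.trans hz.1) (hz.2.trans_le hv)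
        have e1 := pow_gap_le (p := p) hc
        refine Or.inl (mem_iUnion₂.2 ⟨c, ?_, h3, h4⟩)
        simp only [S, Finset.mem_filter, Finset.mem_range]
        exact ⟨hc, by linarith, by linarith⟩
    _ ≤ (∑ c ∈ S, volume (Ico ((c : ℝ) ^ p) ((c + 1 : ℝ) ^ p))) +
          (ENNReal.ofReal G + ENNReal.ofReal G) := by
        refine (measure_union_le _ _).trans (add_le_add (measure_biUnion_finset_le _ _)
          ((measure_union_le _ _).trans (add_le_add ?_ ?_)))
        · rw [Real.volume_Ico, add_sub_cancel_left]
        · rw [Real.volume_Ico, sub_sub_self]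
    _ ≤ _ := by
        rw [← ENNReal.ofReal_add hG0 hG0, ← two_mul]
        gcongr
        rw [Finset.sum_filter]
        refine Finset.sum_le_sum fun c _ => ?_
        split_ifs with h
        · have hsub : Ioo ((c : ℝ) ^ p) ((c : ℝ) ^ p + w) ⊆ Ico u v := by
            intro z hz
            have := one_le_pow_gap hp c
            exact ⟨by linarith [hz.1], by linarith [hz.2]⟩
          calc _ = volume (Ico ((c : ℝ) ^ p) ((c + 1 : ℝ) ^ p)) *
                ∫⁻ z in Ioo ((c : ℝ) ^ p) ((c : ℝ) ^ p + w), (bump w (z - (c : ℝ) ^ p) : ℝ≥0∞) := by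
                rw [lintegral_bump_sub hw, mul_one]
            _ ≤ _ := by gcongr
        · exact zero_le
end

section
open MeasureTheory Set Filter Topology ENNReal NNReal

lemma lintegral_comp_affine {f : ℝ → ℝ≥0∞} (hf : Measurable f) {κ : ℝ} (hκ : κ ≠ 0) (c : ℝ) :
    ∫⁻ y, f (c + κ * y) = ENNReal.ofReal |κ|⁻¹ * ∫⁻ z, f z := by
  have h1 : Measurable fun z => f (c + z) := hf.comp (measurable_const_add c)
  rw [← lintegral_add_left_eq_self (μ := volume) f c]
  conv_rhs => rw [← Real.smul_map_volume_mul_left hκ]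
  rw [lintegral_smul_measure, lintegral_map h1 (measurable_const_mul κ), smul_eq_mul, ← mul_assoc,
    ← ENNReal.ofReal_mul (by positivity), inv_mul_cancel₀ (abs_ne_zero.2 hκ), ENNReal.ofReal_one,
    one_mul]

lemma setLIntegral_comp_affine_le {f : ℝ → ℝ≥0∞} (hf : Measurable f) {κ : ℝ} (hκ : κ ≠ 0) (c : ℝ)
    {S T : Set ℝ} (hS : MeasurableSet S) (hT : MeasurableSet T) (hST : ∀ y ∈ S, c + κ * y ∈ T) :
    ∫⁻ y in S, f (c + κ * y) ≤ ENNReal.ofReal |κ|⁻¹ * ∫⁻ z in T, f z := by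
  rw [← lintegral_indicator hT, ← lintegral_comp_affine (hf.indicator hT) hκ c,
    ← lintegral_indicator hS]
  refine lintegral_mono fun y => ?_
  by_cases hy : y ∈ S
  · simp [hy, hST y hy]
  · simp [hy]

lemma lintegral_comp_affine_le {h : ℝ → ℝ≥0∞} (hm : Measurable h) {G : ℝ}
    (hI : ∀ u v, ∫⁻ z in Icc u v, h z ≤ ENNReal.ofReal (v - u + 2 * G)) {κ : ℝ} (hκ : κ ≠ 0)
    (c u v : ℝ) :
    ∫⁻ y in Icc u v, h (c + κ * y) ≤ ENNReal.ofReal (v - u + 2 * G / |κ|) := by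
  have h0 : 0 < |κ| := abs_pos.2 hκ
  rcases lt_or_gt_of_ne hκ with h | h
  · refine (setLIntegral_comp_affine_le hm hκ c measurableSet_Icc
      (measurableSet_Icc (a := c + κ * v) (b := c + κ * u)) fun y hy => ⟨?_, ?_⟩).trans ?_
    · nlinarith [hy.2]
    · nlinarith [hy.1]
    refine (mul_le_mul_right (hI _ _) _).trans_eq ?_
    rw [← ENNReal.ofReal_mul (by positivity), abs_of_neg h]
    congr 1
    field_simp; ring
  · refine (setLIntegral_comp_affine_le hm hκ c measurableSet_Icc
      (measurableSet_Icc (a := c + κ * u) (b := c + κ * v)) fun y hy => ⟨?_, ?_⟩).trans ?_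
    · nlinarith [hy.1]
    · nlinarith [hy.2]
    refine (mul_le_mul_right (hI _ _) _).trans_eq ?_
    rw [← ENNReal.ofReal_mul (by positivity), abs_of_pos h]
    congr 1
    field_simp; ring

lemma lintegral_mul_nearInd_le (f : ℝ → ℝ≥0∞) (r y : ℝ) :
    ∫⁻ y' in halfIco, f y' * nearInd r y y' ≤ ∫⁻ y' in Icc (y - r) (y + r), f y' := by
  refine (setLIntegral_le_lintegral _ _).trans ?_
  rw [← lintegral_indicator measurableSet_Icc]
  refine lintegral_mono fun y' => ?_
  by_cases hy : |y - y'| ≤ r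
  · have : y' ∈ Icc (y - r) (y + r) := by
      rw [abs_le] at hy
      exact ⟨by linarith, by linarith⟩
    simp [nearInd, hy, this]
  · simp [nearInd, hy]

lemma correlation_le_of_slice {h : ℝ → ℝ≥0∞} (hm : Measurable h) {G : ℝ}
    (hI : ∀ u v, ∫⁻ z in Icc u v, h z ≤ ENNReal.ofReal (v - u + 2 * G)) {α β α' β' r R : ℝ}
    (hβ : 0 < β) (hR : ∀ c y, ∫⁻ y' in Icc (y - r) (y + r), h (c + β' * y') ≤ ENNReal.ofReal R)
    (hR0 : 0 ≤ R) :
    cubeInt (fun x y y' => h (α * x + β * y) * h (α' * x + β' * y') * nearInd r y y') ≤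
      ENNReal.ofReal (R * (1 / 2 + 2 * G / β)) := by
  calc cubeInt (fun x y y' => h (α * x + β * y) * h (α' * x + β' * y') * nearInd r y y')
      ≤ ∫⁻ _x in halfIco, ENNReal.ofReal (R * (1 / 2 + 2 * G / β)) := by
        refine lintegral_mono fun x => ?_
        have hmx : Measurable fun y => h (α * x + β * y) := by fun_prop
        have hmx' : Measurable fun y => h (α' * x + β' * y) := by fun_prop
        calc _ ≤ ∫⁻ y in halfIco, h (α * x + β * y) * ENNReal.ofReal R := by
              refine lintegral_mono fun y => ?_
              simp only [mul_assoc]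
              have hN : Measurable fun y' => nearInd r y y' :=
                (measurable_nearInd r).comp measurable_prodMk_left
              have hP : Measurable fun y' => h (α' * x + β' * y') * nearInd r y y' := hmx'.mul hN
              rw [lintegral_const_mul _ hP]
              gcongr
              exact (lintegral_mul_nearInd_le _ _ _).trans (hR _ _)
          _ = (∫⁻ y in halfIco, h (α * x + β * y)) * ENNReal.ofReal R :=
              lintegral_mul_const _ hmx
          _ ≤ ENNReal.ofReal (1 / 2 - 0 + 2 * G / |β|) * ENNReal.ofReal R := by
              gcongr
              exact (lintegral_mono_set halfIco_subset_Icc).trans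
                (lintegral_comp_affine_le hm hI hβ.ne' _ _ _)
          _ = _ := by
              rw [mul_comm, ← ENNReal.ofReal_mul hR0, abs_of_pos hβ, sub_zero]
    _ ≤ _ := by
        rw [setLIntegral_const]
        exact mul_le_of_le_one_right' volume_halfIco_le

lemma correlation_le {h : ℝ → ℝ≥0∞} (hm : Measurable h) {G : ℝ} (hG : 0 ≤ G)
    (hI : ∀ u v, ∫⁻ z in Icc u v, h z ≤ ENNReal.ofReal (v - u + 2 * G)) {α β α' β' r : ℝ}
    (hβ : 0 < β) (hβ' : 0 < β') (hr : 0 ≤ r) :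
    cubeInt (fun x y y' => h (α * x + β * y) * h (α' * x + β' * y') * nearInd r y y') ≤
      ENNReal.ofReal ((2 * r + 2 * G / β') * (1 / 2 + 2 * G / β)) := by
  refine correlation_le_of_slice hm hI hβ (fun c y => ?_) (by positivity)
  refine (lintegral_comp_affine_le hm hI hβ'.ne' _ _ _).trans_eq ?_
  rw [abs_of_pos hβ']
  congr 1; ring

lemma correlation_le_of_le {h : ℝ → ℝ≥0∞} (hm : Measurable h) {G M : ℝ}
    (hI : ∀ u v, ∫⁻ z in Icc u v, h z ≤ ENNReal.ofReal (v - u + 2 * G))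
    (hM : ∀ z, h z ≤ ENNReal.ofReal M) (hM0 : 0 ≤ M) {α β α' β' r : ℝ}
    (hβ : 0 < β) (hr : 0 ≤ r) :
    cubeInt (fun x y y' => h (α * x + β * y) * h (α' * x + β' * y') * nearInd r y y') ≤
      ENNReal.ofReal ((2 * r * M) * (1 / 2 + 2 * G / β)) := by
  refine correlation_le_of_slice hm hI hβ (fun c y => ?_) (by positivity)
  refine (lintegral_mono fun _ => hM _).trans_eq ?_
  rw [setLIntegral_const, Real.volume_Icc, mul_comm, ← ENNReal.ofReal_mul (by linarith)]
  congr 1; ring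

lemma correlation_le_of_transversal {h : ℝ → ℝ≥0∞} (hm : Measurable h) {G Q : ℝ} (hG : 0 ≤ G)
    (hI : ∀ u v, ∫⁻ z in Icc u v, h z ≤ ENNReal.ofReal (v - u + 2 * G)) {α β α' β' r : ℝ}
    (hα : 0 ≤ α) (hβ : 0 < β) (hαQ : α ≤ Q) (hβQ : β ≤ Q) (hκ : α' - α * β' / β ≠ 0) (hr : 0 ≤ r) :
    cubeInt (fun x y y' => h (α * x + β * y) * h (α' * x + β' * y') * nearInd r y y') ≤
      ENNReal.ofReal ((Q + 2 * G) / β * (2 * r) * (1 / 2 + 2 * G / |α' - α * β' / β|)) := by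
  set κ := α' - α * β' / β
  have hQ : 0 ≤ Q := hα.trans hαQ
  have hsplit : ∀ x y, α' * x + β' * y = κ * x + β' / β * (α * x + β * y) := by
    intro x y
    simp only [κ]
    field_simp
    ring
  set R : ℝ≥0∞ := ENNReal.ofReal (2 * r) * ENNReal.ofReal (1 / 2 + 2 * G / |κ|)
  let J : ℝ → ℝ → ℝ≥0∞ := fun x z =>
    h z * ∫⁻ v in Icc (-r) r, h (κ * x + β' / β * z + β' * v)
  have hin : Measurable fun q : (ℝ × ℝ) × ℝ => h (κ * q.1.1 + β' / β * q.1.2 + β' * q.2) := by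
    fun_prop
  have hin' : Measurable fun q : ℝ × ℝ => ∫⁻ v in Icc (-r) r, h (κ * q.1 + β' / β * q.2 + β' * v) :=
    hin.lintegral_prod_right'
  have hJ : Measurable fun q : ℝ × ℝ => J q.1 q.2 := (hm.comp measurable_snd).mul hin'
  calc cubeInt (fun x y y' => h (α * x + β * y) * h (α' * x + β' * y') * nearInd r y y')
      ≤ ∫⁻ x in halfIco, ENNReal.ofReal |β|⁻¹ * ∫⁻ z in Icc 0 Q, J x z := by
        refine setLIntegral_mono' measurableSet_Ico fun x hx => ?_
        have hmx' : Measurable fun y => h (α' * x + β' * y) := by fun_prop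
        calc _ ≤ ∫⁻ y in halfIco, J x (α * x + β * y) := by
              refine lintegral_mono fun y => ?_
              have hN : Measurable fun y' => nearInd r y y' :=
                (measurable_nearInd r).comp measurable_prodMk_left
              simp only [mul_assoc]
              have hP : Measurable fun y' => h (α' * x + β' * y') * nearInd r y y' := hmx'.mul hN
              rw [lintegral_const_mul _ hP]
              refine mul_le_mul_right ?_ _
              refine (lintegral_mul_nearInd_le _ _ _).trans ?_
              rw [← lintegral_indicator measurableSet_Icc, ← lintegral_indicator measurableSet_Icc,
                ← lintegral_add_left_eq_self (μ := volume)
                  (indicator (Icc (y - r) (y + r)) fun y' => h (α' * x + β' * y')) y]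
              refine lintegral_mono fun v => ?_
              by_cases hv : v ∈ Icc (-r) r
              · refine (indicator_le_self _ _ _).trans ?_
                rw [indicator_of_mem hv]
                rw [← hsplit, mul_add, add_assoc]
              · rw [indicator_of_notMem, indicator_of_notMem hv]
                rintro ⟨h1, h2⟩
                exact hv ⟨by linarith, by linarith⟩
          _ ≤ _ := by
              have hJx : Measurable (J x) := hJ.comp measurable_prodMk_left
              refine setLIntegral_comp_affine_le hJx hβ.ne' (α * x) measurableSet_Ico
                measurableSet_Icc fun y hy => ?_
              have hx1 := hx.1
              have hy1 := hy.1
              have hx2 := hx.2.le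
              have hy2 := hy.2.le
              constructor
              · positivity
              · nlinarith
    _ = ENNReal.ofReal |β|⁻¹ * ∫⁻ z in Icc 0 Q, ∫⁻ x in halfIco, J x z := by
        rw [lintegral_const_mul' _ _ ENNReal.ofReal_ne_top,
          lintegral_lintegral_swap hJ.aemeasurable]
    _ ≤ ENNReal.ofReal |β|⁻¹ * ∫⁻ z in Icc 0 Q, h z * R := by
        gcongr with z
        simp only [J]
        have h1 : Measurable fun x => ∫⁻ v in Icc (-r) r, h (κ * x + β' / β * z + β' * v) :=
          hin'.comp measurable_prodMk_right
        rw [lintegral_const_mul _ h1]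
        gcongr
        have h2 : Measurable fun q : ℝ × ℝ => h (κ * q.1 + β' / β * z + β' * q.2) := by fun_prop
        rw [lintegral_lintegral_swap h2.aemeasurable]
        calc _ ≤ ∫⁻ _v in Icc (-r) r, ENNReal.ofReal (1 / 2 + 2 * G / |κ|) := by
              refine lintegral_mono fun v => ?_
              refine (lintegral_mono_set halfIco_subset_Icc).trans ?_
              have := lintegral_comp_affine_le hm hI hκ (β' / β * z + β' * v) 0 (1 / 2)
              rw [sub_zero] at this
              refine le_trans (le_of_eq (lintegral_congr fun x => ?_)) this
              congr 1; ring
          _ = R := by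
              rw [setLIntegral_const, Real.volume_Icc, mul_comm]
              simp only [R]
              congr 2; ring
    _ = ENNReal.ofReal |β|⁻¹ * ((∫⁻ z in Icc 0 Q, h z) * R) := by
        rw [lintegral_mul_const _ hm]
    _ ≤ ENNReal.ofReal |β|⁻¹ * (ENNReal.ofReal (Q - 0 + 2 * G) * R) := by
        gcongr; exact hI _ _
    _ = _ := by
        simp only [R]
        rw [← ENNReal.ofReal_mul (by positivity), ← ENNReal.ofReal_mul (by positivity),
          ← ENNReal.ofReal_mul (by positivity), abs_of_pos hβ]
        congr 1
        field_simp
        ring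
end

section
open Finset

/-- Coprime pairs in the box `[1, A] × [1, B]` whose entries are comparable to `A` and `B`. -/
def pairSet (A B : ℕ) : Finset (ℕ × ℕ) :=
  (Finset.Icc 1 A ×ˢ Finset.Icc 1 B).filter fun ab =>
    A < 16 * ab.1 ∧ B < 16 * ab.2 ∧ Nat.Coprime ab.1 ab.2

lemma mem_pairSet {A B : ℕ} {ab : ℕ × ℕ} : ab ∈ pairSet A B ↔
    ((1 ≤ ab.1 ∧ ab.1 ≤ A) ∧ 1 ≤ ab.2 ∧ ab.2 ≤ B) ∧
      A < 16 * ab.1 ∧ B < 16 * ab.2 ∧ Nat.Coprime ab.1 ab.2 := by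
  simp [pairSet]

lemma sum_one_div_sq_le (N : ℕ) : ∑ q ∈ Finset.Icc 2 N, 1 / (q : ℝ) ^ 2 ≤ 3 / 4 := by
  rcases Nat.lt_or_ge N 2 with h | h
  · rw [Finset.Icc_eq_empty (by omega)]; norm_num
  suffices H : ∑ q ∈ Finset.Icc 2 N, 1 / (q : ℝ) ^ 2 ≤ 3 / 4 - 1 / (N : ℝ) by
    have : (0 : ℝ) ≤ 1 / (N : ℝ) := by positivity
    linarith
  induction N, h using Nat.le_induction with
  | base => norm_num
  | succ k hk ih =>
    rw [Finset.sum_Icc_succ_top (by omega)]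
    have hk0 : (0 : ℝ) < k := by exact_mod_cast (by omega : 0 < k)
    have : 1 / ((k + 1 : ℕ) : ℝ) ^ 2 ≤ 1 / k - 1 / ((k + 1 : ℕ) : ℝ) := by
      push_cast
      rw [div_sub_div _ _ hk0.ne' (by positivity), div_le_div_iff₀ (by positivity) (by positivity)]
      nlinarith
    linarith

lemma card_multiples_pairs (A B q : ℕ) :
    (((Finset.Icc 1 A).filter (q ∣ ·)) ×ˢ ((Finset.Icc 1 B).filter (q ∣ ·))).card =
      (A / q) * (B / q) := by
  rw [Finset.card_product]
  have h : ∀ N : ℕ, ((Finset.Icc 1 N).filter (q ∣ ·)).card = N / q := fun N =>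
    Nat.Ioc_filter_dvd_card_eq_div N q
  rw [h, h]

lemma card_small_le (A : ℕ) :
    (((Finset.Icc 1 A).filter fun a => 16 * a ≤ A).card : ℝ) ≤ A / 16 := by
  have : ((Finset.Icc 1 A).filter fun a => 16 * a ≤ A) ⊆ Finset.Icc 1 (A / 16) := by
    intro a ha
    simp only [Finset.mem_filter, Finset.mem_Icc] at ha ⊢
    omega
  have h := Finset.card_le_card this
  rw [Nat.card_Icc, Nat.add_sub_cancel] at h
  calc _ ≤ ((A / 16 : ℕ) : ℝ) := by exact_mod_cast h
    _ ≤ _ := by exact_mod_cast Nat.cast_div_le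

lemma mul_le_card_pairSet (A B : ℕ) : (A * B : ℝ) ≤ 8 * (pairSet A B).card := by
  classical
  set S := Finset.Icc 1 A ×ˢ Finset.Icc 1 B
  set U := ((Finset.Icc 1 A).filter fun a => 16 * a ≤ A) ×ˢ Finset.Icc 1 B
  set V := Finset.Icc 1 A ×ˢ ((Finset.Icc 1 B).filter fun a => 16 * a ≤ B)
  set D : ℕ → Finset (ℕ × ℕ) := fun q =>
    ((Finset.Icc 1 A).filter (q ∣ ·)) ×ˢ ((Finset.Icc 1 B).filter (q ∣ ·))
  have hsub : S ⊆ pairSet A B ∪ (U ∪ (V ∪ (Finset.Icc 2 A).biUnion D)) := by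
    rintro ⟨a, b⟩ hab
    simp only [S, Finset.mem_product, Finset.mem_Icc] at hab
    simp only [Finset.mem_union, mem_pairSet, U, V, D, Finset.mem_product, Finset.mem_filter,
      Finset.mem_Icc, Finset.mem_biUnion]
    by_cases h1 : 16 * a ≤ A
    · right; left; exact ⟨⟨hab.1, h1⟩, hab.2⟩
    by_cases h2 : 16 * b ≤ B
    · right; right; left; exact ⟨hab.1, hab.2, h2⟩
    by_cases h3 : Nat.Coprime a b
    · left; exact ⟨hab, by omega, by omega, h3⟩
    · right; right; right
      have hpos : 0 < Nat.gcd a b := Nat.gcd_pos_of_pos_left _ (by omega)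
      have hle : Nat.gcd a b ≤ a := Nat.gcd_le_left _ (by omega)
      have hne : Nat.gcd a b ≠ 1 := h3
      exact ⟨Nat.gcd a b, ⟨by omega, by omega⟩, ⟨hab.1, Nat.gcd_dvd_left _ _⟩,
        hab.2, Nat.gcd_dvd_right _ _⟩
  have hcard := (Finset.card_le_card hsub).trans ((Finset.card_union_le _ _).trans
    (Nat.add_le_add_left ((Finset.card_union_le _ _).trans (Nat.add_le_add_left
      ((Finset.card_union_le _ _).trans (Nat.add_le_add_left Finset.card_biUnion_le _)) _)) _))
  have hcard' : (S.card : ℝ) ≤ (pairSet A B).card + (U.card + (V.card +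
      ∑ q ∈ Finset.Icc 2 A, ((D q).card : ℝ))) := by exact_mod_cast hcard
  have hS : (S.card : ℝ) = A * B := by simp [S]
  have hU : (U.card : ℝ) ≤ A / 16 * B := by
    simp only [U, Finset.card_product, Nat.card_Icc, Nat.add_sub_cancel, Nat.cast_mul]
    gcongr
    exact card_small_le A
  have hV : (V.card : ℝ) ≤ A * (B / 16) := by
    simp only [V, Finset.card_product, Nat.card_Icc, Nat.add_sub_cancel, Nat.cast_mul]
    gcongr
    exact card_small_le B
  have hD : ∑ q ∈ Finset.Icc 2 A, ((D q).card : ℝ) ≤ A * B * (3 / 4) := by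
    calc _ ≤ ∑ q ∈ Finset.Icc 2 A, ((A : ℝ) * B) * (1 / (q : ℝ) ^ 2) := by
          refine Finset.sum_le_sum fun q _ => ?_
          simp only [D, card_multiples_pairs, Nat.cast_mul]
          calc ((A / q : ℕ) : ℝ) * ((B / q : ℕ) : ℝ) ≤ (A / q) * (B / q) := by
                gcongr <;> exact Nat.cast_div_le
            _ = _ := by ring
      _ = (A : ℝ) * B * ∑ q ∈ Finset.Icc 2 A, 1 / (q : ℝ) ^ 2 := by rw [Finset.mul_sum]
      _ ≤ _ := by gcongr; exact sum_one_div_sq_le A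
  rw [hS] at hcard'
  linarith

lemma sum_inv_abs_sub_le {S : Finset ℕ} {A a₀ : ℕ} (hS : ∀ a ∈ S, 1 ≤ a ∧ a ≤ A)
    (h₀ : 1 ≤ a₀ ∧ a₀ ≤ A) :
    ∑ a ∈ S.erase a₀, 1 / |(a : ℝ) - a₀| ≤ 2 * (1 + Real.log A) := by
  classical
  have hH : ∑ d ∈ Finset.Icc 1 A, 1 / (d : ℝ) ≤ 1 + Real.log A := by
    have := harmonic_le_one_add_log A
    rw [harmonic_eq_sum_Icc] at this
    push_cast at this
    simpa only [one_div] using this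
  rw [← Finset.sum_filter_add_sum_filter_not (S.erase a₀) (fun a => a₀ < a), two_mul]
  have key : ∀ (U : Finset ℕ) (e : ℕ → ℕ), (∀ a ∈ U, e a ∈ Finset.Icc 1 A) → Set.InjOn e U →
      (∀ a ∈ U, |(a : ℝ) - a₀| = e a) → ∑ a ∈ U, 1 / |(a : ℝ) - a₀| ≤ 1 + Real.log A := by
    intro U e he hinj hval
    refine le_trans ?_ hH
    calc ∑ a ∈ U, 1 / |(a : ℝ) - a₀| = ∑ a ∈ U, 1 / (e a : ℝ) :=
          Finset.sum_congr rfl fun a ha => by rw [hval a ha]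
      _ = ∑ d ∈ U.image e, 1 / (d : ℝ) := (Finset.sum_image (f := fun d : ℕ => 1 / (d : ℝ)) hinj).symm
      _ ≤ _ := Finset.sum_le_sum_of_subset_of_nonneg (Finset.image_subset_iff.2 he)
          fun _ _ _ => by positivity
  refine add_le_add (key _ (fun a => a - a₀) ?_ ?_ ?_) (key _ (fun a => a₀ - a) ?_ ?_ ?_)
  · intro a ha
    simp only [Finset.mem_filter, Finset.mem_erase, Finset.mem_Icc] at ha ⊢
    have := hS a ha.1.2
    omega
  · intro a ha b hb hab
    simp only [Finset.mem_coe, Finset.mem_filter, Finset.mem_erase] at ha hb hab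
    omega
  · intro a ha
    simp only [Finset.mem_filter, Finset.mem_erase] at ha
    rw [Nat.cast_sub ha.2.le, abs_of_pos (sub_pos.2 (by exact_mod_cast ha.2))]
  · intro a ha
    simp only [Finset.mem_filter, Finset.mem_erase, Finset.mem_Icc] at ha ⊢
    have := hS a ha.1.2
    omega
  · intro a ha b hb hab
    simp only [Finset.mem_coe, Finset.mem_filter, Finset.mem_erase] at ha hb hab
    omega
  · intro a ha
    simp only [Finset.mem_filter, Finset.mem_erase] at ha
    have hlt : a < a₀ := by omega
    rw [Nat.cast_sub hlt.le, abs_of_neg (sub_neg.2 (by exact_mod_cast hlt)), neg_sub]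

lemma sum_le_of_separated {S : Finset ℕ} {A : ℕ} (hS : ∀ a ∈ S, 1 ≤ a ∧ a ≤ A) {f : ℕ → ℝ}
    {θ g : ℝ} (hg : 0 < g) (hsep : ∀ i ∈ S, ∀ j ∈ S, g * |(i : ℝ) - j| ≤ |f i - f j|)
    {Φ : ℕ → ℝ} {M K : ℝ} (hM0 : 0 ≤ M) (hK0 : 0 ≤ K)
    (hM : ∀ a ∈ S, Φ a ≤ M) (hK : ∀ a ∈ S, Φ a * |f a - θ| ≤ K) :
    ∑ a ∈ S, Φ a ≤ M + 4 * (K / g) * (1 + Real.log A) := by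
  classical
  rcases S.eq_empty_or_nonempty with rfl | hne
  · have : 0 ≤ Real.log A := Real.log_natCast_nonneg A
    rw [Finset.sum_empty]; positivity
  obtain ⟨a₀, ha₀, hmin⟩ := Finset.exists_min_image S (fun a => |f a - θ|) hne
  rw [← Finset.add_sum_erase _ _ ha₀]
  refine add_le_add (hM _ ha₀) ?_
  calc ∑ a ∈ S.erase a₀, Φ a ≤ ∑ a ∈ S.erase a₀, (2 * (K / g)) * (1 / |(a : ℝ) - a₀|) := by
        refine Finset.sum_le_sum fun a ha => ?_
        obtain ⟨hne, ha⟩ := Finset.mem_erase.1 ha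
        have h1 : 0 < |(a : ℝ) - a₀| := abs_pos.2 (sub_ne_zero.2 (by exact_mod_cast hne))
        have h2 : g * |(a : ℝ) - a₀| ≤ 2 * |f a - θ| := by
          refine (hsep a ha a₀ ha₀).trans ?_
          have : f a - f a₀ = (f a - θ) - (f a₀ - θ) := by ring
          rw [this]
          refine (abs_sub _ _).trans ?_
          linarith [hmin a ha]
        have h3 : 0 < |f a - θ| := by nlinarith [mul_pos hg h1]
        calc Φ a ≤ K / |f a - θ| := (le_div_iff₀ h3).2 (hK a ha)
          _ ≤ K / (g * |(a : ℝ) - a₀| / 2) := by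
              gcongr
              linarith
          _ = _ := by field_simp
    _ = 2 * (K / g) * ∑ a ∈ S.erase a₀, 1 / |(a : ℝ) - a₀| := by rw [Finset.mul_sum]
    _ ≤ 2 * (K / g) * (2 * (1 + Real.log A)) := by
        gcongr
        exact sum_inv_abs_sub_le hS (hS _ ha₀)
    _ = _ := by ring

lemma mul_abs_sub_le_abs_pow_sub_pow {n : ℕ} (hn : 1 ≤ n) {c x y : ℝ} (hc : 0 ≤ c) (hx : c ≤ x)
    (hy : c ≤ y) : c ^ (n - 1) * |x - y| ≤ |x ^ n - y ^ n| := by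
  have key : ∀ x y : ℝ, c ≤ y → y ≤ x → c ^ (n - 1) * (x - y) ≤ x ^ n - y ^ n := by
    intro x y hy hyx
    obtain ⟨k, rfl⟩ := Nat.exists_eq_add_of_le' hn
    rw [Nat.add_sub_cancel, pow_succ, pow_succ]
    have h1 : c ^ k ≤ y ^ k := pow_le_pow_left₀ hc hy k
    have h2 : y ^ k ≤ x ^ k := pow_le_pow_left₀ (hc.trans hy) hyx k
    nlinarith
  rcases le_total y x with h | h
  · rw [abs_of_nonneg (sub_nonneg.2 h)]
    exact (key x y hy h).trans (le_abs_self _)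
  · rw [abs_sub_comm x y, abs_sub_comm (x ^ n), abs_of_nonneg (sub_nonneg.2 h)]
    exact (key y x hx h).trans (le_abs_self _)

lemma pow_mul_pow_ne {n m a b a' b' : ℕ} (hn : 1 ≤ n) (hm : 1 ≤ m)
    (h : Nat.Coprime a b) (h' : Nat.Coprime a' b') (ha : 1 ≤ a) (hne : (a, b) ≠ (a', b')) :
    a' ^ n * b ^ m ≠ a ^ n * b' ^ m := by
  intro heq
  have h1 : a ^ n ∣ a' ^ n := ((h.pow n m).dvd_of_dvd_mul_right (heq ▸ Dvd.intro _ rfl))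
  have h2 : a' ^ n ∣ a ^ n := ((h'.pow n m).dvd_of_dvd_mul_right (heq ▸ Dvd.intro _ rfl))
  have h3 : a = a' := Nat.pow_left_injective (by omega : n ≠ 0) (Nat.dvd_antisymm h1 h2)
  subst h3
  have h4 : b ^ m = b' ^ m := Nat.eq_of_mul_eq_mul_left (by positivity) heq
  exact hne (by rw [Nat.pow_left_injective (by omega : m ≠ 0) h4])
end

section
open MeasureTheory Set Filter Topology ENNReal NNReal

lemma pow_le_sq_pow_sub_pow {x y d : ℕ} (hd : 2 ≤ d) (hne : x ≠ y) :
    (x : ℝ) ^ d ≤ ((x : ℝ) ^ d - (y : ℝ) ^ d) ^ 2 := by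
  have key : ∀ x y : ℕ, y < x → (x : ℝ) ^ d ≤ ((x : ℝ) ^ d - (y : ℝ) ^ d) ^ 2 := by
    intro x y h
    obtain ⟨k, rfl⟩ := Nat.exists_eq_add_of_le hd
    have h1 : (y : ℝ) + 1 ≤ x := by exact_mod_cast h
    have hy : (0 : ℝ) ≤ y := by positivity
    have hx : (1 : ℝ) ≤ x := by linarith
    have h2 : (x : ℝ) ^ (k + 1) ≤ (x : ℝ) ^ (2 + k) - (y : ℝ) ^ (2 + k) := by
      have e1 : (y : ℝ) ^ (k + 1) ≤ (x : ℝ) ^ (k + 1) := pow_le_pow_left₀ hy (by linarith) _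
      have e2 : ∀ z : ℝ, z ^ (2 + k) = z * z ^ (k + 1) := fun z => by ring
      rw [e2, e2]
      have : (0 : ℝ) ≤ (x : ℝ) ^ (k + 1) := by positivity
      nlinarith
    calc (x : ℝ) ^ (2 + k) ≤ (x : ℝ) ^ (2 * (k + 1)) := pow_le_pow_right₀ hx (by omega)
      _ = ((x : ℝ) ^ (k + 1)) ^ 2 := by rw [← pow_mul, mul_comm]
      _ ≤ _ := pow_le_pow_left₀ (by positivity) h2 2
  rcases lt_or_gt_of_ne hne with h | h
  · calc (x : ℝ) ^ d ≤ (y : ℝ) ^ d := pow_le_pow_left₀ (by positivity) (by exact_mod_cast h.le) _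
      _ ≤ _ := key y x h
      _ = _ := by ring
  · exact key x y h

lemma coeff_pos_of_mem_pairSet (n m : ℕ) {A B : ℕ} {ab : ℕ × ℕ} (hab : ab ∈ pairSet A B) :
    0 < (ab.1 : ℝ) ^ n ∧ 0 < (ab.2 : ℝ) ^ m := by
  obtain ⟨⟨⟨h1, _⟩, h2, _⟩, _⟩ := mem_pairSet.1 hab
  have e1 : (0 : ℝ) < ab.1 := by exact_mod_cast h1
  have e2 : (0 : ℝ) < ab.2 := by exact_mod_cast h2
  exact ⟨by positivity, by positivity⟩

/-- Box sizes `A`, `B`, `L` whose powers `A ^ n`, `B ^ m`, `L ^ p` have the common value `Q`. -/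
structure LatticeScale (n m p A B L : ℕ) (Q : ℝ) : Prop where
  one_le_n : 1 ≤ n
  one_le_m : 1 ≤ m
  one_le_p : 1 ≤ p
  one_le_L : 1 ≤ L
  pow_A : (A : ℝ) ^ n = Q
  pow_B : (B : ℝ) ^ m = Q
  pow_L : (L : ℝ) ^ p = Q

namespace LatticeScale

variable {n m p A B L : ℕ} {Q : ℝ}

lemma one_le_Q (h : LatticeScale n m p A B L Q) : 1 ≤ Q := by
  rw [← h.pow_L]
  exact one_le_pow₀ (by exact_mod_cast h.one_le_L)

lemma pos_A (h : LatticeScale n m p A B L Q) : (0 : ℝ) < A := by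
  by_contra! hA
  have h0 : (A : ℝ) = 0 := le_antisymm hA (by positivity)
  have := h.pow_A
  rw [h0, zero_pow (by have := h.one_le_n; omega)] at this
  linarith [h.one_le_Q]

lemma pos_B (h : LatticeScale n m p A B L Q) : (0 : ℝ) < B := by
  by_contra! hA
  have h0 : (B : ℝ) = 0 := le_antisymm hA (by positivity)
  have := h.pow_B
  rw [h0, zero_pow (by have := h.one_le_m; omega)] at this
  linarith [h.one_le_Q]

lemma gap_eq (h : LatticeScale n m p A B L Q) : (p : ℝ) * (L : ℝ) ^ (p - 1) = p * Q / L := by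
  have hL : (0 : ℝ) < L := by exact_mod_cast h.one_le_L
  rw [← h.pow_L]
  obtain ⟨k, hk⟩ := Nat.exists_eq_add_of_le' h.one_le_p
  rw [hk, Nat.add_sub_cancel, pow_succ]
  field_simp

lemma coeff_bounds (h : LatticeScale n m p A B L Q) {ab : ℕ × ℕ} (hab : ab ∈ pairSet A B) :
    Q ≤ 16 ^ n * (ab.1 : ℝ) ^ n ∧ (ab.1 : ℝ) ^ n ≤ Q ∧
      Q ≤ 16 ^ m * (ab.2 : ℝ) ^ m ∧ (ab.2 : ℝ) ^ m ≤ Q := by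
  obtain ⟨⟨⟨_, h1⟩, _, h2⟩, h3, h4, _⟩ := mem_pairSet.1 hab
  have e1 : (ab.1 : ℝ) ≤ A := by exact_mod_cast h1
  have e2 : (ab.2 : ℝ) ≤ B := by exact_mod_cast h2
  have e3 : (A : ℝ) ≤ 16 * ab.1 := by exact_mod_cast h3.le
  have e4 : (B : ℝ) ≤ 16 * ab.2 := by exact_mod_cast h4.le
  refine ⟨?_, ?_, ?_, ?_⟩
  · rw [← h.pow_A, ← mul_pow]; exact pow_le_pow_left₀ (by positivity) e3 _
  · rw [← h.pow_A]; exact pow_le_pow_left₀ (by positivity) e1 _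
  · rw [← h.pow_B, ← mul_pow]; exact pow_le_pow_left₀ (by positivity) e4 _
  · rw [← h.pow_B]; exact pow_le_pow_left₀ (by positivity) e2 _

lemma transversality (h : LatticeScale n m p A B L Q) {ρ : ℕ}
    (hρ : (n = 1 ∧ m = 1 ∧ ρ = 2) ∨ (2 ≤ Nat.gcd n m ∧ ρ = 1)) {ab ab' : ℕ × ℕ}
    (hab : ab ∈ pairSet A B) (hab' : ab' ∈ pairSet A B) (hne : ab ≠ ab') :
    (ab'.1 : ℝ) ^ n - (ab.1 : ℝ) ^ n * (ab'.2 : ℝ) ^ m / (ab.2 : ℝ) ^ m ≠ 0 ∧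
      Q ≤ 4 ^ (n + m) * Q ^ ρ *
        |(ab'.1 : ℝ) ^ n - (ab.1 : ℝ) ^ n * (ab'.2 : ℝ) ^ m / (ab.2 : ℝ) ^ m| := by
  obtain ⟨_, hβ⟩ := coeff_pos_of_mem_pairSet n m hab
  obtain ⟨_, _, h3, h4⟩ := h.coeff_bounds hab
  obtain ⟨h1', _, _, _⟩ := h.coeff_bounds hab'
  have hQ := h.one_le_Q
  set κ := (ab'.1 : ℝ) ^ n - (ab.1 : ℝ) ^ n * (ab'.2 : ℝ) ^ m / (ab.2 : ℝ) ^ m with hκ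
  have hκD : κ * (ab.2 : ℝ) ^ m =
      (ab'.1 : ℝ) ^ n * (ab.2 : ℝ) ^ m - (ab.1 : ℝ) ^ n * (ab'.2 : ℝ) ^ m := by
    rw [hκ]; field_simp
  obtain ⟨⟨⟨ha, _⟩, _, _⟩, _, _, hc⟩ := mem_pairSet.1 hab
  obtain ⟨_, _, _, hc'⟩ := mem_pairSet.1 hab'
  have hDne := pow_mul_pow_ne h.one_le_n h.one_le_m hc hc' ha hne
  have hDne' : (ab'.1 : ℝ) ^ n * (ab.2 : ℝ) ^ m - (ab.1 : ℝ) ^ n * (ab'.2 : ℝ) ^ m ≠ 0 :=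
    sub_ne_zero.2 (by exact_mod_cast hDne)
  have hDle : |(ab'.1 : ℝ) ^ n * (ab.2 : ℝ) ^ m - (ab.1 : ℝ) ^ n * (ab'.2 : ℝ) ^ m| ≤ |κ| * Q := by
    rw [← hκD, abs_mul, abs_of_pos hβ]
    gcongr
  refine ⟨fun h0 => hDne' (by rw [← hκD, h0, zero_mul]), ?_⟩
  have h4pow : (1 : ℝ) ≤ 4 ^ (n + m) := one_le_pow₀ (by norm_num)
  rcases hρ with ⟨_, _, rfl⟩ | ⟨hg, rfl⟩
  · have h1 : (1 : ℝ) ≤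
        |(ab'.1 : ℝ) ^ n * (ab.2 : ℝ) ^ m - (ab.1 : ℝ) ^ n * (ab'.2 : ℝ) ^ m| := by
      have h2 : ((ab'.1 : ℤ) ^ n * (ab.2 : ℤ) ^ m - (ab.1 : ℤ) ^ n * (ab'.2 : ℤ) ^ m) ≠ 0 := by
        exact_mod_cast hDne'
      exact_mod_cast Int.one_le_abs h2
    calc Q = 1 * (Q * 1) := by ring
      _ ≤ 4 ^ (n + m) * (Q * (|κ| * Q)) := by gcongr; exact h1.trans hDle
      _ = _ := by ring
  · set d := Nat.gcd n m
    obtain ⟨n', hn'⟩ : d ∣ n := Nat.gcd_dvd_left n m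
    obtain ⟨m', hm'⟩ : d ∣ m := Nat.gcd_dvd_right n m
    have e : ∀ x y : ℕ, (x : ℝ) ^ n * (y : ℝ) ^ m = ((x ^ n' * y ^ m' : ℕ) : ℝ) ^ d := by
      intro x y
      push_cast
      rw [mul_pow, ← pow_mul, ← pow_mul, mul_comm n', mul_comm m', ← hn', ← hm']
    have hxy : ab'.1 ^ n' * ab.2 ^ m' ≠ ab.1 ^ n' * ab'.2 ^ m' := by
      intro heq
      apply hDne'
      rw [e, e, heq, sub_self]
    have hsq := pow_le_sq_pow_sub_pow hg hxy
    rw [← e, ← e] at hsq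
    have hX : (Q / 4 ^ (n + m)) ^ 2 ≤ (ab'.1 : ℝ) ^ n * (ab.2 : ℝ) ^ m := by
      rw [div_pow, div_le_iff₀ (by positivity)]
      calc Q ^ 2 = Q * Q := sq Q
        _ ≤ (16 ^ n * (ab'.1 : ℝ) ^ n) * (16 ^ m * (ab.2 : ℝ) ^ m) := by gcongr
        _ = _ := by
          rw [← pow_mul, mul_comm (n + m), pow_mul, pow_add]; norm_num; ring
    have hD := sq_le_sq.1 (hX.trans hsq)
    rw [abs_of_pos (by positivity), div_le_iff₀ (by positivity)] at hD
    calc Q ≤ _ := hD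
      _ ≤ (|κ| * Q) * 4 ^ (n + m) := by gcongr
      _ = _ := by ring

end LatticeScale
end

section
open MeasureTheory Set Filter Topology ENNReal NNReal

/-- The average over the pairs `(a, b)` of the densities `spikes (a ^ n * x + b ^ m * y)`. -/
noncomputable def latticeDensity (n m p A B L : ℕ) (w : ℝ) (q : ℝ × ℝ) : ℝ≥0 :=
  ((pairSet A B).card : ℝ≥0)⁻¹ *
    ∑ ab ∈ pairSet A B, spikes p L w ((ab.1 : ℝ) ^ n * q.1 + (ab.2 : ℝ) ^ m * q.2)

lemma continuous_latticeDensity (n m p A B L : ℕ) (w : ℝ) :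
    Continuous (latticeDensity n m p A B L w) := by
  have := continuous_spikes p L w
  unfold latticeDensity
  fun_prop

lemma cubeInt_finset_sum {ι : Type*} (S : Finset ι) {f : ι → ℝ → ℝ → ℝ → ℝ≥0∞}
    (hf : ∀ i ∈ S, Measurable fun q : ℝ × ℝ × ℝ => f i q.1 q.2.1 q.2.2) :
    cubeInt (fun x y y' => ∑ i ∈ S, f i x y y') = ∑ i ∈ S, cubeInt (f i) := by
  have hm : Measurable fun q : ℝ × ℝ × ℝ => ∑ i ∈ S, f i q.1 q.2.1 q.2.2 :=
    Finset.measurable_fun_sum S hf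
  rw [cubeInt_eq hm, lintegral_finsetSum' S fun i hi => (hf i hi).aemeasurable]
  exact Finset.sum_congr rfl fun i hi => (cubeInt_eq (hf i hi)).symm

lemma inv_card_mul_sum_le {ι : Type*} {S : Finset ι} (hS : S.Nonempty) {f : ι → ℝ≥0∞} {c : ℝ≥0∞}
    (hf : ∀ i ∈ S, f i ≤ c) : (S.card : ℝ≥0∞)⁻¹ * ∑ i ∈ S, f i ≤ c := by
  have h0 : (S.card : ℝ≥0∞) ≠ 0 := by simpa using hS.ne_empty
  calc _ ≤ (S.card : ℝ≥0∞)⁻¹ * ∑ _i ∈ S, c := mul_le_mul_right (Finset.sum_le_sum hf) _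
    _ = c := by
      rw [Finset.sum_const, nsmul_eq_mul, ← mul_assoc, ENNReal.inv_mul_cancel h0 (by simp), one_mul]

lemma le_inv_card_mul_sum {ι : Type*} {S : Finset ι} (hS : S.Nonempty) {f : ι → ℝ≥0∞} {c : ℝ≥0∞}
    (hf : ∀ i ∈ S, c ≤ f i) : c ≤ (S.card : ℝ≥0∞)⁻¹ * ∑ i ∈ S, f i := by
  have h0 : (S.card : ℝ≥0∞) ≠ 0 := by simpa using hS.ne_empty
  calc c = (S.card : ℝ≥0∞)⁻¹ * ∑ _i ∈ S, c := by
        rw [Finset.sum_const, nsmul_eq_mul, ← mul_assoc, ENNReal.inv_mul_cancel h0 (by simp),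
          one_mul]
    _ ≤ _ := mul_le_mul_right (Finset.sum_le_sum hf) _

lemma coe_latticeDensity (n m p : ℕ) {A B : ℕ} (hP : (pairSet A B).Nonempty) (L : ℕ) (w x y : ℝ) :
    (latticeDensity n m p A B L w (x, y) : ℝ≥0∞) = ((pairSet A B).card : ℝ≥0∞)⁻¹ *
      ∑ ab ∈ pairSet A B,
        (spikes p L w ((ab.1 : ℝ) ^ n * x + (ab.2 : ℝ) ^ m * y) : ℝ≥0∞) := by
  have h0 : ((pairSet A B).card : ℝ≥0) ≠ 0 := by simpa using hP.ne_empty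
  rw [latticeDensity, ENNReal.coe_mul, ENNReal.ofNNReal_finsetSum, ENNReal.coe_inv h0,
    ENNReal.coe_natCast]

lemma lintegral_latticeDensity (n m p : ℕ) {A B : ℕ} (hP : (pairSet A B).Nonempty) (L : ℕ)
    (w x : ℝ) (S : Set ℝ) :
    ∫⁻ y in S, (latticeDensity n m p A B L w (x, y) : ℝ≥0∞) = ((pairSet A B).card : ℝ≥0∞)⁻¹ *
      ∑ ab ∈ pairSet A B, ∫⁻ y in S,
        (spikes p L w ((ab.1 : ℝ) ^ n * x + (ab.2 : ℝ) ^ m * y) : ℝ≥0∞) := by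
  have hc := continuous_spikes p L w
  have h0 : ((pairSet A B).card : ℝ≥0∞)⁻¹ ≠ ∞ := by simpa using hP.ne_empty
  simp only [coe_latticeDensity n m p hP]
  have hm : ∀ ab ∈ pairSet A B, Measurable fun y : ℝ =>
      (spikes p L w ((ab.1 : ℝ) ^ n * x + (ab.2 : ℝ) ^ m * y) : ℝ≥0∞) := fun ab _ =>
    ENNReal.continuous_coe.measurable.comp (by fun_prop)
  rw [lintegral_const_mul' _ _ h0, lintegral_finsetSum _ hm]

lemma le_setLIntegral_comp_affine {f : ℝ → ℝ≥0∞} (hf : Measurable f) {κ : ℝ} (hκ : 0 < κ)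
    (c u v : ℝ) :
    ENNReal.ofReal κ⁻¹ * ∫⁻ z in Ico (c + κ * u) (c + κ * v), f z ≤
      ∫⁻ y in Ico u v, f (c + κ * y) := by
  have h1 := lintegral_comp_affine (hf.indicator (measurableSet_Ico (a := c + κ * u)
    (b := c + κ * v))) hκ.ne' c
  rw [abs_of_pos hκ, lintegral_indicator measurableSet_Ico] at h1
  rw [← h1, ← lintegral_indicator measurableSet_Ico]
  refine lintegral_mono fun y => ?_
  by_cases hy : y ∈ Ico u v
  · rw [indicator_of_mem hy]
    exact indicator_le_self _ _ _
  · have : c + κ * y ∉ Ico (c + κ * u) (c + κ * v) := fun h =>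
      hy ⟨le_of_mul_le_mul_left (by linarith [h.1]) hκ, lt_of_mul_lt_mul_left (by linarith [h.2]) hκ.le⟩
    rw [indicator_of_notMem this]
    exact zero_le

lemma LatticeScale.nonempty_pairSet {n m p A B L : ℕ} {Q : ℝ} (h : LatticeScale n m p A B L Q) :
    (pairSet A B).Nonempty := by
  rw [← Finset.card_pos]
  have h1 := mul_le_card_pairSet A B
  have h2 : (0 : ℝ) < A * B := mul_pos h.pos_A h.pos_B
  have : (0 : ℝ) < (pairSet A B).card := by linarith
  exact_mod_cast this

lemma LatticeScale.two_mul_gap_div_le {n m p A B L : ℕ} {Q : ℝ} (h : LatticeScale n m p A B L Q)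
    {ab : ℕ × ℕ} (hab : ab ∈ pairSet A B) :
    2 * (p * (L : ℝ) ^ (p - 1)) / (ab.2 : ℝ) ^ m ≤ 2 * (16 ^ m * p) / L := by
  have hβ := (coeff_pos_of_mem_pairSet n m hab).2
  have hL : (0 : ℝ) < L := by exact_mod_cast h.one_le_L
  rw [h.gap_eq, div_le_div_iff₀ hβ hL]
  calc 2 * (p * Q / L) * L = 2 * p * Q := by field_simp
    _ ≤ 2 * p * (16 ^ m * (ab.2 : ℝ) ^ m) := by gcongr; exact (h.coeff_bounds hab).2.2.1
    _ = _ := by ring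

lemma LatticeScale.lintegral_latticeDensity_le {n m p A B L : ℕ} {Q w : ℝ}
    (h : LatticeScale n m p A B L Q) (hw : 0 < w) (hw1 : w ≤ 1) (x u v : ℝ) :
    ∫⁻ y in Ico u v, (latticeDensity n m p A B L w (x, y) : ℝ≥0∞) ≤
      ENNReal.ofReal (v - u + 2 * (16 ^ m * p) / L) := by
  have hm : Measurable fun z => (spikes p L w z : ℝ≥0∞) :=
    ENNReal.continuous_coe.measurable.comp (continuous_spikes p L w).measurable
  rw [lintegral_latticeDensity n m p h.nonempty_pairSet]
  refine inv_card_mul_sum_le h.nonempty_pairSet fun ab hab => ?_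
  have hβ := (coeff_pos_of_mem_pairSet n m hab).2
  refine (lintegral_mono_set Ico_subset_Icc_self).trans ((lintegral_comp_affine_le hm
    (lintegral_spikes_le h.one_le_p hw hw1) hβ.ne' _ u v).trans (ENNReal.ofReal_le_ofReal ?_))
  rw [abs_of_pos hβ]
  linarith [h.two_mul_gap_div_le hab]

lemma LatticeScale.le_lintegral_latticeDensity {n m p A B L : ℕ} {Q w : ℝ}
    (h : LatticeScale n m p A B L Q) (hw : 0 < w) (hw1 : w ≤ 1) {x u v : ℝ} (hx : x ∈ halfIco)
    (hu : 0 ≤ u) (huv : u ≤ v) (hv : v ≤ 1 / 2) :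
    ENNReal.ofReal (v - u) ≤ (∫⁻ y in Ico u v, (latticeDensity n m p A B L w (x, y) : ℝ≥0∞)) +
      ENNReal.ofReal (2 * (16 ^ m * p) / L) := by
  have hm : Measurable fun z => (spikes p L w z : ℝ≥0∞) :=
    ENNReal.continuous_coe.measurable.comp (continuous_spikes p L w).measurable
  rw [lintegral_latticeDensity n m p h.nonempty_pairSet, ← tsub_le_iff_right]
  refine le_inv_card_mul_sum h.nonempty_pairSet fun ab hab => ?_
  obtain ⟨hα, hβ⟩ := coeff_pos_of_mem_pairSet n m hab
  obtain ⟨_, hαQ, _, hβQ⟩ := h.coeff_bounds hab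
  set α := (ab.1 : ℝ) ^ n
  set β := (ab.2 : ℝ) ^ m
  rw [tsub_le_iff_right]
  have hx0 : 0 ≤ x := hx.1
  have hx1 : x < 1 / 2 := hx.2
  have h1 := le_lintegral_spikes h.one_le_p hw hw1 (u := α * x + β * u) (v := α * x + β * v)
    (by positivity) (by rw [h.pow_L]; nlinarith)
  calc ENNReal.ofReal (v - u)
      = ENNReal.ofReal β⁻¹ * ENNReal.ofReal (α * x + β * v - (α * x + β * u)) := by
        rw [← ENNReal.ofReal_mul (by positivity)]
        congr 1; field_simp; ring
    _ ≤ ENNReal.ofReal β⁻¹ * _ := mul_le_mul_right h1 _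
    _ = ENNReal.ofReal β⁻¹ * (∫⁻ z in Ico (α * x + β * u) (α * x + β * v), spikes p L w z) +
          ENNReal.ofReal (2 * (p * (L : ℝ) ^ (p - 1)) / β) := by
        rw [mul_add, ← ENNReal.ofReal_mul (by positivity)]
        congr 2; field_simp
    _ ≤ _ := add_le_add (le_setLIntegral_comp_affine hm hβ _ _ _)
        (ENNReal.ofReal_le_ofReal (h.two_mul_gap_div_le hab))

end

section
open MeasureTheory Set Filter Topology ENNReal NNReal

namespace LatticeScale

variable {n m p A B L : ℕ} {Q : ℝ}

lemma sum_min_le_of_snd_eq (h : LatticeScale n m p A B L Q) {ρ : ℕ}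
    (hρ : (n = 1 ∧ m = 1 ∧ ρ = 2) ∨ (2 ≤ Nat.gcd n m ∧ ρ = 1)) {s r : ℝ} (hs : 0 < s) (hs1 : s ≤ 1)
    (hr : 0 < r) {ab : ℕ × ℕ} (hab : ab ∈ pairSet A B) (b' : ℕ) :
    ∑ ab' ∈ (pairSet A B).erase ab with ab'.2 = b',
      min 1 (r * (Q / |(ab'.1 : ℝ) ^ n - (ab.1 : ℝ) ^ n * (ab'.2 : ℝ) ^ m / (ab.2 : ℝ) ^ m|)) ≤
        4 ^ (n + m) * (r ^ s * Q ^ (ρ * s)) + 4 * 16 ^ n * (r * A * (1 + Real.log A)) := by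
  have hQ := h.one_le_Q
  have hA := h.pos_A
  set T := ((pairSet A B).erase ab).filter fun ab' => ab'.2 = b' with hT
  set θ := (ab.1 : ℝ) ^ n * (b' : ℝ) ^ m / (ab.2 : ℝ) ^ m with hθ
  set Φ : ℕ → ℝ := fun a' => min 1 (r * (Q / |(a' : ℝ) ^ n - θ|)) with hΦ
  have hTmem : ∀ a' ∈ T.image Prod.fst, (a', b') ∈ pairSet A B ∧ ab ≠ (a', b') := by
    intro a' ha'
    obtain ⟨ab', h1, rfl⟩ := Finset.mem_image.1 ha'
    obtain ⟨h2, h3⟩ := Finset.mem_filter.1 h1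
    obtain ⟨h4, h5⟩ := Finset.mem_erase.1 h2
    subst h3
    exact ⟨h5, h4.symm⟩
  have hsum : ∑ ab' ∈ T, min 1 (r * (Q / |(ab'.1 : ℝ) ^ n -
      (ab.1 : ℝ) ^ n * (ab'.2 : ℝ) ^ m / (ab.2 : ℝ) ^ m|)) = ∑ a' ∈ T.image Prod.fst, Φ a' := by
    rw [Finset.sum_image]
    · refine Finset.sum_congr rfl fun ab' h1 => ?_
      rw [hΦ, hθ, ← (Finset.mem_filter.1 h1).2]
    · intro x hx y hy hxy
      exact Prod.ext hxy ((Finset.mem_filter.1 hx).2.trans (Finset.mem_filter.1 hy).2.symm)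
  rw [hsum]
  have hg : (0 : ℝ) < ((A : ℝ) / 16) ^ (n - 1) := by positivity
  have hlog : 0 ≤ Real.log A := Real.log_natCast_nonneg A
  refine (sum_le_of_separated (A := A) (f := fun a => (a : ℝ) ^ n) (θ := θ)
    (M := 4 ^ (n + m) * (r ^ s * Q ^ (ρ * s))) (K := r * Q) ?_ hg ?_ (by positivity)
    (by positivity) ?_ ?_).trans ?_
  · intro a' ha'
    exact (mem_pairSet.1 (hTmem a' ha').1).1.1
  · intro i hi j hj
    have key : ∀ i ∈ T.image Prod.fst, (A : ℝ) / 16 ≤ i := by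
      intro i hi
      have h1 : (A : ℝ) ≤ 16 * i := by
        exact_mod_cast (mem_pairSet.1 (hTmem i hi).1).2.1.le
      linarith
    exact mul_abs_sub_le_abs_pow_sub_pow h.one_le_n (by positivity) (key i hi) (key j hj)
  · intro a' ha'
    obtain ⟨h1, h2⟩ := hTmem a' ha'
    obtain ⟨h3, h4⟩ := h.transversality hρ hab h1 h2
    simp only at h3 h4
    rw [← hθ] at h3 h4
    have hκ : 0 < |(a' : ℝ) ^ n - θ| := abs_pos.2 h3
    have h5 : Q / |(a' : ℝ) ^ n - θ| ≤ 4 ^ (n + m) * Q ^ ρ := by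
      rwa [div_le_iff₀ hκ]
    have h4pow : (1 : ℝ) ≤ 4 ^ (n + m) := one_le_pow₀ (by norm_num)
    have hX : 0 < r * (Q / |(a' : ℝ) ^ n - θ|) := by positivity
    calc Φ a' ≤ (r * (Q / |(a' : ℝ) ^ n - θ|)) ^ s := by
          rcases le_total (r * (Q / |(a' : ℝ) ^ n - θ|)) 1 with h6 | h6
          · exact (min_le_right _ _).trans (Real.self_le_rpow_of_le_one hX.le h6 hs1)
          · exact (min_le_left _ _).trans (Real.one_le_rpow h6 hs.le)
      _ ≤ (r * (4 ^ (n + m) * Q ^ ρ)) ^ s := by gcongr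
      _ = (4 ^ (n + m)) ^ s * (r ^ s * Q ^ (ρ * s)) := by
          rw [Real.mul_rpow hr.le (by positivity), Real.mul_rpow (by positivity) (by positivity),
            Real.rpow_mul (by positivity), Real.rpow_natCast Q ρ]
          ring
      _ ≤ _ := by
          gcongr
          exact (Real.rpow_le_rpow_of_exponent_le h4pow hs1).trans_eq (Real.rpow_one _)
  · intro a' _
    rcases (abs_nonneg ((a' : ℝ) ^ n - θ)).eq_or_lt' with h0 | h0
    · rw [h0, mul_zero]; positivity
    · calc Φ a' * |(a' : ℝ) ^ n - θ| ≤ r * (Q / |(a' : ℝ) ^ n - θ|) * |(a' : ℝ) ^ n - θ| := by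
            gcongr; exact min_le_right _ _
        _ = r * Q := by field_simp
  · have h1 : r * Q / ((A : ℝ) / 16) ^ (n - 1) = 16 ^ (n - 1) * (r * A) := by
      obtain ⟨k, hk⟩ := Nat.exists_eq_add_of_le' h.one_le_n
      rw [← h.pow_A, hk, Nat.add_sub_cancel, div_pow, pow_succ]
      field_simp
    rw [h1]
    have h2 : (16 : ℝ) ^ (n - 1) ≤ 16 ^ n := pow_le_pow_right₀ (by norm_num) (Nat.sub_le _ _)
    calc _ = 4 ^ (n + m) * (r ^ s * Q ^ (ρ * s)) +
          4 * 16 ^ (n - 1) * (r * A * (1 + Real.log A)) := by ring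
      _ ≤ _ := by gcongr

lemma sum_min_le (h : LatticeScale n m p A B L Q) {ρ : ℕ}
    (hρ : (n = 1 ∧ m = 1 ∧ ρ = 2) ∨ (2 ≤ Nat.gcd n m ∧ ρ = 1)) {s r : ℝ} (hs : 0 < s) (hs1 : s ≤ 1)
    (hr : 0 < r) {ab : ℕ × ℕ} (hab : ab ∈ pairSet A B) :
    ∑ ab' ∈ (pairSet A B).erase ab,
      min 1 (r * (Q / |(ab'.1 : ℝ) ^ n - (ab.1 : ℝ) ^ n * (ab'.2 : ℝ) ^ m / (ab.2 : ℝ) ^ m|)) ≤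
        B * (4 ^ (n + m) * (r ^ s * Q ^ (ρ * s)) + 4 * 16 ^ n * (r * A * (1 + Real.log A))) := by
  rw [← Finset.sum_fiberwise_of_maps_to (t := Finset.Icc 1 B) (g := Prod.snd)]
  · refine (Finset.sum_le_sum fun b' _ => h.sum_min_le_of_snd_eq hρ hs hs1 hr hab b').trans_eq ?_
    rw [Finset.sum_const, Nat.card_Icc, nsmul_eq_mul, Nat.add_sub_cancel]
  · intro ab' h1
    exact Finset.mem_Icc.2 (mem_pairSet.1 (Finset.mem_of_mem_erase h1)).1.2

end LatticeScale
end

section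
open MeasureTheory Set Filter Topology ENNReal NNReal

namespace LatticeScale

variable {n m p A B L : ℕ} {Q : ℝ}

lemma le_ofReal_add_mul_min {C r l X : ℝ} {I : ℝ≥0∞}
    (h1 : I ≤ ENNReal.ofReal (C * (r + l))) (h2 : I ≤ ENNReal.ofReal (C * (r + l * X))) :
    I ≤ ENNReal.ofReal (C * (r + l * min 1 X)) := by
  rcases min_cases 1 X with ⟨h3, _⟩ | ⟨h3, _⟩
  · rwa [h3, mul_one]
  · rwa [h3]

lemma measurable_coe_spikes (p L : ℕ) (w : ℝ) : Measurable fun z => (spikes p L w z : ℝ≥0∞) :=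
  ENNReal.continuous_coe.measurable.comp (continuous_spikes p L w).measurable

lemma half_add_gap_div_le (h : LatticeScale n m p A B L Q) {ab : ℕ × ℕ}
    (hab : ab ∈ pairSet A B) :
    1 / 2 + 2 * (p * (L : ℝ) ^ (p - 1)) / (ab.2 : ℝ) ^ m ≤ 3 * (16 ^ m * p) := by
  have h1 := h.two_mul_gap_div_le hab
  have hL : (1 : ℝ) ≤ L := by exact_mod_cast h.one_le_L
  have hp : (1 : ℝ) ≤ p := by exact_mod_cast h.one_le_p
  have h16 : (1 : ℝ) ≤ 16 ^ m := one_le_pow₀ (by norm_num)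
  have hK : (1 : ℝ) ≤ 16 ^ m * p := by nlinarith
  have h2 : 2 * (16 ^ m * p : ℝ) / L ≤ 2 * (16 ^ m * p) := div_le_self (by positivity) hL
  linarith

lemma pair_correlation_le (h : LatticeScale n m p A B L Q) {w r : ℝ} (hw : 0 < w) (hw1 : w ≤ 1)
    (hr : 0 ≤ r) {ab ab' : ℕ × ℕ} (hab : ab ∈ pairSet A B) (hab' : ab' ∈ pairSet A B) :
    cubeInt (fun x y y' => (spikes p L w ((ab.1 : ℝ) ^ n * x + (ab.2 : ℝ) ^ m * y) : ℝ≥0∞) *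
      spikes p L w ((ab'.1 : ℝ) ^ n * x + (ab'.2 : ℝ) ^ m * y') * nearInd r y y') ≤
      ENNReal.ofReal (18 * (16 ^ m * p) ^ 2 * (r + 1 / L)) := by
  have hL : (1 : ℝ) ≤ L := by exact_mod_cast h.one_le_L
  have hp : (1 : ℝ) ≤ p := by exact_mod_cast h.one_le_p
  have h16 : (1 : ℝ) ≤ 16 ^ m := one_le_pow₀ (by norm_num)
  have hK : (1 : ℝ) ≤ 16 ^ m * p := by nlinarith
  refine (correlation_le (measurable_coe_spikes p L w) (by positivity)
    (lintegral_spikes_le h.one_le_p hw hw1) (coeff_pos_of_mem_pairSet n m hab).2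
    (coeff_pos_of_mem_pairSet n m hab').2 hr).trans (ENNReal.ofReal_le_ofReal ?_)
  have h1 := h.half_add_gap_div_le hab
  have h2 := h.two_mul_gap_div_le hab'
  set K : ℝ := 16 ^ m * p
  calc _ ≤ (2 * r + 2 * K / L) * (3 * K) := by gcongr
    _ = 6 * K * (1 * r + K * (1 / L)) := by ring
    _ ≤ 18 * K * (K * r + K * (1 / L)) := by gcongr; norm_num
    _ = _ := by ring

lemma diag_correlation_le (h : LatticeScale n m p A B L Q) {τ r : ℝ} (hτ : 0 ≤ τ)
    (hr : 0 ≤ r) {ab : ℕ × ℕ} (hab : ab ∈ pairSet A B) :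
    cubeInt (fun x y y' =>
      (spikes p L (Q ^ (-τ) / 2) ((ab.1 : ℝ) ^ n * x + (ab.2 : ℝ) ^ m * y) : ℝ≥0∞) *
      spikes p L (Q ^ (-τ) / 2) ((ab.1 : ℝ) ^ n * x + (ab.2 : ℝ) ^ m * y') * nearInd r y y') ≤
      ENNReal.ofReal (18 * (16 ^ m * p) ^ 2 * (r + 1 / L * (r * Q ^ (1 + τ)))) := by
  have hQ := h.one_le_Q
  have hw : 0 < Q ^ (-τ) / 2 := by positivity
  have hw1 : Q ^ (-τ) / 2 ≤ 1 := by
    have := Real.rpow_le_one_of_one_le_of_nonpos hQ (by linarith : -τ ≤ 0)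
    linarith
  have hL : (1 : ℝ) ≤ L := by exact_mod_cast h.one_le_L
  have hp : (1 : ℝ) ≤ p := by exact_mod_cast h.one_le_p
  have h16 : (1 : ℝ) ≤ 16 ^ m := one_le_pow₀ (by norm_num)
  have hK : (p : ℝ) ≤ 16 ^ m * p := by nlinarith
  have hM : p * (L : ℝ) ^ (p - 1) * (3 / (2 * (Q ^ (-τ) / 2))) = 3 * p * Q ^ (1 + τ) / L := by
    rw [h.gap_eq, Real.rpow_neg (by linarith), Real.rpow_add (by linarith), Real.rpow_one]
    field_simp
  refine (correlation_le_of_le (M := 3 * p * Q ^ (1 + τ) / L) (measurable_coe_spikes p L _)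
    (lintegral_spikes_le h.one_le_p hw hw1) (fun z => ?_) (by positivity)
    (coeff_pos_of_mem_pairSet n m hab).2 hr).trans (ENNReal.ofReal_le_ofReal ?_)
  · rw [← ENNReal.ofReal_coe_nnreal, ← hM]
    exact ENNReal.ofReal_le_ofReal (spikes_le h.one_le_p hw hw1 z)
  · have h1 := h.half_add_gap_div_le hab
    set K : ℝ := 16 ^ m * p
    calc _ ≤ 2 * r * (3 * K * Q ^ (1 + τ) / L) * (3 * K) := by gcongr
      _ = 18 * K ^ 2 * (1 / L * (r * Q ^ (1 + τ))) := by ring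
      _ ≤ _ := by gcongr; linarith

lemma offdiag_correlation_le (h : LatticeScale n m p A B L Q) {w r : ℝ} (hw : 0 < w)
    (hw1 : w ≤ 1) (hr : 0 ≤ r) {ab ab' : ℕ × ℕ} (hab : ab ∈ pairSet A B)
    (hκ : (ab'.1 : ℝ) ^ n - (ab.1 : ℝ) ^ n * (ab'.2 : ℝ) ^ m / (ab.2 : ℝ) ^ m ≠ 0) :
    cubeInt (fun x y y' => (spikes p L w ((ab.1 : ℝ) ^ n * x + (ab.2 : ℝ) ^ m * y) : ℝ≥0∞) *
      spikes p L w ((ab'.1 : ℝ) ^ n * x + (ab'.2 : ℝ) ^ m * y') * nearInd r y y') ≤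
      ENNReal.ofReal (18 * (16 ^ m * p) ^ 2 * (r + 1 / L * (r *
        (Q / |(ab'.1 : ℝ) ^ n - (ab.1 : ℝ) ^ n * (ab'.2 : ℝ) ^ m / (ab.2 : ℝ) ^ m|)))) := by
  have hQ := h.one_le_Q
  have hL : (1 : ℝ) ≤ L := by exact_mod_cast h.one_le_L
  have hp : (1 : ℝ) ≤ p := by exact_mod_cast h.one_le_p
  have h16 : (1 : ℝ) ≤ 16 ^ m := one_le_pow₀ (by norm_num)
  have hK : (1 : ℝ) ≤ 16 ^ m * p := by nlinarith
  have hK16 : (16 : ℝ) ^ m ≤ 16 ^ m * p := by nlinarith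
  have hKp : (p : ℝ) ≤ 16 ^ m * p := by nlinarith
  obtain ⟨hα, hβ⟩ := coeff_pos_of_mem_pairSet n m hab
  obtain ⟨_, hαQ, hQβ, hβQ⟩ := h.coeff_bounds hab
  refine (correlation_le_of_transversal (measurable_coe_spikes p L w) (by positivity)
    (lintegral_spikes_le h.one_le_p hw hw1) hα.le hβ hαQ hβQ hκ hr).trans
    (ENNReal.ofReal_le_ofReal ?_)
  have h1 := h.half_add_gap_div_le hab
  have h3 := h.two_mul_gap_div_le hab
  set K : ℝ := 16 ^ m * p with hKdef
  set κ := |(ab'.1 : ℝ) ^ n - (ab.1 : ℝ) ^ n * (ab'.2 : ℝ) ^ m / (ab.2 : ℝ) ^ m| with hκdef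
  have hκ0 : 0 < κ := abs_pos.2 hκ
  have h2 : (Q + 2 * (p * (L : ℝ) ^ (p - 1))) / (ab.2 : ℝ) ^ m ≤ 3 * K := by
    have h4 : Q / (ab.2 : ℝ) ^ m ≤ K := by
      rw [div_le_iff₀ hβ]
      exact hQβ.trans (by gcongr)
    have h5 : 2 * K / L ≤ 2 * K := div_le_self (by positivity) hL
    rw [add_div]
    linarith
  calc _ ≤ 3 * K * (2 * r) * (1 / 2 + 2 * (p * (L : ℝ) ^ (p - 1)) / κ) := by gcongr
    _ = 3 * K * (1 * r) + 12 * K * p * (1 / L * (r * (Q / κ))) := by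
        rw [h.gap_eq]; field_simp; ring
    _ ≤ 18 * K * (K * r) + 18 * K * K * (1 / L * (r * (Q / κ))) := by
        gcongr <;> norm_num
    _ = _ := by ring

end LatticeScale
end

section
open MeasureTheory Set Filter Topology ENNReal NNReal

namespace LatticeScale

variable {n m p A B L : ℕ} {Q : ℝ}

lemma cubeInt_latticeDensity (hP : (pairSet A B).Nonempty) (w r : ℝ) :
    cubeInt (fun x y y' => latticeDensity n m p A B L w (x, y) *
      latticeDensity n m p A B L w (x, y') * nearInd r y y') =
    ((pairSet A B).card : ℝ≥0∞)⁻¹ * ∑ ab ∈ pairSet A B, ((pairSet A B).card : ℝ≥0∞)⁻¹ *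
      ∑ ab' ∈ pairSet A B, cubeInt (fun x y y' =>
        (spikes p L w ((ab.1 : ℝ) ^ n * x + (ab.2 : ℝ) ^ m * y) : ℝ≥0∞) *
        spikes p L w ((ab'.1 : ℝ) ^ n * x + (ab'.2 : ℝ) ^ m * y') * nearInd r y y') := by
  have hs := measurable_coe_spikes p L w
  have hN : Measurable fun q : ℝ × ℝ × ℝ => nearInd r q.2.1 q.2.2 :=
    (measurable_nearInd r).comp measurable_snd
  have h1 : ∀ ab ab' : ℕ × ℕ, Measurable fun q : ℝ × ℝ × ℝ =>
      (spikes p L w ((ab.1 : ℝ) ^ n * q.1 + (ab.2 : ℝ) ^ m * q.2.1) : ℝ≥0∞) *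
        spikes p L w ((ab'.1 : ℝ) ^ n * q.1 + (ab'.2 : ℝ) ^ m * q.2.2) * nearInd r q.2.1 q.2.2 :=
    fun ab ab' => ((hs.comp (by fun_prop)).mul (hs.comp (by fun_prop))).mul hN
  have h2 : ∀ ab : ℕ × ℕ, Measurable fun q : ℝ × ℝ × ℝ => ∑ ab' ∈ pairSet A B,
      (spikes p L w ((ab.1 : ℝ) ^ n * q.1 + (ab.2 : ℝ) ^ m * q.2.1) : ℝ≥0∞) *
        spikes p L w ((ab'.1 : ℝ) ^ n * q.1 + (ab'.2 : ℝ) ^ m * q.2.2) * nearInd r q.2.1 q.2.2 :=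
    fun ab => Finset.measurable_fun_sum _ fun ab' _ => h1 ab ab'
  have h3 : Measurable fun q : ℝ × ℝ × ℝ => ∑ ab ∈ pairSet A B, ((pairSet A B).card : ℝ≥0∞)⁻¹ *
      ∑ ab' ∈ pairSet A B,
      (spikes p L w ((ab.1 : ℝ) ^ n * q.1 + (ab.2 : ℝ) ^ m * q.2.1) : ℝ≥0∞) *
        spikes p L w ((ab'.1 : ℝ) ^ n * q.1 + (ab'.2 : ℝ) ^ m * q.2.2) * nearInd r q.2.1 q.2.2 :=
    Finset.measurable_fun_sum _ fun ab _ => (h2 ab).const_mul _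
  have e : ∀ x y y', (latticeDensity n m p A B L w (x, y) *
      latticeDensity n m p A B L w (x, y') * nearInd r y y' : ℝ≥0∞) =
      ((pairSet A B).card : ℝ≥0∞)⁻¹ * ∑ ab ∈ pairSet A B, ((pairSet A B).card : ℝ≥0∞)⁻¹ *
      ∑ ab' ∈ pairSet A B,
      (spikes p L w ((ab.1 : ℝ) ^ n * x + (ab.2 : ℝ) ^ m * y) : ℝ≥0∞) *
        spikes p L w ((ab'.1 : ℝ) ^ n * x + (ab'.2 : ℝ) ^ m * y') * nearInd r y y' := by
    intro x y y'
    rw [coe_latticeDensity n m p hP, coe_latticeDensity n m p hP]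
    simp only [← Finset.mul_sum, ← Finset.sum_mul]
    ring
  simp only [e]
  rw [cubeInt_const_mul _ h3, cubeInt_finset_sum _ fun ab _ => (h2 ab).const_mul _]
  congr 1
  refine Finset.sum_congr rfl fun ab _ => ?_
  rw [cubeInt_const_mul _ (h2 ab), cubeInt_finset_sum _ fun cd _ => h1 ab cd]

/-- The correlation integral of the lattice density at distance `r` is `O(r ^ s)`. -/
theorem correlation_le (h : LatticeScale n m p A B L Q) {ρ : ℕ}
    (hρ : (n = 1 ∧ m = 1 ∧ ρ = 2) ∨ (2 ≤ Nat.gcd n m ∧ ρ = 1)) {τ s D r : ℝ} (hτ : 0 ≤ τ)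
    (hs : 0 < s) (hs1 : s ≤ 1) (hdiag : Q ^ ((1 + τ) * s) ≤ A * B * L)
    (hoff : Q ^ (ρ * s) ≤ A * L) (hlog : 1 + Real.log A ≤ D * L) (hr : 0 < r) (hr1 : r ≤ 1) :
    cubeInt (fun x y y' => latticeDensity n m p A B L (Q ^ (-τ) / 2) (x, y) *
      latticeDensity n m p A B L (Q ^ (-τ) / 2) (x, y') * nearInd r y y') ≤
      ENNReal.ofReal (18 * (16 ^ m * p) ^ 2 * (1 + 8 * (1 + 4 ^ (n + m) + 4 * 16 ^ n * D)) *
        r ^ s) := by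
  have hQ := h.one_le_Q
  have hw : 0 < Q ^ (-τ) / 2 := by positivity
  have hw1 : Q ^ (-τ) / 2 ≤ 1 := by
    have := Real.rpow_le_one_of_one_le_of_nonpos hQ (by linarith : -τ ≤ 0)
    linarith
  have hL : (0 : ℝ) < L := by exact_mod_cast h.one_le_L
  have hA := h.pos_A
  have hB := h.pos_B
  have hP := h.nonempty_pairSet
  have hN : (0 : ℝ) < (pairSet A B).card := by exact_mod_cast Finset.card_pos.2 hP
  have hAB := mul_le_card_pairSet A B
  have hD : 0 ≤ D := by
    have : 0 ≤ Real.log A := Real.log_natCast_nonneg A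
    by_contra! hD
    nlinarith
  have hrs : r ≤ r ^ s := Real.self_le_rpow_of_le_one hr.le hr1 hs1
  set C : ℝ := 18 * (16 ^ m * p) ^ 2
  rw [cubeInt_latticeDensity hP]
  refine inv_card_mul_sum_le hP fun ab hab => ?_
  set κ : ℕ × ℕ → ℝ := fun ab' =>
    |(ab'.1 : ℝ) ^ n - (ab.1 : ℝ) ^ n * (ab'.2 : ℝ) ^ m / (ab.2 : ℝ) ^ m| with hκ
  set Y : ℕ × ℕ → ℝ := fun ab' => if ab' = ab then r * Q ^ (1 + τ) else r * (Q / κ ab') with hY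
  have hY0 : ∀ ab', 0 ≤ Y ab' := by
    intro ab'
    simp only [hY]
    split_ifs <;> positivity
  have hbound : ∀ ab' ∈ pairSet A B, cubeInt (fun x y y' =>
      (spikes p L (Q ^ (-τ) / 2) ((ab.1 : ℝ) ^ n * x + (ab.2 : ℝ) ^ m * y) : ℝ≥0∞) *
      spikes p L (Q ^ (-τ) / 2) ((ab'.1 : ℝ) ^ n * x + (ab'.2 : ℝ) ^ m * y') * nearInd r y y') ≤
      ENNReal.ofReal (C * (r + 1 / L * min 1 (Y ab'))) := by
    intro ab' hab'
    refine le_ofReal_add_mul_min (h.pair_correlation_le hw hw1 hr.le hab hab') ?_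
    by_cases heq : ab' = ab
    · simp only [hY, heq, if_true]
      exact h.diag_correlation_le hτ hr.le hab
    · simp only [hY, heq, if_false]
      exact h.offdiag_correlation_le hw hw1 hr.le hab
        (h.transversality hρ hab hab' (Ne.symm heq)).1
  have hsum : ∑ ab' ∈ pairSet A B, min 1 (Y ab') ≤ r ^ s * Q ^ ((1 + τ) * s) +
      B * (4 ^ (n + m) * (r ^ s * Q ^ (ρ * s)) + 4 * 16 ^ n * (r * A * (1 + Real.log A))) := by
    rw [← Finset.add_sum_erase _ _ hab]
    refine add_le_add ?_ ((Finset.sum_congr rfl fun ab' h1 => ?_).trans_le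
      (h.sum_min_le hρ hs hs1 hr hab))
    · simp only [hY, if_true]
      rw [Real.rpow_mul (by linarith), ← Real.mul_rpow hr.le (by positivity)]
      rcases le_total (r * Q ^ (1 + τ)) 1 with h6 | h6
      · exact (min_le_right _ _).trans (Real.self_le_rpow_of_le_one (by positivity) h6 hs1)
      · exact (min_le_left _ _).trans (Real.one_le_rpow h6 hs.le)
    · simp only [hY, Finset.ne_of_mem_erase h1, if_false, hκ]
  have htotal : ∑ ab' ∈ pairSet A B, C * (r + 1 / L * min 1 (Y ab')) ≤
      (pairSet A B).card * (C * (1 + 8 * (1 + 4 ^ (n + m) + 4 * 16 ^ n * D)) * r ^ s) := by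
    rw [← Finset.mul_sum, Finset.sum_add_distrib, ← Finset.mul_sum, Finset.sum_const, nsmul_eq_mul]
    calc _ ≤ C * ((pairSet A B).card * r ^ s + 1 / L * (r ^ s * (A * B * L) +
          B * (4 ^ (n + m) * (r ^ s * (A * L)) + 4 * 16 ^ n * (r ^ s * A * (D * L))))) := by
          gcongr
          refine hsum.trans ?_
          have : 0 ≤ Real.log A := Real.log_natCast_nonneg A
          gcongr
      _ = C * r ^ s * ((pairSet A B).card + (A * B) * (1 + 4 ^ (n + m) + 4 * 16 ^ n * D)) := by
          field_simp; ring
      _ ≤ C * r ^ s * ((pairSet A B).card +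
            (8 * (pairSet A B).card) * (1 + 4 ^ (n + m) + 4 * 16 ^ n * D)) := by gcongr
      _ = _ := by ring
  have hpos : ∀ ab' ∈ pairSet A B, 0 ≤ C * (r + 1 / L * min 1 (Y ab')) := by
    intro ab' _
    have := hY0 ab'
    have : 0 ≤ min 1 (Y ab') := le_min zero_le_one this
    positivity
  calc _ ≤ ((pairSet A B).card : ℝ≥0∞)⁻¹ *
        ENNReal.ofReal (∑ ab' ∈ pairSet A B, C * (r + 1 / L * min 1 (Y ab'))) := by
        rw [ENNReal.ofReal_sum_of_nonneg hpos]
        exact mul_le_mul_right (Finset.sum_le_sum hbound) _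
    _ ≤ ((pairSet A B).card : ℝ≥0∞)⁻¹ * ENNReal.ofReal ((pairSet A B).card *
          (C * (1 + 8 * (1 + 4 ^ (n + m) + 4 * 16 ^ n * D)) * r ^ s)) :=
        mul_le_mul_right (ENNReal.ofReal_le_ofReal htotal) _
    _ = _ := by
        rw [ENNReal.ofReal_mul hN.le, ENNReal.ofReal_natCast, ← mul_assoc,
          ENNReal.inv_mul_cancel (by simpa using hP.ne_empty) (by simp), one_mul]

end LatticeScale
end

section
open MeasureTheory Set Filter Topology ENNReal NNReal

/-- Points of the unit square with infinitely many `(a, b, c)` such that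
`|a ^ n * x + b ^ m * y - c ^ p| < max (a ^ n) (b ^ m) ^ (-τ)`. -/
def approxSet (n m p : ℕ) (τ : ℝ) : Set (ℝ × ℝ) :=
  {xy : ℝ × ℝ | xy.1 ∈ Set.Ico (0 : ℝ) 1 ∧ xy.2 ∈ Set.Ico (0 : ℝ) 1 ∧
    {abc : ℕ × ℕ × ℕ | 1 ≤ abc.1 ∧ 1 ≤ abc.2.1 ∧
      |(abc.1 : ℝ) ^ n * xy.1 + (abc.2.1 : ℝ) ^ m * xy.2 - (abc.2.2 : ℝ) ^ p| <
        ((max (abc.1 ^ n) (abc.2.1 ^ m) : ℕ) : ℝ) ^ (-τ)}.Infinite}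

lemma latticeScale_pow {n m p T : ℕ} (hn : 1 ≤ n) (hm : 1 ≤ m) (hp : 1 ≤ p) (hT : 1 ≤ T) :
    LatticeScale n m p (T ^ (m * p)) (T ^ (n * p)) (T ^ (n * m)) ((T : ℝ) ^ (n * m * p)) where
  one_le_n := hn
  one_le_m := hm
  one_le_p := hp
  one_le_L := Nat.one_le_pow _ _ hT
  pow_A := by push_cast; rw [← pow_mul]; congr 1; ring
  pow_B := by push_cast; rw [← pow_mul]; congr 1; ring
  pow_L := by push_cast; rw [← pow_mul]

/-- The closed strips of width `w` to the right of the lines `a ^ n * x + b ^ m * y = c ^ p`. -/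
def stripUnion (n m p A B L : ℕ) (w : ℝ) : Set (ℝ × ℝ) :=
  ⋃ ab ∈ pairSet A B, ⋃ c ∈ Finset.range L,
    {q | 0 ≤ (ab.1 : ℝ) ^ n * q.1 + (ab.2 : ℝ) ^ m * q.2 - (c : ℝ) ^ p ∧
      (ab.1 : ℝ) ^ n * q.1 + (ab.2 : ℝ) ^ m * q.2 - (c : ℝ) ^ p ≤ w}

lemma isClosed_stripUnion (n m p A B L : ℕ) (w : ℝ) : IsClosed (stripUnion n m p A B L w) :=
  isClosed_biUnion_finset fun _ _ => isClosed_biUnion_finset fun _ _ => by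
    rw [ofPred_and]
    exact (isClosed_le (by fun_prop) (by fun_prop)).inter (isClosed_le (by fun_prop) (by fun_prop))

lemma latticeDensity_eq_zero {n m p A B L : ℕ} {w : ℝ} (hw : 0 < w) {q : ℝ × ℝ}
    (hq : q ∉ stripUnion n m p A B L w) : latticeDensity n m p A B L w q = 0 := by
  refine mul_eq_zero_of_right _ (Finset.sum_eq_zero fun ab hab => ?_)
  by_contra hne
  obtain ⟨c, hc, h1, h2⟩ := exists_of_spikes_ne_zero hw hne
  exact hq (mem_biUnion hab (mem_biUnion (Finset.mem_coe.2 (Finset.mem_range.2 hc))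
    ⟨h1.le, h2.le⟩))

lemma mem_approxSet_of_frequently {n m p : ℕ} (hn : 1 ≤ n) (hm : 1 ≤ m) (hp : 1 ≤ p) {τ : ℝ}
    (hτ : 0 ≤ τ) {q : ℝ × ℝ} (hq : q ∈ Icc (0 : ℝ) (1 / 2) ×ˢ Icc (0 : ℝ) (1 / 2))
    (h : ∃ᶠ k : ℕ in atTop, q ∈ stripUnion n m p ((k + 1) ^ (m * p)) ((k + 1) ^ (n * p))
      ((k + 1) ^ (n * m)) ((((k + 1 : ℕ) : ℝ) ^ (n * m * p)) ^ (-τ) / 2)) :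
    q ∈ approxSet n m p τ := by
  obtain ⟨⟨h1, h2⟩, h3, h4⟩ := hq
  refine ⟨⟨h1, by linarith⟩, ⟨h3, by linarith⟩, fun hfin => ?_⟩
  obtain ⟨M, hM⟩ := (hfin.image Prod.fst).bddAbove
  obtain ⟨k, hk, hqk⟩ := frequently_atTop.1 h (16 * M)
  simp only [stripUnion, mem_iUnion, exists_prop] at hqk
  obtain ⟨ab, hab, c, _, h5, h6⟩ := hqk
  have hs := latticeScale_pow hn hm hp (Nat.le_add_left 1 k)
  obtain ⟨_, hα, _, hβ⟩ := hs.coeff_bounds hab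
  obtain ⟨⟨⟨ha, _⟩, hb, _⟩, hA, _⟩ := mem_pairSet.1 hab
  set Q : ℝ := ((k + 1 : ℕ) : ℝ) ^ (n * m * p) with hQ
  have hmem : (ab.1, ab.2, c) ∈ {abc : ℕ × ℕ × ℕ | 1 ≤ abc.1 ∧ 1 ≤ abc.2.1 ∧
      |(abc.1 : ℝ) ^ n * q.1 + (abc.2.1 : ℝ) ^ m * q.2 - (abc.2.2 : ℝ) ^ p| <
        ((max (abc.1 ^ n) (abc.2.1 ^ m) : ℕ) : ℝ) ^ (-τ)} := by
    refine ⟨ha, hb, ?_⟩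
    have hmax0 : 0 < ((max (ab.1 ^ n) (ab.2 ^ m) : ℕ) : ℝ) := by
      have : 0 < ab.1 ^ n := Nat.pow_pos ha
      exact_mod_cast lt_max_of_lt_left this
    have hmax : ((max (ab.1 ^ n) (ab.2 ^ m) : ℕ) : ℝ) ≤ Q := by
      push_cast
      exact max_le hα hβ
    have hQ0 : 0 < Q ^ (-τ) := Real.rpow_pos_of_pos (hmax0.trans_le hmax) _
    have hle := Real.rpow_le_rpow_of_nonpos hmax0 hmax (by linarith : -τ ≤ 0)
    rw [abs_of_nonneg h5]
    linarith
  have hle : ab.1 ≤ M := hM ⟨_, hmem, rfl⟩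
  have hk1 : k + 1 ≤ (k + 1) ^ (m * p) :=
    Nat.le_self_pow (Nat.mul_ne_zero (by omega) (by omega)) _
  omega

lemma verticalEquidistribution_latticeDensity {n m p : ℕ} (hn : 1 ≤ n) (hm : 1 ≤ m) (hp : 1 ≤ p)
    {τ : ℝ} (hτ : 0 ≤ τ) :
    VerticalEquidistribution fun k => latticeDensity n m p ((k + 1) ^ (m * p)) ((k + 1) ^ (n * p))
      ((k + 1) ^ (n * m)) ((((k + 1 : ℕ) : ℝ) ^ (n * m * p)) ^ (-τ) / 2) := by
  have hscale := fun k : ℕ => latticeScale_pow hn hm hp (Nat.le_add_left 1 k)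
  have hw : ∀ k : ℕ, 0 < ((((k + 1 : ℕ) : ℝ) ^ (n * m * p)) ^ (-τ) / 2) := fun k => by positivity
  have hw1 : ∀ k : ℕ, ((((k + 1 : ℕ) : ℝ) ^ (n * m * p)) ^ (-τ) / 2) ≤ 1 := fun k => by
    have := Real.rpow_le_one_of_one_le_of_nonpos (hscale k).one_le_Q (by linarith : -τ ≤ 0)
    linarith
  have herr : ∀ ε : ℝ, 0 < ε → ∀ᶠ k : ℕ in atTop,
      2 * (16 ^ m * p) / (((k + 1) ^ (n * m) : ℕ) : ℝ) ≤ ε := by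
    intro ε hε
    have h1 : Tendsto (fun k : ℕ => 2 * (16 ^ m * p : ℝ) / ((k : ℝ) + 1)) atTop (𝓝 0) :=
      tendsto_const_nhds.div_atTop
        (tendsto_atTop_add_const_right _ _ tendsto_natCast_atTop_atTop)
    filter_upwards [h1.eventually_le_const hε] with k hk
    refine le_trans ?_ hk
    have : k + 1 ≤ (k + 1) ^ (n * m) := Nat.le_self_pow (Nat.mul_ne_zero (by omega) (by omega)) _
    have : (k : ℝ) + 1 ≤ (((k + 1) ^ (n * m) : ℕ) : ℝ) := by exact_mod_cast this
    gcongr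
  refine ⟨fun k => continuous_latticeDensity _ _ _ _ _ _ _, fun ε hε => ?_, fun ε hε => ?_⟩
  · filter_upwards [herr ε hε] with k hk x _ u v _ _ _
    exact ((hscale k).lintegral_latticeDensity_le (hw k) (hw1 k) x u v).trans
      (ENNReal.ofReal_le_ofReal (by linarith))
  · filter_upwards [herr ε hε] with k hk x hx u v hu huv hv
    exact ((hscale k).le_lintegral_latticeDensity (hw k) (hw1 k) hx hu huv hv).trans
      (add_le_add le_rfl (ENNReal.ofReal_le_ofReal hk))

lemma ofReal_one_add_le_dimH_approxSet {n m p : ℕ} (hn : 1 ≤ n) (hm : 1 ≤ m) (hp : 1 ≤ p)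
    {ρ : ℕ} (hρ : (n = 1 ∧ m = 1 ∧ ρ = 2) ∨ (2 ≤ Nat.gcd n m ∧ ρ = 1)) {τ s : ℝ} (hτ : 0 ≤ τ)
    (hs : 0 < s) (hs1 : s ≤ 1)
    (hdiag : (1 + τ) * s ≤ 1 / (n : ℝ) + 1 / (m : ℝ) + 1 / (p : ℝ))
    (hoff : ρ * s ≤ 1 / (n : ℝ) + 1 / (p : ℝ)) :
    ENNReal.ofReal (1 + s) ≤ dimH (approxSet n m p τ) := by
  have hn0 : (0 : ℝ) < n := by exact_mod_cast hn
  have hm0 : (0 : ℝ) < m := by exact_mod_cast hm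
  have hp0 : (0 : ℝ) < p := by exact_mod_cast hp
  have hscale := fun k : ℕ => latticeScale_pow hn hm hp (Nat.le_add_left 1 k)
  have hT1 : ∀ k : ℕ, (1 : ℝ) ≤ ((k + 1 : ℕ) : ℝ) := fun k => by exact_mod_cast Nat.le_add_left 1 k
  have hcorr : ∀ t, 0 < t → t < s → ENNReal.ofReal (1 + t) ≤ dimH (approxSet n m p τ) := by
    intro t ht hts
    refine (verticalEquidistribution_latticeDensity hn hm hp hτ).le_dimH ht hts
      (fun k r hr hr1 => (hscale k).correlation_le hρ (D := 1 + m * p) hτ hs hs1 ?_ ?_ ?_ hr hr1)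
      (fun k => isClosed_stripUnion n m p ((k + 1) ^ (m * p)) ((k + 1) ^ (n * p))
        ((k + 1) ^ (n * m)) ((((k + 1 : ℕ) : ℝ) ^ (n * m * p)) ^ (-τ) / 2))
      (fun k q hq => latticeDensity_eq_zero (by positivity) hq)
      (fun q hq hfreq => mem_approxSet_of_frequently hn hm hp hτ hq hfreq)
    · rw [← Real.rpow_natCast, ← Real.rpow_mul (by positivity)]
      have e : (((k + 1) ^ (m * p) : ℕ) : ℝ) * (((k + 1) ^ (n * p) : ℕ) : ℝ) *
          (((k + 1) ^ (n * m) : ℕ) : ℝ) =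
          ((k + 1 : ℕ) : ℝ) ^ (((m * p + n * p + n * m : ℕ)) : ℝ) := by
        rw [Real.rpow_natCast, pow_add, pow_add]; push_cast; ring
      rw [e]
      refine Real.rpow_le_rpow_of_exponent_le (hT1 k) ?_
      calc ((n * m * p : ℕ) : ℝ) * ((1 + τ) * s)
          ≤ ((n * m * p : ℕ) : ℝ) * (1 / (n : ℝ) + 1 / (m : ℝ) + 1 / (p : ℝ)) := by gcongr
        _ = _ := by push_cast; field_simp
    · rw [← Real.rpow_natCast, ← Real.rpow_mul (by positivity)]
      have e : (((k + 1) ^ (m * p) : ℕ) : ℝ) * (((k + 1) ^ (n * m) : ℕ) : ℝ) =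
          ((k + 1 : ℕ) : ℝ) ^ (((m * p + n * m : ℕ)) : ℝ) := by
        rw [Real.rpow_natCast, pow_add]; push_cast; ring
      rw [e]
      refine Real.rpow_le_rpow_of_exponent_le (hT1 k) ?_
      calc ((n * m * p : ℕ) : ℝ) * (ρ * s)
          ≤ ((n * m * p : ℕ) : ℝ) * (1 / (n : ℝ) + 1 / (p : ℝ)) := by gcongr
        _ = _ := by push_cast; field_simp
    · have h1 : k + 1 ≤ (k + 1) ^ (n * m) :=
        Nat.le_self_pow (Nat.mul_ne_zero (by omega) (by omega)) _
      have h2 : ((k + 1 : ℕ) : ℝ) ≤ (((k + 1) ^ (n * m) : ℕ) : ℝ) := by exact_mod_cast h1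
      have h3 : Real.log (((k + 1) ^ (m * p) : ℕ) : ℝ) ≤ m * p * ((k + 1 : ℕ) : ℝ) := by
        rw [Nat.cast_pow, Real.log_pow, Nat.cast_mul]
        gcongr
        exact Real.log_le_self (by positivity)
      have h4 := hT1 k
      have h5 : (m * p : ℝ) * ((k + 1 : ℕ) : ℝ) ≤ m * p * (((k + 1) ^ (n * m) : ℕ) : ℝ) := by
        gcongr
      linarith
  have hcont : Tendsto (fun t : ℝ => ENNReal.ofReal (1 + t)) (𝓝[<] s)
      (𝓝 (ENNReal.ofReal (1 + s))) :=
    ((ENNReal.continuous_ofReal.comp (by fun_prop : Continuous fun t : ℝ => 1 + t)).tendsto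
      s).mono_left nhdsWithin_le_nhds
  refine le_of_tendsto hcont ?_
  filter_upwards [Ioo_mem_nhdsLT hs] with t ht
  exact hcorr t ht.1 ht.2

lemma dimH_approxSet_le_swap (n m p : ℕ) (τ : ℝ) :
    dimH (approxSet m n p τ) ≤ dimH (approxSet n m p τ) := by
  have hiso : Isometry (Prod.swap : ℝ × ℝ → ℝ × ℝ) :=
    Isometry.of_dist_eq fun x y => by simp only [Prod.dist_eq, Prod.fst_swap, Prod.snd_swap, max_comm]
  rw [← hiso.dimH_image (approxSet m n p τ)]
  refine dimH_mono ?_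
  rintro _ ⟨q, ⟨h1, h2, h3⟩, rfl⟩
  refine ⟨h2, h1, ?_⟩
  have hinj : Function.Injective fun abc : ℕ × ℕ × ℕ => (abc.2.1, abc.1, abc.2.2) := by
    rintro ⟨a, b, c⟩ ⟨a', b', c'⟩ h
    simp only [Prod.mk.injEq] at h ⊢
    tauto
  refine (h3.image hinj.injOn).mono ?_
  rintro _ ⟨⟨a, b, c⟩, ⟨h4, h5, h6⟩, rfl⟩
  refine ⟨h5, h4, ?_⟩
  simp only [Prod.fst_swap, Prod.snd_swap] at h6 ⊢
  rwa [max_comm, add_comm ((b : ℝ) ^ n * q.2)]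

theorem le_dimH_approxSet {n m p : ℕ} (hn : 1 ≤ n) (hm : 1 ≤ m) (hp : 1 ≤ p)
    (hcase : (n = 1 ∧ m = 1 ∧ p = 1) ∨ 2 ≤ Nat.gcd n m) {τ : ℝ} (hτ : 1 < τ) :
    ENNReal.ofReal (1 + min 1 ((1 / (n : ℝ) + 1 / (m : ℝ) + 1 / (p : ℝ)) / (τ + 1))) ≤
      dimH (approxSet n m p τ) := by
  wlog hnm : n ≤ m generalizing n m
  · have h := this hm hn (by rw [Nat.gcd_comm]; tauto) (le_of_not_ge hnm)
    rw [add_comm (1 / (m : ℝ))] at h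
    exact h.trans (dimH_approxSet_le_swap n m p τ)
  have hn0 : (0 : ℝ) < n := by exact_mod_cast hn
  have hm0 : (0 : ℝ) < m := by exact_mod_cast hm
  have hp0 : (0 : ℝ) < p := by exact_mod_cast hp
  set s := min 1 ((1 / (n : ℝ) + 1 / (m : ℝ) + 1 / (p : ℝ)) / (τ + 1)) with hs
  have hs0 : 0 < s := lt_min one_pos (by positivity)
  have hs1 : s ≤ 1 := min_le_left _ _
  have hdiag : (1 + τ) * s ≤ 1 / (n : ℝ) + 1 / (m : ℝ) + 1 / (p : ℝ) := by
    have := min_le_right 1 ((1 / (n : ℝ) + 1 / (m : ℝ) + 1 / (p : ℝ)) / (τ + 1))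
    rw [← hs, le_div_iff₀ (by linarith)] at this
    linarith
  rcases hcase with ⟨rfl, rfl, rfl⟩ | hg
  · refine ofReal_one_add_le_dimH_approxSet hn hm hp (ρ := 2) (Or.inl ⟨rfl, rfl, rfl⟩)
      (by linarith) hs0 hs1 hdiag ?_
    norm_num
    linarith
  · refine ofReal_one_add_le_dimH_approxSet hn hm hp (ρ := 1) (Or.inr ⟨hg, rfl⟩)
      (by linarith) hs0 hs1 hdiag ?_
    have h1 : 1 / (m : ℝ) ≤ 1 / n := one_div_le_one_div_of_le hn0 (by exact_mod_cast hnm)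
    have h2 : 0 < 1 / (p : ℝ) := by positivity
    have h3 : 2 * s ≤ (1 + τ) * s := by gcongr; linarith
    rw [Nat.cast_one, one_mul]
    linarith

end

section
open MeasureTheory Set Filter Topology ENNReal NNReal

/-- The larger coefficient of the line attached to `(a, b, c)`. -/
def height (n m : ℕ) (e : ℕ × ℕ × ℕ) : ℕ := max (e.1 ^ n) (e.2.1 ^ m)

/-- The points of the unit square approximated by the line attached to `(a, b, c)`. -/
def strip (n m p : ℕ) (τ : ℝ) (e : ℕ × ℕ × ℕ) : Set (ℝ × ℝ) :=
  {q | q.1 ∈ Ico (0 : ℝ) 1 ∧ q.2 ∈ Ico (0 : ℝ) 1 ∧ 1 ≤ e.1 ∧ 1 ≤ e.2.1 ∧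
    |(e.1 : ℝ) ^ n * q.1 + (e.2.1 : ℝ) ^ m * q.2 - (e.2.2 : ℝ) ^ p| < (height n m e : ℝ) ^ (-τ)}

/-- The width of the strip attached to `(a, b, c)`, up to a constant. -/
noncomputable def stripWidth (n m : ℕ) (τ : ℝ) (e : ℕ × ℕ × ℕ) : ℝ :=
  (height n m e : ℝ) ^ (-(τ + 1))

/-- A piece of the strip, comparable to a square of side the width of the strip. -/
noncomputable def stripPiece (n m p : ℕ) (τ : ℝ) (e : ℕ × ℕ × ℕ) (j : ℕ) : Set (ℝ × ℝ) :=
  {q | q ∈ strip n m p τ e ∧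
    ⌊(if e.1 ^ n ≤ e.2.1 ^ m then q.1 else q.2) / stripWidth n m τ e⌋₊ = j}

lemma abs_sub_le_of_floor_eq {δ x x' : ℝ} (hδ : 0 < δ) (hx : 0 ≤ x) (hx' : 0 ≤ x')
    (h : ⌊x / δ⌋₊ = ⌊x' / δ⌋₊) : |x - x'| ≤ δ := by
  have h1 := Nat.floor_le (div_nonneg hx hδ.le)
  have h2 := Nat.lt_floor_add_one (x / δ)
  have h3 := Nat.floor_le (div_nonneg hx' hδ.le)
  have h4 := Nat.lt_floor_add_one (x' / δ)
  rw [← h] at h3 h4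
  have h5 : x / δ - x' / δ < 1 := by linarith
  have h6 : x' / δ - x / δ < 1 := by linarith
  rw [← _root_.sub_div, div_lt_one hδ] at h5
  rw [← _root_.sub_div, div_lt_one hδ] at h6
  exact abs_le.2 ⟨by linarith, by linarith⟩

lemma abs_sub_le_of_mem_strip {α β c w δ x y x' y' : ℝ} (hα : 0 ≤ α) (hαβ : α ≤ β) (hβ : 0 < β)
    (h : |α * x + β * y - c| < w) (h' : |α * x' + β * y' - c| < w) (hw : w ≤ β * δ)
    (hx : |x - x'| ≤ δ) : |y - y'| ≤ 3 * δ := by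
  have h1 : β * (y - y') = (α * x + β * y - c) - (α * x' + β * y' - c) - α * (x - x') := by ring
  have h2 : β * |y - y'| ≤ β * (3 * δ) := by
    calc β * |y - y'| = |β * (y - y')| := by rw [abs_mul, abs_of_pos hβ]
      _ ≤ |α * x + β * y - c| + |α * x' + β * y' - c| + |α * (x - x')| := by
        rw [h1]
        exact (abs_sub _ _).trans (add_le_add (abs_sub _ _) le_rfl)
      _ = |α * x + β * y - c| + |α * x' + β * y' - c| + α * |x - x'| := by
        rw [abs_mul, abs_of_nonneg hα]
      _ ≤ β * δ + β * δ + β * δ := by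
        have : α * |x - x'| ≤ β * δ := by gcongr
        linarith
      _ = _ := by ring
  exact le_of_mul_le_mul_left h2 hβ

lemma one_le_height {n m : ℕ} {e : ℕ × ℕ × ℕ} (h : 1 ≤ e.1) : (1 : ℝ) ≤ height n m e := by
  have : 1 ≤ e.1 ^ n := Nat.one_le_pow _ _ h
  exact_mod_cast this.trans (le_max_left _ _)

lemma ediam_stripPiece_le (n m p : ℕ) (τ : ℝ) (e : ℕ × ℕ × ℕ) (j : ℕ) :
    Metric.ediam (stripPiece n m p τ e j) ≤ ENNReal.ofReal (3 * stripWidth n m τ e) := by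
  refine Metric.ediam_le fun q ⟨⟨h1, h2, ha, hb, h3⟩, h4⟩ q' ⟨⟨h1', h2', _, _, h3'⟩, h4'⟩ => ?_
  have hH := one_le_height (n := n) (m := m) ha
  have hδ : 0 < stripWidth n m τ e := Real.rpow_pos_of_pos (by linarith) _
  have hw : (height n m e : ℝ) ^ (-τ) = height n m e * stripWidth n m τ e := by
    rw [stripWidth, neg_add, Real.rpow_add (by linarith), Real.rpow_neg_one]
    field_simp
  rw [edist_dist, Prod.dist_eq, Real.dist_eq, Real.dist_eq]
  refine ENNReal.ofReal_le_ofReal ?_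
  have hfloor := h4.trans h4'.symm
  have ha0 : (0 : ℝ) < (e.1 : ℝ) ^ n := by
    have : (0 : ℝ) < e.1 := by exact_mod_cast ha
    positivity
  have hb0 : (0 : ℝ) < (e.2.1 : ℝ) ^ m := by
    have : (0 : ℝ) < e.2.1 := by exact_mod_cast hb
    positivity
  by_cases hab : e.1 ^ n ≤ e.2.1 ^ m
  · simp only [hab, if_true] at hfloor
    have h5 := abs_sub_le_of_floor_eq hδ h1.1 h1'.1 hfloor
    have hHb : (height n m e : ℝ) = (e.2.1 : ℝ) ^ m := by
      rw [height, max_eq_right hab]; push_cast; rfl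
    have hab' : (e.1 : ℝ) ^ n ≤ (e.2.1 : ℝ) ^ m := by exact_mod_cast hab
    exact max_le (by linarith) (abs_sub_le_of_mem_strip ha0.le hab' hb0 h3 h3'
      (by rw [hw, hHb]) h5)
  · simp only [hab, if_false] at hfloor
    have h5 := abs_sub_le_of_floor_eq hδ h2.1 h2'.1 hfloor
    have hab' := (not_le.1 hab).le
    have hHb : (height n m e : ℝ) = (e.1 : ℝ) ^ n := by
      rw [height, max_eq_left hab']; push_cast; rfl
    have hab'' : (e.2.1 : ℝ) ^ m ≤ (e.1 : ℝ) ^ n := by exact_mod_cast hab'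
    rw [add_comm ((e.1 : ℝ) ^ n * _)] at h3 h3'
    exact max_le (abs_sub_le_of_mem_strip hb0.le hab'' ha0 h3 h3' (by rw [hw, hHb]) h5)
      (by linarith)

lemma exists_mem_stripPiece {n m p : ℕ} {τ : ℝ} {e : ℕ × ℕ × ℕ} {q : ℝ × ℝ}
    (hq : q ∈ strip n m p τ e) :
    ∃ j < ⌊1 / stripWidth n m τ e⌋₊ + 1, q ∈ stripPiece n m p τ e j := by
  have hδ : 0 ≤ stripWidth n m τ e := Real.rpow_nonneg (by positivity) _
  refine ⟨_, Nat.lt_succ_of_le (Nat.floor_le_floor ?_), hq, rfl⟩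
  have : (if e.1 ^ n ≤ e.2.1 ^ m then q.1 else q.2) ≤ 1 := by
    split_ifs
    exacts [hq.1.2.le, hq.2.1.2.le]
  gcongr

/-- Summable majorant of the contribution of `(a, b, c)` to the covering sum. -/
lemma height_rpow_le {n m p : ℕ} (hn : 1 ≤ n) (hm : 1 ≤ m) (hp : 1 ≤ p) {τ l : ℝ} (hτ : 0 ≤ τ)
    (hl : 0 ≤ l) {e : ℕ × ℕ × ℕ} (he : (strip n m p τ e).Nonempty) :
    (height n m e : ℝ) ^ (-(l * (1 / (n : ℝ) + 1 / (m : ℝ) + 1 / (p : ℝ)))) ≤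
      (2 ^ p * 3) ^ (l / p) * ((e.1 : ℝ) ^ (-l) * ((e.2.1 : ℝ) ^ (-l) *
        ((e.2.2 + 1 : ℕ) : ℝ) ^ (-l))) := by
  obtain ⟨q, h1, h2, ha, hb, h3⟩ := he
  have hH := one_le_height (n := n) (m := m) ha
  have hn0 : (0 : ℝ) < n := by exact_mod_cast hn
  have hm0 : (0 : ℝ) < m := by exact_mod_cast hm
  have hp0 : (0 : ℝ) < p := by exact_mod_cast hp
  have ha0 : (0 : ℝ) < e.1 := by exact_mod_cast ha
  have hb0 : (0 : ℝ) < e.2.1 := by exact_mod_cast hb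
  have haH : (e.1 : ℝ) ^ n ≤ height n m e := by exact_mod_cast le_max_left _ _
  have hbH : (e.2.1 : ℝ) ^ m ≤ height n m e := by exact_mod_cast le_max_right _ _
  have hcH : ((e.2.2 + 1 : ℕ) : ℝ) ^ p ≤ 2 ^ p * 3 * height n m e := by
    have hw := Real.rpow_le_one_of_one_le_of_nonpos hH (by linarith : -τ ≤ 0)
    have h4 : (e.2.2 : ℝ) ^ p ≤ 3 * height n m e := by
      have h5 := (abs_lt.1 h3).1
      have h6 : (e.1 : ℝ) ^ n * q.1 ≤ height n m e * 1 := by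
        have := h1.2.le; have := h1.1
        gcongr
      have h7 : (e.2.1 : ℝ) ^ m * q.2 ≤ height n m e * 1 := by
        have := h2.2.le; have := h2.1
        gcongr
      linarith
    rcases Nat.eq_zero_or_pos e.2.2 with h0 | h0
    · rw [h0]
      have : (1 : ℝ) ≤ 2 ^ p := one_le_pow₀ (by norm_num)
      simp only [zero_add, Nat.cast_one, one_pow]
      nlinarith
    · have h5 : ((e.2.2 + 1 : ℕ) : ℝ) ≤ 2 * e.2.2 := by
        have : (1 : ℝ) ≤ e.2.2 := by exact_mod_cast h0
        push_cast
        linarith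
      calc _ ≤ (2 * (e.2.2 : ℝ)) ^ p := by gcongr
        _ = 2 ^ p * (e.2.2 : ℝ) ^ p := mul_pow _ _ _
        _ ≤ 2 ^ p * (3 * height n m e) := by gcongr
        _ = _ := by ring
  have key : ∀ {x C : ℝ} {d : ℕ}, 0 < x → 0 < C → (0 : ℝ) < d → x ^ d ≤ C * height n m e →
      (height n m e : ℝ) ^ (-(l / d)) ≤ C ^ (l / d) * x ^ (-l) := by
    intro x C d hx hC hd hle
    have e1 : x ^ (-l) = (x ^ d) ^ (-(l / d)) := by
      rw [← Real.rpow_natCast, ← Real.rpow_mul hx.le]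
      congr 1; field_simp
    have e2 := Real.rpow_le_rpow_of_nonpos (pow_pos hx d) hle
      (neg_nonpos.2 (by positivity : 0 ≤ l / d))
    rw [Real.mul_rpow hC.le (by positivity), ← e1, Real.rpow_neg hC.le] at e2
    calc _ = C ^ (l / d) * ((C ^ (l / d))⁻¹ * (height n m e : ℝ) ^ (-(l / d))) := by
          field_simp
      _ ≤ _ := by gcongr
  have e1 := key ha0 one_pos hn0 (by rwa [one_mul])
  have e2 := key hb0 one_pos hm0 (by rwa [one_mul])
  have e3 := key (by positivity) (by positivity) hp0 hcH
  rw [Real.one_rpow, one_mul] at e1 e2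
  calc _ = (height n m e : ℝ) ^ (-(l / n)) * ((height n m e : ℝ) ^ (-(l / m)) *
        (height n m e : ℝ) ^ (-(l / p))) := by
        rw [← Real.rpow_add (by linarith), ← Real.rpow_add (by linarith)]
        congr 1; ring
    _ ≤ (e.1 : ℝ) ^ (-l) * ((e.2.1 : ℝ) ^ (-l) * ((2 ^ p * 3) ^ (l / p) *
        ((e.2.2 + 1 : ℕ) : ℝ) ^ (-l))) := by gcongr
    _ = _ := by ring

lemma summable_majorant {l : ℝ} (hl : 1 < l) (C : ℝ) : Summable fun e : ℕ × ℕ × ℕ =>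
    C * ((e.1 : ℝ) ^ (-l) * ((e.2.1 : ℝ) ^ (-l) * ((e.2.2 + 1 : ℕ) : ℝ) ^ (-l))) := by
  have h1 : Summable fun a : ℕ => (a : ℝ) ^ (-l) := Real.summable_nat_rpow.2 (by linarith)
  have h2 : Summable fun c : ℕ => ((c + 1 : ℕ) : ℝ) ^ (-l) :=
    (summable_nat_add_iff (f := fun c : ℕ => (c : ℝ) ^ (-l)) 1).2 h1
  have h0 : ∀ a : ℕ, 0 ≤ (a : ℝ) ^ (-l) := fun a => Real.rpow_nonneg (by positivity) _
  exact (h1.mul_of_nonneg (h1.mul_of_nonneg h2 h0 fun c => h0 (c + 1)) h0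
    fun e => mul_nonneg (h0 _) (h0 _)).mul_left C

lemma sum_ediam_stripPiece_le {n m p : ℕ} (hn : 1 ≤ n) (hm : 1 ≤ m) (hp : 1 ≤ p) {τ σ l : ℝ}
    (hτ : 0 ≤ τ) (hl : 0 ≤ l) (hσ : 0 < σ)
    (hlσ : (τ + 1) * (σ - 1) = l * (1 / (n : ℝ) + 1 / (m : ℝ) + 1 / (p : ℝ))) (e : ℕ × ℕ × ℕ) :
    ∑ j : Fin (⌊1 / stripWidth n m τ e⌋₊ + 1), Metric.ediam (stripPiece n m p τ e j) ^ σ ≤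
      ENNReal.ofReal (2 * 3 ^ σ * (2 ^ p * 3) ^ (l / p) * ((e.1 : ℝ) ^ (-l) *
        ((e.2.1 : ℝ) ^ (-l) * ((e.2.2 + 1 : ℕ) : ℝ) ^ (-l)))) := by
  rcases (strip n m p τ e).eq_empty_or_nonempty with h0 | h0
  · have : ∀ j, stripPiece n m p τ e j = ∅ := fun j =>
      eq_empty_of_forall_notMem fun q hq => (h0 ▸ hq.1 : q ∈ (∅ : Set (ℝ × ℝ)))
    simp [this, hσ]
  have hH : (1 : ℝ) ≤ height n m e := by
    obtain ⟨q, _, _, ha, _⟩ := h0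
    exact one_le_height ha
  have hδ : 0 < stripWidth n m τ e := Real.rpow_pos_of_pos (by linarith) _
  have hδ1 : stripWidth n m τ e ≤ 1 :=
    Real.rpow_le_one_of_one_le_of_nonpos hH (by linarith)
  have hcount : ((⌊1 / stripWidth n m τ e⌋₊ + 1 : ℕ) : ℝ) ≤ 2 * (stripWidth n m τ e)⁻¹ := by
    have h1 := Nat.floor_le (by positivity : 0 ≤ 1 / stripWidth n m τ e)
    have h2 := (one_le_inv₀ hδ).2 hδ1
    push_cast
    rw [one_div] at *
    linarith
  calc _ ≤ ∑ _j : Fin (⌊1 / stripWidth n m τ e⌋₊ + 1),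
        ENNReal.ofReal ((3 * stripWidth n m τ e) ^ σ) := by
        refine Finset.sum_le_sum fun j _ => ?_
        rw [← ENNReal.ofReal_rpow_of_pos (by positivity)]
        exact ENNReal.rpow_le_rpow (ediam_stripPiece_le n m p τ e j) hσ.le
    _ = ENNReal.ofReal (((⌊1 / stripWidth n m τ e⌋₊ + 1 : ℕ) : ℝ) *
          (3 * stripWidth n m τ e) ^ σ) := by
        rw [Finset.sum_const, Finset.card_univ, Fintype.card_fin, nsmul_eq_mul,
          ENNReal.ofReal_mul (by positivity), ENNReal.ofReal_natCast]
    _ ≤ _ := by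
        refine ENNReal.ofReal_le_ofReal ?_
        calc _ ≤ 2 * (stripWidth n m τ e)⁻¹ * (3 * stripWidth n m τ e) ^ σ := by gcongr
          _ = 2 * 3 ^ σ * stripWidth n m τ e ^ (σ - 1) := by
            rw [Real.mul_rpow (by norm_num) hδ.le, Real.rpow_sub_one hδ.ne']
            field_simp
          _ = 2 * 3 ^ σ * (height n m e : ℝ) ^
                (-(l * (1 / (n : ℝ) + 1 / (m : ℝ) + 1 / (p : ℝ)))) := by
            rw [stripWidth, ← Real.rpow_mul (by linarith), ← hlσ, neg_mul]
          _ ≤ 2 * 3 ^ σ * ((2 ^ p * 3) ^ (l / p) * ((e.1 : ℝ) ^ (-l) * ((e.2.1 : ℝ) ^ (-l) *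
                ((e.2.2 + 1 : ℕ) : ℝ) ^ (-l)))) := by
            gcongr
            exact height_rpow_le hn hm hp hτ hl h0
          _ = _ := by ring

lemma exists_lt_height_of_mem_approxSet {n m p : ℕ} (hn : 1 ≤ n) (hm : 1 ≤ m) (hp : 1 ≤ p) {τ : ℝ}
    (hτ : 0 ≤ τ) {q : ℝ × ℝ} (hq : q ∈ approxSet n m p τ) (k : ℕ) :
    ∃ e, k < height n m e ∧ q ∈ strip n m p τ e := by
  obtain ⟨h1, h2, h3⟩ := hq
  by_contra! hcon
  refine h3 ((finite_Iic (k, k, 3 * k)).subset ?_)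
  rintro ⟨a, b, c⟩ ⟨ha, hb, h4⟩
  simp only at ha hb h4
  have hk : height n m (a, b, c) ≤ k := by
    by_contra! hk
    exact hcon _ hk ⟨h1, h2, ha, hb, h4⟩
  have hak : a ^ n ≤ k := (le_max_left _ _).trans hk
  have hbk : b ^ m ≤ k := (le_max_right _ _).trans hk
  have hck : c ^ p ≤ 3 * k := by
    have hH := one_le_height (n := n) (m := m) (e := (a, b, c)) ha
    have hw : ((max (a ^ n) (b ^ m) : ℕ) : ℝ) ^ (-τ) ≤ 1 :=
      Real.rpow_le_one_of_one_le_of_nonpos hH (by linarith : -τ ≤ 0)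
    have h5 := (abs_lt.1 h4).1
    have hak' : (a : ℝ) ^ n ≤ k := by exact_mod_cast hak
    have hbk' : (b : ℝ) ^ m ≤ k := by exact_mod_cast hbk
    have hk' : (1 : ℝ) ≤ k := hH.trans (by exact_mod_cast hk)
    have h6 : (a : ℝ) ^ n * q.1 ≤ k * 1 := by
      have := h1.2.le; have := h1.1
      gcongr
    have h7 : (b : ℝ) ^ m * q.2 ≤ k * 1 := by
      have := h2.2.le; have := h2.1
      gcongr
    have : (c : ℝ) ^ p ≤ 3 * k := by linarith
    exact_mod_cast this
  exact ⟨(Nat.le_self_pow (by omega) a).trans hak, (Nat.le_self_pow (by omega) b).trans hbk,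
    (Nat.le_self_pow (by omega) c).trans hck⟩

lemma hausdorffMeasure_approxSet_ne_top {n m p : ℕ} (hn : 1 ≤ n) (hm : 1 ≤ m) (hp : 1 ≤ p)
    {τ σ : ℝ} (hτ : 0 ≤ τ)
    (hσ : 1 + (1 / (n : ℝ) + 1 / (m : ℝ) + 1 / (p : ℝ)) / (τ + 1) < σ) :
    μH[σ] (approxSet n m p τ) ≠ ∞ := by
  have hn0 : (0 : ℝ) < n := by exact_mod_cast hn
  have hm0 : (0 : ℝ) < m := by exact_mod_cast hm
  have hp0 : (0 : ℝ) < p := by exact_mod_cast hp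
  set P := 1 / (n : ℝ) + 1 / (m : ℝ) + 1 / (p : ℝ) with hP
  have hP0 : 0 < P := by positivity
  have hτ1 : 0 < τ + 1 := by linarith
  have hσ0 : 0 < σ := by
    have : 0 < P / (τ + 1) := by positivity
    linarith
  obtain ⟨l, hlσ⟩ : ∃ l, (τ + 1) * (σ - 1) = l * P := ⟨(τ + 1) * (σ - 1) / P, by field_simp⟩
  have hl : 1 < l := by
    have h1 : P / (τ + 1) < σ - 1 := by linarith
    rw [div_lt_iff₀ hτ1, mul_comm, hlσ] at h1
    exact lt_of_mul_lt_mul_right (by linarith) hP0.le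
  set ι := Σ e : ℕ × ℕ × ℕ, Fin (⌊1 / stripWidth n m τ e⌋₊ + 1)
  set t : ℕ → ι → Set (ℝ × ℝ) := fun k i =>
    {q | q ∈ stripPiece n m p τ i.1 i.2 ∧ k < height n m i.1} with ht
  have hr : Tendsto (fun k : ℕ => ENNReal.ofReal (3 * ((k : ℝ) + 1) ^ (-(τ + 1)))) atTop (𝓝 0) := by
    have h1 : Tendsto (fun k : ℕ => ((k : ℝ) + 1) ^ (-(τ + 1))) atTop (𝓝 0) :=
      (tendsto_rpow_neg_atTop hτ1).comp
        (tendsto_atTop_add_const_right _ _ tendsto_natCast_atTop_atTop)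
    have h2 := ENNReal.tendsto_ofReal (h1.const_mul 3)
    rwa [mul_zero, ENNReal.ofReal_zero] at h2
  have hdiam : ∀ k i, Metric.ediam (t k i) ≤ ENNReal.ofReal (3 * ((k : ℝ) + 1) ^ (-(τ + 1))) := by
    intro k i
    by_cases hk : k < height n m i.1
    · refine (Metric.ediam_mono fun q hq => hq.1).trans ((ediam_stripPiece_le n m p τ i.1 i.2).trans
        (ENNReal.ofReal_le_ofReal ?_))
      have h1 : (k : ℝ) + 1 ≤ height n m i.1 := by exact_mod_cast hk
      have := Real.rpow_le_rpow_of_nonpos (by positivity) h1 (by linarith : -(τ + 1) ≤ 0)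
      rw [stripWidth]
      gcongr
    · have : t k i = ∅ := eq_empty_of_forall_notMem fun q hq => hk hq.2
      rw [this, Metric.ediam_empty]
      exact zero_le
  have hcover : ∀ k, approxSet n m p τ ⊆ ⋃ i, t k i := by
    intro k q hq
    obtain ⟨e, h1, h2⟩ := exists_lt_height_of_mem_approxSet hn hm hp hτ hq k
    obtain ⟨j, hj, h3⟩ := exists_mem_stripPiece h2
    exact mem_iUnion.2 ⟨⟨e, j, hj⟩, h3, h1⟩
  have hsum : ∀ k, ∑' i, Metric.ediam (t k i) ^ σ ≤ ∑' e : ℕ × ℕ × ℕ,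
      ENNReal.ofReal (2 * 3 ^ σ * (2 ^ p * 3) ^ (l / p) * ((e.1 : ℝ) ^ (-l) *
        ((e.2.1 : ℝ) ^ (-l) * ((e.2.2 + 1 : ℕ) : ℝ) ^ (-l)))) := by
    intro k
    rw [ENNReal.tsum_sigma']
    refine ENNReal.tsum_le_tsum fun e => ?_
    rw [tsum_fintype]
    refine (Finset.sum_le_sum fun j _ => ?_).trans
      (sum_ediam_stripPiece_le hn hm hp hτ (by linarith) hσ0 hlσ e)
    exact ENNReal.rpow_le_rpow (Metric.ediam_mono fun q hq => hq.1) hσ0.le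
  refine ne_top_of_le_ne_top
    (summable_majorant hl (2 * 3 ^ σ * (2 ^ p * 3) ^ (l / p))).tsum_ofReal_ne_top
    ((Measure.hausdorffMeasure_le_liminf_tsum σ (approxSet n m p τ) _ hr t
      (Eventually.of_forall hdiam) (Eventually.of_forall hcover)).trans ?_)
  exact (liminf_le_liminf (Eventually.of_forall hsum)).trans_eq (liminf_const _)

theorem dimH_approxSet_le {n m p : ℕ} (hn : 1 ≤ n) (hm : 1 ≤ m) (hp : 1 ≤ p) {τ : ℝ}
    (hτ : 0 ≤ τ) :
    dimH (approxSet n m p τ) ≤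
      ENNReal.ofReal (1 + min 1 ((1 / (n : ℝ) + 1 / (m : ℝ) + 1 / (p : ℝ)) / (τ + 1))) := by
  set P := (1 / (n : ℝ) + 1 / (m : ℝ) + 1 / (p : ℝ)) / (τ + 1) with hP
  have hP0 : 0 ≤ P := by positivity
  have h2 : dimH (approxSet n m p τ) ≤ ENNReal.ofReal (1 + 1) := by
    refine (dimH_mono (subset_univ _)).trans_eq ?_
    rw [Real.dimH_univ_eq_finrank, Module.finrank_prod, Module.finrank_self]
    norm_num
  have h1 : dimH (approxSet n m p τ) ≤ ENNReal.ofReal (1 + P) := by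
    have hcont : Tendsto ENNReal.ofReal (𝓝[>] (1 + P)) (𝓝 (ENNReal.ofReal (1 + P))) :=
      (ENNReal.continuous_ofReal.tendsto _).mono_left nhdsWithin_le_nhds
    refine ge_of_tendsto hcont ?_
    filter_upwards [self_mem_nhdsWithin] with σ hσ
    have hσ' : 1 + P < σ := hσ
    refine dimH_le_of_hausdorffMeasure_ne_top (d := σ.toNNReal) ?_
    rw [Real.coe_toNNReal _ (by linarith)]
    exact hausdorffMeasure_approxSet_ne_top hn hm hp hτ hσ'
  rcases min_cases 1 P with ⟨h, _⟩ | ⟨h, _⟩ <;> rw [h]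
  exacts [h2, h1]

end

open MeasureTheory

theorem stmt18 (n m p : ℕ) (hn : 1 ≤ n) (hm : 1 ≤ m) (hp : 1 ≤ p)
    (hcase : (n = 1 ∧ m = 1 ∧ p = 1) ∨ 2 ≤ Nat.gcd n m)
    (τ : ℝ) (hτ : 1 < τ) :
    dimH {xy : ℝ × ℝ | xy.1 ∈ Set.Ico (0 : ℝ) 1 ∧ xy.2 ∈ Set.Ico (0 : ℝ) 1 ∧
        {abc : ℕ × ℕ × ℕ | 1 ≤ abc.1 ∧ 1 ≤ abc.2.1 ∧
          |(abc.1 : ℝ) ^ n * xy.1 + (abc.2.1 : ℝ) ^ m * xy.2 - (abc.2.2 : ℝ) ^ p| <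
            ((max (abc.1 ^ n) (abc.2.1 ^ m) : ℕ) : ℝ) ^ (-τ)}.Infinite} =
      ENNReal.ofReal (1 + min 1 ((1 / (n : ℝ) + 1 / (m : ℝ) + 1 / (p : ℝ)) / (τ + 1))) := by
  exact le_antisymm (dimH_approxSet_le hn hm hp (by linarith))
    (le_dimH_approxSet hn hm hp hcase hτ)
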